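/- arXiv:1910.06231 — 3 statements merged into one kernel-verified Lean document; each statement's English description precedes it below -/
import Mathlib

section
/- Let A and B be two finite sets of lines in ℝ² such that A ∪ B is in general position, and let r be a positive integer. Then there exists a convex partition (C₁, …, C_r) of ℝ² into r parts such that for every j ∈ {1, …, r} there exist subsets A_j ⊆ A and B_j ⊆ B with I(A_j) ⊆ C_j, I(B_j) ⊆ C_j, |A_j| ≥ r^{ln(2/3)}·|A|^{1/r} − 2r, and |B_j| ≥ r^{ln(2/3)}·|B|^{1/r} − 2r. -/
open scoped Classical

/-- A line in the plane: the solution set of `a*x + b*y = c` with `(a,b) ≠ (0,0)`. -/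
def IsLine (L : Set (ℝ × ℝ)) : Prop :=
  ∃ a b c : ℝ, (a, b) ≠ (0, 0) ∧ L = {p : ℝ × ℝ | a * p.1 + b * p.2 = c}

/-- The incidence set of a finite family of lines: all pairwise intersection points. -/
def incSet (L : Finset (Set (ℝ × ℝ))) : Set (ℝ × ℝ) :=
  {p | ∃ ℓ₁ ∈ L, ∃ ℓ₂ ∈ L, ℓ₁ ≠ ℓ₂ ∧ p ∈ ℓ₁ ∧ p ∈ ℓ₂}

/-- Two lines are non-parallel if they meet in exactly one point. -/
def NotParallel (L₁ L₂ : Set (ℝ × ℝ)) : Prop := ∃! p : ℝ × ℝ, p ∈ L₁ ∩ L₂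

/-- No two lines of the family are parallel. -/
def PairwiseNonParallel (L : Finset (Set (ℝ × ℝ))) : Prop :=
  ∀ ℓ₁ ∈ L, ∀ ℓ₂ ∈ L, ℓ₁ ≠ ℓ₂ → NotParallel ℓ₁ ℓ₂

/-- A family of lines is in general position: no two parallel, no three concurrent, and any
three collinear points of the incidence set lie on a common line of the family. -/
def GenPos (L : Finset (Set (ℝ × ℝ))) : Prop :=
  PairwiseNonParallel L ∧
  (∀ ℓ₁ ∈ L, ∀ ℓ₂ ∈ L, ∀ ℓ₃ ∈ L, ℓ₁ ≠ ℓ₂ → ℓ₁ ≠ ℓ₃ → ℓ₂ ≠ ℓ₃ →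
    ¬ ∃ p : ℝ × ℝ, p ∈ ℓ₁ ∧ p ∈ ℓ₂ ∧ p ∈ ℓ₃) ∧
  (∀ p q s : ℝ × ℝ, p ∈ incSet L → q ∈ incSet L → s ∈ incSet L →
    p ≠ q → p ≠ s → q ≠ s → Collinear ℝ ({p, q, s} : Set (ℝ × ℝ)) →
    ∃ ℓ ∈ L, p ∈ ℓ ∧ q ∈ ℓ ∧ s ∈ ℓ)

/-- `mu A K` is the largest cardinality of a subset of `A` whose incidence set lies in `K`. -/
noncomputable def mu (A : Finset (Set (ℝ × ℝ))) (K : Set (ℝ × ℝ)) : ℕ :=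
  (A.powerset.filter (fun A' => incSet A' ⊆ K)).sup Finset.card

/-- A convex partition of the plane into `r` parts: closed convex sets covering `ℝ²`
with pairwise disjoint interiors. -/
def ConvexPartition {r : ℕ} (C : Fin r → Set (ℝ × ℝ)) : Prop :=
  (∀ j, IsClosed (C j)) ∧ (∀ j, Convex ℝ (C j)) ∧
  (⋃ j, C j) = Set.univ ∧
  Pairwise fun i j => interior (C i) ∩ interior (C j) = ∅

theorem exists_chain_or_antichain {α : Type*} (s : Finset α) (R : α → α → Prop)
    (irr : ∀ x ∈ s, ¬ R x x)
    (tr : ∀ x ∈ s, ∀ y ∈ s, ∀ z ∈ s, R x y → R y z → R x z) (M : ℝ) :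
    (∃ t ⊆ s, (∀ x ∈ t, ∀ y ∈ t, x ≠ y → R x y ∨ R y x) ∧ M ≤ (t.card : ℝ)) ∨
    (∃ t ⊆ s, (∀ x ∈ t, ∀ y ∈ t, ¬ R x y) ∧ (s.card : ℝ) ≤ t.card * M) := by
  by_cases h : ∃ t ⊆ s, (∀ x ∈ t, ∀ y ∈ t, x ≠ y → R x y ∨ R y x) ∧ M ≤ (t.card : ℝ)
  · exact Or.inl h
  right
  push Not at h
  rcases s.eq_empty_or_nonempty with rfl | hs
  · exact ⟨∅, by simp⟩
  let F : α → Finset (Finset α) := fun x => s.powerset.filter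
    (fun t => (∀ x ∈ t, ∀ y ∈ t, x ≠ y → R x y ∨ R y x) ∧ ∀ z ∈ t, R z x)
  let c : α → ℕ := fun x => (F x).sup Finset.card
  have hF : ∀ x, (F x).Nonempty := fun x => ⟨∅, by simp [F]⟩
  have hext : ∀ x ∈ s, ∃ t ⊆ s, x ∉ t ∧ t.card = c x ∧
      (∀ a ∈ insert x t, ∀ b ∈ insert x t, a ≠ b → R a b ∨ R b a) ∧ ∀ z ∈ t, R z x := by
    intro x hx
    obtain ⟨t, ht, htc⟩ := Finset.exists_mem_eq_sup (F x) (hF x) Finset.card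
    simp only [F, Finset.mem_filter, Finset.mem_powerset] at ht
    obtain ⟨hts, hch, hbel⟩ := ht
    refine ⟨t, hts, fun hxt => irr x hx (hbel x hxt), htc.symm, ?_, hbel⟩
    intro a ha b hb hab
    rw [Finset.mem_insert] at ha hb
    rcases ha with rfl | ha <;> rcases hb with rfl | hb
    · exact absurd rfl hab
    · exact Or.inr (hbel b hb)
    · exact Or.inl (hbel a ha)
    · exact hch a ha b hb hab
  have hlt : ∀ x ∈ s, ∀ y ∈ s, R x y → c x < c y := by
    intro x hx y hy hxy
    obtain ⟨t, hts, hxt, htc, hch, hbel⟩ := hext x hx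
    have : insert x t ∈ F y := by
      simp only [F, Finset.mem_filter, Finset.mem_powerset]
      refine ⟨Finset.insert_subset hx hts, hch, ?_⟩
      intro z hz
      rw [Finset.mem_insert] at hz
      rcases hz with rfl | hz
      · exact hxy
      · exact tr z (hts hz) x hx y hy (hbel z hz) hxy
    have h2 := Finset.le_sup (f := Finset.card) this
    rw [Finset.card_insert_of_notMem hxt, htc] at h2
    exact h2
  have hcM : ∀ x ∈ s, (c x : ℝ) + 1 < M := by
    intro x hx
    obtain ⟨t, hts, hxt, htc, hch, -⟩ := hext x hx
    have := h (insert x t) (Finset.insert_subset hx hts) hch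
    rw [Finset.card_insert_of_notMem hxt, htc] at this
    exact_mod_cast this
  let k : ℕ := s.sup c + 1
  have hkM : (k : ℝ) ≤ M := by
    obtain ⟨x, hx, hxc⟩ := Finset.exists_mem_eq_sup s hs c
    have := hcM x hx
    simp only [k, hxc]
    push_cast
    exact this.le
  have hmap : ∀ x ∈ s, c x ∈ Finset.range k := fun x hx =>
    Finset.mem_range.2 (Nat.lt_succ_of_le (Finset.le_sup hx))
  have hk0 : (0 : ℝ) < k := by positivity
  obtain ⟨i, -, hi⟩ := Finset.exists_le_card_fiber_of_nsmul_le_card_of_maps_to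
    (M := ℝ) (b := (s.card : ℝ) / k) hmap ⟨0, by simp [k]⟩
    (by rw [Finset.card_range, nsmul_eq_mul]; field_simp; exact le_rfl)
  refine ⟨s.filter (fun x => c x = i), Finset.filter_subset _ _, ?_, ?_⟩
  · intro x hx y hy hxy
    rw [Finset.mem_filter] at hx hy
    have := hlt x hx.1 y hy.1 hxy
    omega
  · rw [div_le_iff₀ hk0] at hi
    refine hi.trans ?_
    gcongr

/-- `K` encloses at least `m` lines of `A`. -/
def Encloses (A : Finset (Set (ℝ × ℝ))) (K : Set (ℝ × ℝ)) (m : ℝ) : Prop :=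
  ∃ S ⊆ A, incSet S ⊆ K ∧ m ≤ (S.card : ℝ)

theorem Encloses.mono {A : Finset (Set (ℝ × ℝ))} {K K' : Set (ℝ × ℝ)} {m m' : ℝ}
    (h : Encloses A K m) (hK : K ⊆ K') (hm : m' ≤ m) : Encloses A K' m' := by
  obtain ⟨S, hS, hSK, hSm⟩ := h
  exact ⟨S, hS, hSK.trans hK, hm.trans hSm⟩

theorem incSet_mono {A B : Finset (Set (ℝ × ℝ))} (h : A ⊆ B) : incSet A ⊆ incSet B := by
  rintro p ⟨ℓ₁, h₁, ℓ₂, h₂, hne, hp⟩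
  exact ⟨ℓ₁, h h₁, ℓ₂, h h₂, hne, hp⟩

theorem Encloses.mono_on {A : Finset (Set (ℝ × ℝ))} {K K' : Set (ℝ × ℝ)} {m m' : ℝ}
    (h : Encloses A K m) (hK : ∀ q ∈ incSet A, q ∈ K → q ∈ K') (hm : m' ≤ m) :
    Encloses A K' m' := by
  obtain ⟨S, hS, hSK, hSm⟩ := h
  exact ⟨S, hS, fun q hq => hK q (incSet_mono hS hq) (hSK hq), hm.trans hSm⟩

theorem Encloses.of_subset {A B : Finset (Set (ℝ × ℝ))} {K : Set (ℝ × ℝ)} {m : ℝ}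
    (h : Encloses A K m) (hAB : A ⊆ B) : Encloses B K m := by
  obtain ⟨S, hS, hSK⟩ := h
  exact ⟨S, hS.trans hAB, hSK⟩

/-- A finite family of pairwise non-parallel lines. -/
def LineFamily (A : Finset (Set (ℝ × ℝ))) : Prop :=
  (∀ ℓ ∈ A, IsLine ℓ) ∧ PairwiseNonParallel A

theorem LineFamily.subset {A B : Finset (Set (ℝ × ℝ))} (h : LineFamily B) (hAB : A ⊆ B) :
    LineFamily A :=
  ⟨fun ℓ hℓ => h.1 ℓ (hAB hℓ), fun ℓ₁ h₁ ℓ₂ h₂ => h.2 ℓ₁ (hAB h₁) ℓ₂ (hAB h₂)⟩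

/-- `d` is a direction vector of the line `ℓ`. -/
def HasDir (ℓ : Set (ℝ × ℝ)) (d : ℝ × ℝ) : Prop :=
  d ≠ 0 ∧ ∀ p ∈ ℓ, ∀ q, q ∈ ℓ ↔ ∃ c : ℝ, q = p + c • d

theorem HasDir.neg {ℓ : Set (ℝ × ℝ)} {d : ℝ × ℝ} (h : HasDir ℓ d) : HasDir ℓ (-d) := by
  refine ⟨neg_ne_zero.2 h.1, fun p hp q => (h.2 p hp q).trans ?_⟩
  constructor
  · rintro ⟨c, rfl⟩
    exact ⟨-c, by simp⟩
  · rintro ⟨c, rfl⟩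
    exact ⟨-c, by simp⟩

theorem IsLine.exists_hasDir {ℓ : Set (ℝ × ℝ)} (h : IsLine ℓ) : ∃ d, HasDir ℓ d := by
  obtain ⟨a, b, c, hab, rfl⟩ := h
  have hpos : 0 < a ^ 2 + b ^ 2 := by
    by_contra hcon
    have ha : a = 0 := by nlinarith [sq_nonneg a, sq_nonneg b]
    have hb : b = 0 := by nlinarith [sq_nonneg a, sq_nonneg b]
    exact hab (by rw [ha, hb])
  refine ⟨(-b, a), ?_, ?_⟩
  · intro h0
    rw [Prod.ext_iff] at h0
    apply hab
    simp at h0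
    simp [h0.1, h0.2]
  rintro ⟨x, y⟩ hp ⟨u, v⟩
  simp only [Set.mem_ofPred_eq] at hp ⊢
  constructor
  · intro hq
    refine ⟨(a * (v - y) - b * (u - x)) / (a ^ 2 + b ^ 2), ?_⟩
    ext
    · simp
      field_simp
      linear_combination a * hq - a * hp
    · simp
      field_simp
      linear_combination b * hq - b * hp
  · rintro ⟨t, ht⟩
    rw [Prod.ext_iff] at ht
    simp at ht
    rw [ht.1, ht.2]
    linear_combination hp

/-- The cross product of two plane vectors. -/
def cross (d e : ℝ × ℝ) : ℝ := d.1 * e.2 - d.2 * e.1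

theorem cross_ne_zero_of_notParallel {ℓ₁ ℓ₂ : Set (ℝ × ℝ)} {d₁ d₂ : ℝ × ℝ}
    (h : NotParallel ℓ₁ ℓ₂) (h₁ : HasDir ℓ₁ d₁) (h₂ : HasDir ℓ₂ d₂) : cross d₁ d₂ ≠ 0 := by
  obtain ⟨p, ⟨hp₁, hp₂⟩, huniq⟩ := h
  intro hc
  have hd₂ : 0 < d₂.1 ^ 2 + d₂.2 ^ 2 := by
    by_contra hcon
    have ha : d₂.1 = 0 := by nlinarith [sq_nonneg d₂.1, sq_nonneg d₂.2]
    have hb : d₂.2 = 0 := by nlinarith [sq_nonneg d₂.1, sq_nonneg d₂.2]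
    exact h₂.1 (Prod.ext ha hb)
  have hd : d₁ = ((d₁.1 * d₂.1 + d₁.2 * d₂.2) / (d₂.1 ^ 2 + d₂.2 ^ 2)) • d₂ := by
    unfold cross at hc
    ext
    · simp
      field_simp
      linear_combination d₂.2 * hc
    · simp
      field_simp
      linear_combination (-d₂.1) * hc
  have := huniq (p + d₁) ⟨(h₁.2 p hp₁ _).2 ⟨1, by simp⟩, (h₂.2 p hp₂ _).2 ⟨_, by rw [← hd]⟩⟩
  exact h₁.1 (by simpa using this)

theorem mem_of_middle_direction {X : Set (ℝ × ℝ)} {K : Set (ℝ × ℝ)}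
    (hX : ∀ q ∈ X, ∀ d ∈ K, ∀ c : ℝ, 0 ≤ c → q + c • d ∈ X)
    {d₁ d₂ d₃ : ℝ × ℝ} (hd₁ : d₁ ∈ K) (hd₃ : d₃ ∈ K)
    (h₁₂ : 0 < cross d₁ d₂) (h₂₃ : 0 < cross d₂ d₃) (h₁₃ : 0 < cross d₁ d₃)
    {p₁₂ p₂₃ p₁₃ : ℝ × ℝ} {a b c : ℝ} (ha : p₁₃ = p₁₂ + a • d₁) (hb : p₂₃ = p₁₂ + b • d₂)
    (hc : p₁₃ = p₂₃ + c • d₃) (hp₁₂ : p₁₂ ∈ X) (hp₂₃ : p₂₃ ∈ X) : p₁₃ ∈ X := by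
  have hkey : ∀ i : (ℝ × ℝ) → ℝ, (i = Prod.fst ∨ i = Prod.snd) →
      a * i d₁ = b * i d₂ + c * i d₃ := by
    have h1 := congrArg Prod.fst ha
    have h2 := congrArg Prod.snd ha
    have h3 := congrArg Prod.fst hb
    have h4 := congrArg Prod.snd hb
    have h5 := congrArg Prod.fst hc
    have h6 := congrArg Prod.snd hc
    simp at h1 h2 h3 h4 h5 h6
    rintro i (rfl | rfl) <;> linarith
  have k1 := hkey _ (Or.inl rfl)
  have k2 := hkey _ (Or.inr rfl)
  unfold cross at *
  have e1 : a * (d₁.1 * d₃.2 - d₁.2 * d₃.1) = b * (d₂.1 * d₃.2 - d₂.2 * d₃.1) := by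
    linear_combination d₃.2 * k1 - d₃.1 * k2
  have e2 : c * (d₁.1 * d₃.2 - d₁.2 * d₃.1) = -b * (d₁.1 * d₂.2 - d₁.2 * d₂.1) := by
    linear_combination d₁.2 * k1 - d₁.1 * k2
  rcases le_total 0 b with hb0 | hb0
  · have : 0 ≤ a := by
      by_contra hcon
      push Not at hcon
      nlinarith [mul_nonneg hb0 h₂₃.le, mul_pos (neg_pos.2 hcon) h₁₃]
    rw [ha]
    exact hX _ hp₁₂ _ hd₁ _ this
  · have : 0 ≤ c := by
      by_contra hcon
      push Not at hcon
      nlinarith [mul_nonneg (neg_nonneg.2 hb0) h₁₂.le, mul_pos (neg_pos.2 hcon) h₁₃]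
    rw [hc]
    exact hX _ hp₂₃ _ hd₃ _ this

theorem encloses_or_encloses_compl {A : Finset (Set (ℝ × ℝ))} (hA : LineFamily A)
    (X K : Set (ℝ × ℝ)) (hX : ∀ q ∈ X, ∀ d ∈ K, ∀ c : ℝ, 0 ≤ c → q + c • d ∈ X)
    (g : ℝ × ℝ) (hg0 : g ≠ 0) (hg : ∀ d ∈ K, 0 ≤ g.1 * d.1 + g.2 * d.2)
    (hdir : ∀ ℓ ∈ A, ∃ d ∈ K, HasDir ℓ d) {M N : ℝ} (hM : 0 < M) (hMN : M * N ≤ A.card) :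
    Encloses A X M ∨ Encloses A Xᶜ N := by
  choose! d hdK hd using hdir
  have hcr : ∀ x ∈ A, ∀ y ∈ A, x ≠ y → cross (d x) (d y) ≠ 0 := fun x hx y hy hxy =>
    cross_ne_zero_of_notParallel (hA.2 x hx y hy hxy) (hd x hx) (hd y hy)
  have hself : ∀ v, cross v v = 0 := fun v => by unfold cross; ring
  have hanti : ∀ v w, cross w v = - cross v w := fun v w => by unfold cross; ring
  have hctr : ∀ x ∈ A, ∀ y ∈ A, ∀ z ∈ A, 0 < cross (d x) (d y) → 0 < cross (d y) (d z) →
      0 < cross (d x) (d z) := by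
    intro x hx y hy z hz hxy hyz
    have gx := hg _ (hdK x hx)
    have gy := hg _ (hdK y hy)
    have gz := hg _ (hdK z hz)
    have hid : cross (d y) (d z) * (g.1 * (d x).1 + g.2 * (d x).2) +
        cross (d x) (d y) * (g.1 * (d z).1 + g.2 * (d z).2) =
        cross (d x) (d z) * (g.1 * (d y).1 + g.2 * (d y).2) := by
      unfold cross; ring
    have hne : x ≠ z := by
      rintro rfl
      rw [hanti] at hyz
      linarith
    have hxz := hcr x hx z hz hne
    by_contra hcon
    have hneg : cross (d x) (d z) < 0 := lt_of_le_of_ne (not_lt.1 hcon) hxz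
    have hx0 : g.1 * (d x).1 + g.2 * (d x).2 = 0 := by
      nlinarith [mul_nonneg hyz.le gx, mul_nonneg hxy.le gz, mul_nonneg (neg_pos.2 hneg).le gy]
    have hz0 : g.1 * (d z).1 + g.2 * (d z).2 = 0 := by
      nlinarith [mul_nonneg hyz.le gx, mul_nonneg hxy.le gz, mul_nonneg (neg_pos.2 hneg).le gy]
    apply hg0
    have e1 : g.1 * cross (d x) (d z) = 0 := by
      unfold cross; linear_combination (d z).2 * hx0 - (d x).2 * hz0
    have e2 : g.2 * cross (d x) (d z) = 0 := by
      unfold cross; linear_combination (d x).1 * hz0 - (d z).1 * hx0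
    exact Prod.ext ((mul_eq_zero.1 e1).resolve_right hxz) ((mul_eq_zero.1 e2).resolve_right hxz)
  let R : Set (ℝ × ℝ) → Set (ℝ × ℝ) → Prop := fun x y =>
    0 < cross (d x) (d y) ∧ ∀ p, p ∈ x → p ∈ y → p ∈ X
  have hne_of : ∀ x y, 0 < cross (d x) (d y) → x ≠ y := by
    rintro x y h rfl
    rw [hself] at h
    exact lt_irrefl _ h
  have htrans : ∀ x ∈ A, ∀ y ∈ A, ∀ z ∈ A, R x y → R y z → R x z := by
    rintro x hx y hy z hz ⟨hxy, hxyX⟩ ⟨hyz, hyzX⟩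
    have hxz := hctr x hx y hy z hz hxy hyz
    refine ⟨hxz, fun p hpx hpz => ?_⟩
    obtain ⟨q, ⟨hqx, hqy⟩, -⟩ := hA.2 x hx y hy (hne_of _ _ hxy)
    obtain ⟨s, ⟨hsy, hsz⟩, -⟩ := hA.2 y hy z hz (hne_of _ _ hyz)
    obtain ⟨a, ha⟩ := ((hd x hx).2 q hqx p).1 hpx
    obtain ⟨b, hb⟩ := ((hd y hy).2 q hqy s).1 hsy
    obtain ⟨c, hc⟩ := ((hd z hz).2 s hsz p).1 hpz
    exact mem_of_middle_direction hX (hdK x hx) (hdK z hz) hxy hyz hxz ha hb hc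
      (hxyX q hqx hqy) (hyzX s hsy hsz)
  rcases exists_chain_or_antichain A R (fun x _ h => hne_of x x h.1 rfl) htrans M with
    ⟨t, htA, hch, hcard⟩ | ⟨t, htA, hanti', hcard⟩
  · left
    refine ⟨t, htA, ?_, hcard⟩
    rintro p ⟨x, hx, y, hy, hxy, hpx, hpy⟩
    rcases hch x hx y hy hxy with h | h
    · exact h.2 p hpx hpy
    · exact h.2 p hpy hpx
  · right
    refine ⟨t, htA, ?_, ?_⟩
    · have main : ∀ x ∈ t, ∀ y ∈ t, 0 < cross (d x) (d y) → ∀ p, p ∈ x → p ∈ y → p ∉ X := by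
        intro x hx y hy hxy p hpx hpy hpX
        refine hanti' x hx y hy ⟨hxy, fun q hqx hqy => ?_⟩
        have := (hA.2 x (htA hx) y (htA hy) (hne_of x y hxy)).unique ⟨hqx, hqy⟩ ⟨hpx, hpy⟩
        rwa [this]
      rintro p ⟨x, hx, y, hy, hxy, hpx, hpy⟩
      rcases lt_or_gt_of_ne (hcr x (htA hx) y (htA hy) hxy) with h | h
      · exact main y hy x hx (by rw [hanti]; linarith) p hpy hpx
      · exact main x hx y hy h p hpx hpy
    · have : M * N ≤ M * t.card := by rw [mul_comm M (t.card : ℝ)]; exact hMN.trans hcard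
      exact le_of_mul_le_mul_left this hM

/-- The value at `q` of the linear functional with coefficients `e`. -/
def lin (e q : ℝ × ℝ) : ℝ := e.1 * q.1 + e.2 * q.2

theorem lin_add_smul (e q d : ℝ × ℝ) (c : ℝ) : lin e (q + c • d) = lin e q + c * lin e d := by
  simp [lin]; ring

theorem encloses_halfplane {A : Finset (Set (ℝ × ℝ))} (hA : LineFamily A) {e : ℝ × ℝ}
    (he : e ≠ 0) (t : ℝ) {M N : ℝ} (hM : 0 < M) (hMN : M * N ≤ A.card) :
    Encloses A {q | t < lin e q} M ∨ Encloses A {q | lin e q ≤ t} N := by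
  have h := encloses_or_encloses_compl hA {q | t < lin e q} {d | 0 ≤ lin e d} ?_ e he
    (fun d hd => hd) ?_ hM hMN
  · refine h.imp_right fun h => h.mono (fun q hq => ?_) le_rfl
    simpa using hq
  · intro q hq d hd c hc
    simp only [Set.mem_ofPred_eq, lin_add_smul] at hq hd ⊢
    nlinarith [mul_nonneg hc hd]
  · intro ℓ hℓ
    obtain ⟨d, hd⟩ := (hA.1 ℓ hℓ).exists_hasDir
    rcases le_total 0 (lin e d) with h | h
    · exact ⟨d, h, hd⟩
    · refine ⟨-d, ?_, hd.neg⟩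
      simp only [lin, Set.mem_ofPred_eq, Prod.fst_neg, Prod.snd_neg] at h ⊢
      linarith

theorem encloses_three {A : Finset (Set (ℝ × ℝ))} (hA : LineFamily A)
    (X Y Z K : Set (ℝ × ℝ)) (hX : ∀ q ∈ X, ∀ d ∈ K, ∀ c : ℝ, 0 ≤ c → q + c • d ∈ X)
    (g : ℝ × ℝ) (hg0 : g ≠ 0) (hg : ∀ d ∈ K, 0 ≤ lin g d)
    (hdir : ∀ ℓ ∈ A, ∃ d ∈ K, HasDir ℓ d) {e : ℝ × ℝ} (he : e ≠ 0) (t : ℝ)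
    (hY : ∀ q, q ∉ X → t < lin e q → q ∈ Y) (hZ : ∀ q, q ∉ X → lin e q ≤ t → q ∈ Z)
    {M₁ M₂ M₃ : ℝ} (h₁ : 0 < M₁) (h₂ : 0 < M₂) (hM : M₁ * M₂ * M₃ ≤ A.card) :
    Encloses A X M₁ ∨ Encloses A Y M₂ ∨ Encloses A Z M₃ := by
  rcases encloses_or_encloses_compl hA X K hX g hg0 hg hdir h₁
    (N := M₂ * M₃) (by linarith) with h | ⟨S, hS, hSX, hcard⟩
  · exact Or.inl h
  right
  rcases encloses_halfplane (hA.subset hS) he t h₂ hcard with h | h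
  · exact Or.inl ((h.mono_on (fun q hq hq' => hY q (hSX hq) hq') le_rfl).of_subset hS)
  · exact Or.inr ((h.mono_on (fun q hq hq' => hZ q (hSX hq) hq') le_rfl).of_subset hS)

theorem lin_sub (e q p : ℝ × ℝ) : lin e (q - p) = lin e q - lin e p := by
  simp [lin]; ring

/-- The wedge to the left of the downward vertical ray from `p`, of angle `θ`. -/
def leftWedge (p : ℝ × ℝ) (θ : ℝ) : Set (ℝ × ℝ) :=
  {q | q.1 ≤ p.1 ∧ 0 ≤ lin (Real.cos θ, -Real.sin θ) (q - p)}

/-- The wedge to the right of the downward vertical ray from `p`, of angle `θ`. -/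
def rightWedge (p : ℝ × ℝ) (θ : ℝ) : Set (ℝ × ℝ) :=
  {q | p.1 ≤ q.1 ∧ 0 ≤ lin (-Real.cos θ, -Real.sin θ) (q - p)}

/-- The wedge with apex `p` complementary to `leftWedge p θ₁` and `rightWedge p θ₂`. -/
def topWedge (p : ℝ × ℝ) (θ₁ θ₂ : ℝ) : Set (ℝ × ℝ) :=
  {q | lin (Real.cos θ₁, -Real.sin θ₁) (q - p) ≤ 0 ∧
    lin (-Real.cos θ₂, -Real.sin θ₂) (q - p) ≤ 0}

theorem cos_sin_ne_zero (θ : ℝ) : ((Real.cos θ, -Real.sin θ) : ℝ × ℝ) ≠ 0 := by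
  intro h
  rw [Prod.ext_iff] at h
  simp at h
  have := Real.sin_sq_add_cos_sq θ
  rw [h.1, h.2] at this
  norm_num at this

theorem neg_cos_sin_ne_zero (θ : ℝ) : ((-Real.cos θ, -Real.sin θ) : ℝ × ℝ) ≠ 0 := by
  intro h
  rw [Prod.ext_iff] at h
  simp at h
  have := Real.sin_sq_add_cos_sq θ
  rw [h.1, h.2] at this
  norm_num at this

theorem eq_zero_or_pi_of_sin_eq_zero {θ : ℝ} (h0 : 0 ≤ θ) (hπ : θ ≤ Real.pi)
    (h : Real.sin θ = 0) : θ = 0 ∨ θ = Real.pi := by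
  by_contra hcon
  push Not at hcon
  exact (Real.sin_pos_of_pos_of_lt_pi (lt_of_le_of_ne h0 hcon.1.symm)
    (lt_of_le_of_ne hπ hcon.2)).ne' h

theorem sin_add_nonpos {θ₁ θ₂ : ℝ} (hπ₁ : θ₁ ≤ Real.pi) (hπ₂ : θ₂ ≤ Real.pi)
    (hsum : Real.pi ≤ θ₁ + θ₂) : Real.sin (θ₁ + θ₂) ≤ 0 := by
  have h := Real.sin_nonneg_of_nonneg_of_le_pi (x := θ₁ + θ₂ - Real.pi) (by linarith)
    (by linarith)
  rw [Real.sin_sub_pi] at h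
  linarith

theorem right_pos_of_left_pos {θ₁ θ₂ : ℝ} (h₁ : 0 ≤ θ₁) (hπ₁ : θ₁ ≤ Real.pi) (h₂ : 0 ≤ θ₂)
    (hπ₂ : θ₂ ≤ Real.pi) (hsum : Real.pi ≤ θ₁ + θ₂) {v : ℝ × ℝ} (hv : 0 < v.1)
    (h : 0 < lin (Real.cos θ₁, -Real.sin θ₁) v) :
    0 < lin (-Real.cos θ₂, -Real.sin θ₂) v := by
  have hs := sin_add_nonpos hπ₁ hπ₂ hsum
  rw [Real.sin_add] at hs
  have hs1 := Real.sin_nonneg_of_nonneg_of_le_pi h₁ hπ₁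
  have hs2 := Real.sin_nonneg_of_nonneg_of_le_pi h₂ hπ₂
  unfold lin at *
  simp only at *
  rcases hs1.eq_or_lt with h0 | h0
  · rcases eq_zero_or_pi_of_sin_eq_zero h₁ hπ₁ h0.symm with rfl | rfl
    · obtain rfl : θ₂ = Real.pi := by linarith
      simp at h ⊢
      exact hv
    · simp at h
      linarith
  rcases hs2.eq_or_lt with h0' | h0'
  · rcases eq_zero_or_pi_of_sin_eq_zero h₂ hπ₂ h0'.symm with rfl | rfl
    · obtain rfl : θ₁ = Real.pi := by linarith
      simp at h0
    · simp
      exact hv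
  have e1 := mul_pos h0' h
  have e2 := mul_nonneg hv.le (neg_nonneg.2 hs)
  by_contra hcon
  push Not at hcon
  nlinarith [mul_nonneg h0.le (neg_nonneg.2 hcon)]

theorem left_pos_of_right_pos {θ₁ θ₂ : ℝ} (h₁ : 0 ≤ θ₁) (hπ₁ : θ₁ ≤ Real.pi) (h₂ : 0 ≤ θ₂)
    (hπ₂ : θ₂ ≤ Real.pi) (hsum : Real.pi ≤ θ₁ + θ₂) {v : ℝ × ℝ} (hv : v.1 < 0)
    (h : 0 < lin (-Real.cos θ₂, -Real.sin θ₂) v) :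
    0 < lin (Real.cos θ₁, -Real.sin θ₁) v := by
  have := right_pos_of_left_pos h₂ hπ₂ h₁ hπ₁ (by linarith) (v := (-v.1, v.2))
    (by simpa using hv) (by simpa [lin] using h)
  simpa [lin] using this

theorem exists_two_thirds {α : Type*} (A : Finset α) (P₁ P₂ P₃ : α → Prop)
    (h : ∀ x ∈ A, (P₁ x ∧ P₂ x) ∨ (P₁ x ∧ P₃ x) ∨ (P₂ x ∧ P₃ x)) :
    (2 / 3 * A.card : ℝ) ≤ (A.filter P₁).card ∨ (2 / 3 * A.card : ℝ) ≤ (A.filter P₂).card ∨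
      (2 / 3 * A.card : ℝ) ≤ (A.filter P₃).card := by
  have hsum : 2 * A.card ≤ (A.filter P₁).card + (A.filter P₂).card + (A.filter P₃).card := by
    rw [Finset.card_filter, Finset.card_filter, Finset.card_filter, ← Finset.sum_add_distrib,
      ← Finset.sum_add_distrib, mul_comm, ← smul_eq_mul]
    apply Finset.card_nsmul_le_sum
    intro x hx
    rcases h x hx with h | h | h <;> simp only [h.1, h.2, if_true] <;> split_ifs <;> omega
  have hsum' : (2 * A.card : ℝ) ≤ (A.filter P₁).card + (A.filter P₂).card +
      (A.filter P₃).card := by exact_mod_cast hsum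
  by_contra hcon
  push Not at hcon
  linarith [hcon.1, hcon.2.1, hcon.2.2]

theorem direction_in_two_cones {θ₁ θ₂ : ℝ} (h₁ : 0 ≤ θ₁) (hπ₁ : θ₁ ≤ Real.pi) (h₂ : 0 ≤ θ₂)
    (hπ₂ : θ₂ ≤ Real.pi) (hsum : Real.pi ≤ θ₁ + θ₂) {ℓ : Set (ℝ × ℝ)} (hℓ : IsLine ℓ) :
    let P₁ := ∃ d ∈ leftWedge 0 θ₁, HasDir ℓ d
    let P₂ := ∃ d ∈ rightWedge 0 θ₂, HasDir ℓ d
    let P₃ := ∃ d ∈ topWedge 0 θ₁ θ₂, HasDir ℓ d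
    (P₁ ∧ P₂) ∨ (P₁ ∧ P₃) ∨ (P₂ ∧ P₃) := by
  intro P₁ P₂ P₃
  have hs1 := Real.sin_nonneg_of_nonneg_of_le_pi h₁ hπ₁
  have hs2 := Real.sin_nonneg_of_nonneg_of_le_pi h₂ hπ₂
  obtain ⟨d, hd, hdu⟩ : ∃ d, HasDir ℓ d ∧ (d.1 < 0 ∨ (d.1 = 0 ∧ d.2 ≤ 0)) := by
    obtain ⟨d, hd⟩ := hℓ.exists_hasDir
    rcases lt_trichotomy d.1 0 with h | h | h
    · exact ⟨d, hd, Or.inl h⟩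
    · rcases le_total d.2 0 with h' | h'
      · exact ⟨d, hd, Or.inr ⟨h, h'⟩⟩
      · exact ⟨-d, hd.neg, Or.inr ⟨by simpa using h, by simpa using h'⟩⟩
    · exact ⟨-d, hd.neg, Or.inl (by simpa using h)⟩
  rcases hdu with hu | ⟨hu, hw⟩
  · have hneg₁ : lin (Real.cos θ₁, -Real.sin θ₁) (-d) = -lin (Real.cos θ₁, -Real.sin θ₁) d := by
      simp [lin]; ring
    have hneg₂ : lin (-Real.cos θ₂, -Real.sin θ₂) (-d) =
        -lin (-Real.cos θ₂, -Real.sin θ₂) d := by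
      simp [lin]; ring
    have hu' : (0 : ℝ) ≤ (-d).1 := by simpa using hu.le
    rcases le_or_gt 0 (lin (Real.cos θ₁, -Real.sin θ₁) d) with hf | hf
    · have hP₁ : P₁ := ⟨d, ⟨hu.le, by simpa using hf⟩, hd⟩
      rcases le_or_gt 0 (lin (-Real.cos θ₂, -Real.sin θ₂) (-d)) with hf' | hf'
      · exact Or.inl ⟨hP₁, -d, ⟨hu', by simpa using hf'⟩, hd.neg⟩
      · refine Or.inr (Or.inl ⟨hP₁, -d, ⟨?_, ?_⟩, hd.neg⟩)
        · rw [sub_zero, hneg₁]; linarith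
        · rw [sub_zero]; exact hf'.le
    · have hf' : lin (-Real.cos θ₂, -Real.sin θ₂) d ≤ 0 := by
        by_contra hcon
        exact hf.not_gt (left_pos_of_right_pos h₁ hπ₁ h₂ hπ₂ hsum hu (not_le.1 hcon))
      refine Or.inr (Or.inr ⟨⟨-d, ⟨hu', ?_⟩, hd.neg⟩, d, ⟨?_, ?_⟩, hd⟩)
      · rw [sub_zero, hneg₂]; linarith
      · rw [sub_zero]; exact hf.le
      · rw [sub_zero]; exact hf'
  · left
    exact ⟨⟨d, ⟨by simp [hu], by simp [lin, hu]; nlinarith⟩, hd⟩,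
      ⟨d, ⟨by simp [hu], by simp [lin, hu]; nlinarith⟩, hd⟩⟩

theorem encloses_wedges {A : Finset (Set (ℝ × ℝ))} (hA : LineFamily A) (p : ℝ × ℝ) {θ₁ θ₂ : ℝ}
    (h₁ : 0 ≤ θ₁) (hπ₁ : θ₁ ≤ Real.pi) (h₂ : 0 ≤ θ₂) (hπ₂ : θ₂ ≤ Real.pi)
    (hsum : Real.pi ≤ θ₁ + θ₂) {M₁ M₂ M₃ : ℝ} (hM₁ : 0 < M₁) (hM₂ : 0 < M₂) (hM₃ : 0 < M₃)
    (hM : M₁ * M₂ * M₃ ≤ 2 / 3 * A.card) :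
    Encloses A {q | q.1 ≤ p.1 ∧ 0 < lin (Real.cos θ₁, -Real.sin θ₁) (q - p)} M₁ ∨
      Encloses A {q | p.1 ≤ q.1 ∧ 0 < lin (-Real.cos θ₂, -Real.sin θ₂) (q - p)} M₂ ∨
      Encloses A (topWedge p θ₁ θ₂) M₃ := by
  have hR : ∀ q : ℝ × ℝ, p.1 < q.1 → 0 < lin (Real.cos θ₁, -Real.sin θ₁) (q - p) →
      0 < lin (-Real.cos θ₂, -Real.sin θ₂) (q - p) := fun q hq =>
    right_pos_of_left_pos h₁ hπ₁ h₂ hπ₂ hsum (by simpa using hq)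
  have hL : ∀ q : ℝ × ℝ, q.1 < p.1 → 0 < lin (-Real.cos θ₂, -Real.sin θ₂) (q - p) →
      0 < lin (Real.cos θ₁, -Real.sin θ₁) (q - p) := fun q hq =>
    left_pos_of_right_pos h₁ hπ₁ h₂ hπ₂ hsum (by simpa using hq)
  have hadd : ∀ (e q d : ℝ × ℝ) (c : ℝ), lin e (q + c • d - p) = lin e (q - p) + c * lin e d := by
    intro e q d c
    rw [lin_sub, lin_sub, lin_add_smul]; ring
  rcases exists_two_thirds A _ _ _
    (fun ℓ hℓ => direction_in_two_cones h₁ hπ₁ h₂ hπ₂ hsum (hA.1 ℓ hℓ)) with h | h | h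
  · have hsub := Finset.filter_subset (fun ℓ => ∃ d ∈ leftWedge 0 θ₁, HasDir ℓ d) A
    have key := encloses_three (hA.subset hsub)
      {q | q.1 ≤ p.1 ∧ 0 < lin (Real.cos θ₁, -Real.sin θ₁) (q - p)}
      {q | p.1 ≤ q.1 ∧ 0 < lin (-Real.cos θ₂, -Real.sin θ₂) (q - p)}
      (topWedge p θ₁ θ₂) (leftWedge 0 θ₁) ?_ (-1, 0) (by simp) ?_
      (fun ℓ hℓ => (Finset.mem_filter.1 hℓ).2) (neg_cos_sin_ne_zero θ₂)
      (lin (-Real.cos θ₂, -Real.sin θ₂) p) ?_ ?_ hM₁ hM₂ (hM.trans h)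
    · exact key.imp (·.of_subset hsub) (Or.imp (·.of_subset hsub) (·.of_subset hsub))
    · rintro q ⟨hq, hq'⟩ d ⟨hd, hd'⟩ c hc
      rw [sub_zero] at hd'
      refine ⟨?_, ?_⟩
      · simp at hd ⊢
        nlinarith
      · rw [hadd]
        have := mul_nonneg hc hd'
        linarith
    · rintro d ⟨hd, -⟩
      simpa [lin] using hd
    · intro q hq ht
      rw [← sub_pos, ← lin_sub] at ht
      refine ⟨?_, ht⟩
      by_contra hcon
      push Not at hcon
      exact hq ⟨hcon.le, hL q hcon ht⟩
    · intro q hq ht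
      rw [← sub_nonpos, ← lin_sub] at ht
      refine ⟨?_, ht⟩
      by_contra hcon
      push Not at hcon
      refine (hR q ?_ hcon).not_ge ht
      by_contra hcon'
      exact hq ⟨not_lt.1 hcon', hcon⟩
  · have hsub := Finset.filter_subset (fun ℓ => ∃ d ∈ rightWedge 0 θ₂, HasDir ℓ d) A
    have key := encloses_three (hA.subset hsub)
      {q | p.1 ≤ q.1 ∧ 0 < lin (-Real.cos θ₂, -Real.sin θ₂) (q - p)}
      {q | q.1 ≤ p.1 ∧ 0 < lin (Real.cos θ₁, -Real.sin θ₁) (q - p)}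
      (topWedge p θ₁ θ₂) (rightWedge 0 θ₂) ?_ (1, 0) (by simp) ?_
      (fun ℓ hℓ => (Finset.mem_filter.1 hℓ).2) (cos_sin_ne_zero θ₁)
      (lin (Real.cos θ₁, -Real.sin θ₁) p) ?_ ?_ hM₂ hM₁
      (by rw [mul_comm M₂ M₁]; exact hM.trans h)
    · rw [or_left_comm] at key
      exact key.imp (·.of_subset hsub) (Or.imp (·.of_subset hsub) (·.of_subset hsub))
    · rintro q ⟨hq, hq'⟩ d ⟨hd, hd'⟩ c hc
      rw [sub_zero] at hd'
      refine ⟨?_, ?_⟩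
      · simp at hd ⊢
        nlinarith
      · rw [hadd]
        have := mul_nonneg hc hd'
        linarith
    · rintro d ⟨hd, -⟩
      simpa [lin] using hd
    · intro q hq ht
      rw [← sub_pos, ← lin_sub] at ht
      refine ⟨?_, ht⟩
      by_contra hcon
      push Not at hcon
      exact hq ⟨hcon.le, hR q hcon ht⟩
    · intro q hq ht
      rw [← sub_nonpos, ← lin_sub] at ht
      refine ⟨ht, ?_⟩
      by_contra hcon
      push Not at hcon
      refine (hL q ?_ hcon).not_ge ht
      by_contra hcon'
      exact hq ⟨not_lt.1 hcon', hcon⟩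
  · have hsub := Finset.filter_subset (fun ℓ => ∃ d ∈ topWedge 0 θ₁ θ₂, HasDir ℓ d) A
    have hX : ∀ q ∈ topWedge p θ₁ θ₂, ∀ d ∈ topWedge 0 θ₁ θ₂, ∀ c : ℝ, 0 ≤ c →
        q + c • d ∈ topWedge p θ₁ θ₂ := by
      rintro q ⟨hq, hq'⟩ d ⟨hd, hd'⟩ c hc
      rw [sub_zero] at hd hd'
      refine ⟨?_, ?_⟩
      · rw [hadd]
        have := mul_nonneg hc (neg_nonneg.2 hd)
        linarith
      · rw [hadd]
        have := mul_nonneg hc (neg_nonneg.2 hd')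
        linarith
    have hg : ∀ d ∈ topWedge 0 θ₁ θ₂, 0 ≤ lin (-(Real.cos θ₁, -Real.sin θ₁)) d := by
      rintro d ⟨hd, -⟩
      simp [lin] at hd ⊢
      linarith
    have hnot : ∀ q, q ∉ topWedge p θ₁ θ₂ → lin (Real.cos θ₁, -Real.sin θ₁) (q - p) ≤ 0 →
        0 < lin (-Real.cos θ₂, -Real.sin θ₂) (q - p) := by
      intro q hq hf
      by_contra hcon
      exact hq ⟨hf, not_lt.1 hcon⟩
    have hright : ∀ q, q ∉ topWedge p θ₁ θ₂ → p.1 < q.1 →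
        0 < lin (-Real.cos θ₂, -Real.sin θ₂) (q - p) := by
      intro q hq hu
      rcases le_or_gt (lin (Real.cos θ₁, -Real.sin θ₁) (q - p)) 0 with hf | hf
      · exact hnot q hq hf
      · exact hR q hu hf
    have hleft : ∀ q, q ∉ topWedge p θ₁ θ₂ → q.1 < p.1 →
        0 < lin (Real.cos θ₁, -Real.sin θ₁) (q - p) := by
      intro q hq hu
      by_contra hcon
      exact hcon (hL q hu (hnot q hq (not_lt.1 hcon)))
    have hs2 := Real.sin_nonneg_of_nonneg_of_le_pi h₂ hπ₂
    rcases (Real.sin_nonneg_of_nonneg_of_le_pi h₁ hπ₁).eq_or_lt with hs | hs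
    · have key := encloses_three (hA.subset hsub) (topWedge p θ₁ θ₂)
        {q | q.1 ≤ p.1 ∧ 0 < lin (Real.cos θ₁, -Real.sin θ₁) (q - p)}
        {q | p.1 ≤ q.1 ∧ 0 < lin (-Real.cos θ₂, -Real.sin θ₂) (q - p)}
        (topWedge 0 θ₁ θ₂) hX _ (neg_ne_zero.2 (cos_sin_ne_zero θ₁)) hg
        (fun ℓ hℓ => (Finset.mem_filter.1 hℓ).2) (e := (-1, 0)) (by simp)
        (-p.1) ?_ ?_ (M₃ := M₂) hM₃ hM₁ (by linarith)
      · rw [or_comm, or_assoc] at key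
        exact key.imp (·.of_subset hsub) (Or.imp (·.of_subset hsub) (·.of_subset hsub))
      · intro q hq ht
        have hu : q.1 < p.1 := by simpa [lin] using ht
        exact ⟨hu.le, hleft q hq hu⟩
      · intro q hq ht
        have hu : p.1 ≤ q.1 := by simpa [lin] using ht
        refine ⟨hu, ?_⟩
        rcases hu.eq_or_lt with hu | hu
        · exact hnot q hq (by simp [lin, ← hs, hu])
        · exact hright q hq hu
    · have key := encloses_three (hA.subset hsub) (topWedge p θ₁ θ₂)
        {q | p.1 ≤ q.1 ∧ 0 < lin (-Real.cos θ₂, -Real.sin θ₂) (q - p)}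
        {q | q.1 ≤ p.1 ∧ 0 < lin (Real.cos θ₁, -Real.sin θ₁) (q - p)}
        (topWedge 0 θ₁ θ₂) hX _ (neg_ne_zero.2 (cos_sin_ne_zero θ₁)) hg
        (fun ℓ hℓ => (Finset.mem_filter.1 hℓ).2) (e := (1, 0)) (by simp)
        p.1 ?_ ?_ (M₃ := M₁) hM₃ hM₂ (by linarith)
      · rw [or_comm, or_assoc, or_left_comm] at key
        exact key.imp (·.of_subset hsub) (Or.imp (·.of_subset hsub) (·.of_subset hsub))
      · intro q hq ht
        have hu : p.1 < q.1 := by simpa [lin] using ht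
        exact ⟨hu.le, hright q hq hu⟩
      · intro q hq ht
        have hu : q.1 ≤ p.1 := by simpa [lin] using ht
        refine ⟨hu, ?_⟩
        rcases hu.eq_or_lt with hu | hu
        · by_contra hcon
          push Not at hcon
          have := hnot q hq hcon
          simp [lin, hu] at this hcon
          nlinarith
        · exact hleft q hq hu

theorem Encloses.nonempty_incSet {A : Finset (Set (ℝ × ℝ))} (hA : LineFamily A)
    {K : Set (ℝ × ℝ)} {m : ℝ} (h : Encloses A K m) (hm : 1 < m) : ∃ q ∈ incSet A, q ∈ K := by
  obtain ⟨S, hS, hSK, hmS⟩ := h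
  obtain ⟨x, hx, y, hy, hxy⟩ := Finset.one_lt_card.1
    (by exact_mod_cast hm.trans_le hmS : 1 < S.card)
  obtain ⟨q, hq, -⟩ := hA.2 x (hS hx) y (hS hy) hxy
  have hq' : q ∈ incSet S := ⟨x, hx, y, hy, hxy, hq.1, hq.2⟩
  exact ⟨q, incSet_mono hS hq', hSK hq'⟩

theorem exists_threshold {A : Finset (Set (ℝ × ℝ))} (hA : LineFamily A) {m : ℝ} (hm : 1 < m)
    (hmA : m ≤ A.card) {P : Type*} [TopologicalSpace P] (h : ℝ × ℝ → P → ℝ)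
    (hc : ∀ q, Continuous (h q)) :
    ∃ a : P → ℝ, Continuous a ∧ (∀ p θ, a p ≤ θ ↔ Encloses A {q | h q p ≤ θ} m) ∧
      ∀ p θ, a p < θ ↔ Encloses A {q | h q p < θ} m := by
  have hI : ∀ x : Set (ℝ × ℝ) × Set (ℝ × ℝ), ∃ p, x ∈ A.offDiag → ∀ q, q ∈ x.1 ∩ x.2 ↔ q = p := by
    intro x
    by_cases hx : x ∈ A.offDiag
    · obtain ⟨h1, h2, h3⟩ := Finset.mem_offDiag.1 hx
      obtain ⟨p, hp, hp'⟩ := hA.2 _ h1 _ h2 h3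
      exact ⟨p, fun _ q => ⟨hp' q, by rintro rfl; exact hp⟩⟩
    · exact ⟨0, fun h => absurd h hx⟩
  choose I hI using hI
  have hinc : ∀ S ⊆ A, ∀ K : Set (ℝ × ℝ), incSet S ⊆ K ↔ ∀ x ∈ S.offDiag, I x ∈ K := by
    intro S hS K
    constructor
    · intro hK x hx
      have := (hI x (Finset.offDiag_mono hS hx) (I x)).2 rfl
      obtain ⟨h1, h2, h3⟩ := Finset.mem_offDiag.1 hx
      exact hK ⟨x.1, h1, x.2, h2, h3, this.1, this.2⟩
    · rintro hK q ⟨x, hx, y, hy, hxy, hqx, hqy⟩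
      have hm : (x, y) ∈ S.offDiag := Finset.mem_offDiag.2 ⟨hx, hy, hxy⟩
      rw [(hI (x, y) (Finset.offDiag_mono hS hm) q).1 ⟨hqx, hqy⟩]
      exact hK _ hm
  let T := A.powerset.filter fun S => m ≤ (S.card : ℝ)
  have hT : T.Nonempty := ⟨A, by simp [T, hmA]⟩
  have hne : ∀ S ∈ T, S.offDiag.Nonempty := by
    intro S hS
    have : 1 < S.card := by exact_mod_cast hm.trans_le (Finset.mem_filter.1 hS).2
    obtain ⟨x, hx, y, hy, hxy⟩ := Finset.one_lt_card.1 this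
    exact ⟨(x, y), Finset.mem_offDiag.2 ⟨hx, hy, hxy⟩⟩
  let f : Finset (Set (ℝ × ℝ)) → P → ℝ := fun S p =>
    if hS : S.offDiag.Nonempty then S.offDiag.sup' hS fun x => h (I x) p else 0
  refine ⟨fun p => T.inf' hT fun S => f S p, ?_, ?_, ?_⟩
  · refine Continuous.finset_inf'_apply hT fun S hS => ?_
    simp only [f, dif_pos (hne S hS)]
    exact Continuous.finset_sup'_apply _ fun x _ => hc _
  · intro p θ
    rw [Finset.inf'_le_iff]
    constructor
    · rintro ⟨S, hS, hle⟩
      simp only [f, dif_pos (hne S hS), Finset.sup'_le_iff] at hle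
      obtain ⟨h1, h2⟩ := Finset.mem_filter.1 hS
      exact ⟨S, Finset.mem_powerset.1 h1, (hinc S (Finset.mem_powerset.1 h1) _).2 hle, h2⟩
    · rintro ⟨S, h1, hle, h2⟩
      have hS : S ∈ T := Finset.mem_filter.2 ⟨Finset.mem_powerset.2 h1, h2⟩
      refine ⟨S, hS, ?_⟩
      simp only [f, dif_pos (hne S hS), Finset.sup'_le_iff]
      exact (hinc S h1 _).1 hle
  · intro p θ
    rw [Finset.inf'_lt_iff]
    constructor
    · rintro ⟨S, hS, hle⟩
      simp only [f, dif_pos (hne S hS), Finset.sup'_lt_iff] at hle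
      obtain ⟨h1, h2⟩ := Finset.mem_filter.1 hS
      exact ⟨S, Finset.mem_powerset.1 h1, (hinc S (Finset.mem_powerset.1 h1) _).2 hle, h2⟩
    · rintro ⟨S, h1, hle, h2⟩
      have hS : S ∈ T := Finset.mem_filter.2 ⟨Finset.mem_powerset.2 h1, h2⟩
      refine ⟨S, hS, ?_⟩
      simp only [f, dif_pos (hne S hS), Finset.sup'_lt_iff]
      exact (hinc S h1 _).1 hle

theorem isClosed_encloses (A : Finset (Set (ℝ × ℝ))) (m : ℝ) {X : Type*} [TopologicalSpace X]
    (W : X → Set (ℝ × ℝ)) (hW : ∀ q, IsClosed {x | q ∈ W x}) :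
    IsClosed {x | Encloses A (W x) m} := by
  have : {x | Encloses A (W x) m} =
      ⋃ S ∈ A.powerset.filter fun S => m ≤ (S.card : ℝ), ⋂ q ∈ incSet S, {x | q ∈ W x} := by
    ext x
    simp only [Encloses, Set.mem_ofPred_eq, Set.mem_iUnion, Set.mem_iInter, Finset.mem_filter,
      Finset.mem_powerset, exists_prop, and_assoc, and_comm, Set.subset_def]
  rw [this]
  exact isClosed_biUnion_finset fun S _ => isClosed_biInter fun q _ => hW q

/-- A continuous approximation, at scale `ε`, of the angle which a vector `v` of the left
half-plane makes with the downward vertical direction. It is very negative near the origin and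
very large far inside the right half-plane. -/
noncomputable def fuzzyAngle (ε : ℝ) (v : ℝ × ℝ) : ℝ :=
  Real.arccos (-v.2 / max (√(v.1 ^ 2 + v.2 ^ 2)) ε)
    - Real.pi * max 0 (2 - √(v.1 ^ 2 + v.2 ^ 2) / ε) + 4 * max v.1 0 / ε

theorem continuous_fuzzyAngle {ε : ℝ} (hε : 0 < ε) : Continuous (fuzzyAngle ε) := by
  unfold fuzzyAngle
  have h : ∀ v : ℝ × ℝ, max (√(v.1 ^ 2 + v.2 ^ 2)) ε ≠ 0 := fun v =>
    (hε.trans_le (le_max_right _ _)).ne'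
  have hε' := hε.ne'
  refine ((Real.continuous_arccos.comp (Continuous.div (by fun_prop) (by fun_prop) h)).sub ?_).add
    ?_
  · fun_prop
  · fun_prop

theorem fuzzyAngle_lt {ε : ℝ} (hε : 0 < ε) {v : ℝ × ℝ} (hv : v.1 ≤ 0) {θ : ℝ} (h0 : 0 ≤ θ)
    (hf : 0 < lin (Real.cos θ, -Real.sin θ) v) : fuzzyAngle ε v < θ := by
  unfold fuzzyAngle lin at *
  simp only at hf
  rw [max_eq_right hv]
  set r := √(v.1 ^ 2 + v.2 ^ 2) with hr
  rcases lt_or_ge r ε with h | h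
  · have h1 : r / ε < 1 := (div_lt_one hε).2 h
    have h2 : 1 < max 0 (2 - r / ε) := lt_max_of_lt_right (by linarith)
    have := Real.arccos_le_pi (-v.2 / max r ε)
    have := mul_lt_mul_of_pos_left h2 Real.pi_pos
    simp
    linarith
  · rw [max_eq_left h]
    have hr0 : 0 < r := hε.trans_le h
    have hr2 : r ^ 2 = v.1 ^ 2 + v.2 ^ 2 := Real.sq_sqrt (by positivity)
    have hφ : Real.arccos (-v.2 / r) < θ := by
      by_contra hcon
      push Not at hcon
      have hsub := Real.sin_nonneg_of_nonneg_of_le_pi (x := Real.arccos (-v.2 / r) - θ)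
        (by linarith) (by linarith [Real.arccos_le_pi (-v.2 / r)])
      have hle : (-v.2 / r) ^ 2 ≤ 1 := by
        rw [div_pow, div_le_one (by positivity), hr2]; nlinarith [sq_nonneg v.1]
      have hcos : Real.cos (Real.arccos (-v.2 / r)) = -v.2 / r :=
        Real.cos_arccos (abs_le.1 ((sq_le_one_iff_abs_le_one _).1 hle)).1
          (abs_le.1 ((sq_le_one_iff_abs_le_one _).1 hle)).2
      have hsin : Real.sin (Real.arccos (-v.2 / r)) = -v.1 / r := by
        rw [Real.sin_arccos, show 1 - (-v.2 / r) ^ 2 = (-v.1 / r) ^ 2 by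
          field_simp; rw [hr2]; ring]
        exact Real.sqrt_sq (div_nonneg (by linarith) hr0.le)
      rw [Real.sin_sub, hcos, hsin] at hsub
      have : -v.1 / r * Real.cos θ - -v.2 / r * Real.sin θ =
        -(Real.cos θ * v.1 + -Real.sin θ * v.2) / r := by ring
      rw [this] at hsub
      exact absurd hsub (not_le.2 (div_neg_of_neg_of_pos (by linarith) hr0))
    have : 0 ≤ Real.pi * max 0 (2 - r / ε) := mul_nonneg Real.pi_pos.le (le_max_left _ _)
    simp
    linarith

theorem fuzzyAngle_le_arccos (ε : ℝ) {v : ℝ × ℝ} (hv : v.1 ≤ 0) :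
    fuzzyAngle ε v ≤ Real.arccos (-v.2 / max (√(v.1 ^ 2 + v.2 ^ 2)) ε) := by
  unfold fuzzyAngle
  rw [max_eq_right hv]
  have : 0 ≤ Real.pi * max 0 (2 - √(v.1 ^ 2 + v.2 ^ 2) / ε) :=
    mul_nonneg Real.pi_pos.le (le_max_left _ _)
  simp
  linarith

theorem fuzzyAngle_le_pi (ε : ℝ) {v : ℝ × ℝ} (hv : v.1 ≤ 0) : fuzzyAngle ε v ≤ Real.pi :=
  (fuzzyAngle_le_arccos ε hv).trans (Real.arccos_le_pi _)

theorem fuzzyAngle_le_pi_div_two {ε : ℝ} (hε : 0 < ε) {v : ℝ × ℝ} (hv : v.1 ≤ 0)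
    (hv' : v.2 ≤ 0) : fuzzyAngle ε v ≤ Real.pi / 2 :=
  (fuzzyAngle_le_arccos ε hv).trans (Real.arccos_le_pi_div_two.2
    (div_nonneg (by linarith) (hε.le.trans (le_max_right _ _))))

theorem pi_div_two_le_fuzzyAngle {ε : ℝ} (hε : 0 < ε) {v : ℝ × ℝ} (hv : 2 * ε ≤ v.2) :
    Real.pi / 2 ≤ fuzzyAngle ε v := by
  unfold fuzzyAngle
  set r := √(v.1 ^ 2 + v.2 ^ 2) with hr
  have hr2 : 2 * ε ≤ r := hv.trans (Real.le_sqrt_of_sq_le (by nlinarith [sq_nonneg v.1]))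
  have h1 : 2 - r / ε ≤ 0 := by
    rw [sub_nonpos, le_div_iff₀ hε]; exact hr2
  rw [max_eq_left h1]
  have h2 : 0 ≤ 4 * max v.1 0 / ε := by positivity
  have h3 : Real.pi / 2 ≤ Real.arccos (-v.2 / max r ε) := by
    rw [← not_lt, Real.arccos_lt_pi_div_two, not_lt]
    exact div_nonpos_of_nonpos_of_nonneg (by linarith) (hε.le.trans (le_max_right _ _))
  linarith

theorem of_fuzzyAngle_le {ε : ℝ} (hε : 0 < ε) {v : ℝ × ℝ} {θ : ℝ} (hπ : θ ≤ Real.pi)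
    (h : fuzzyAngle ε v ≤ θ) :
    v.1 ≤ 2 * ε ∧ -(4 * ε) ≤ lin (Real.cos θ, -Real.sin θ) v := by
  unfold fuzzyAngle lin at *
  simp only
  set r := √(v.1 ^ 2 + v.2 ^ 2) with hr
  have hr2 : r ^ 2 = v.1 ^ 2 + v.2 ^ 2 := Real.sq_sqrt (by positivity)
  have hr0 : 0 ≤ r := Real.sqrt_nonneg _
  have hsc := Real.sin_sq_add_cos_sq θ
  rcases le_or_gt r (2 * ε) with hrε | hrε
  · refine ⟨(abs_le_of_sq_le_sq' (by nlinarith [sq_nonneg v.2]) (by linarith)).2, ?_⟩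
    have : (Real.cos θ * v.1 + -Real.sin θ * v.2) ^ 2 ≤ r ^ 2 := by
      nlinarith [sq_nonneg (Real.sin θ * v.1 + Real.cos θ * v.2)]
    linarith [(abs_le_of_sq_le_sq' this hr0).1]
  have h1 : 2 - r / ε ≤ 0 := by
    rw [sub_nonpos, le_div_iff₀ hε]; exact hrε.le
  rw [max_eq_left h1, max_eq_left (by linarith : ε ≤ r)] at h
  have hu : max v.1 0 ≤ 2 * ε := by
    have h2 := Real.arccos_nonneg (-v.2 / r)
    have h3 : 4 * max v.1 0 / ε ≤ 4 := by linarith [Real.pi_le_four]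
    rw [div_le_iff₀ hε] at h3
    linarith
  refine ⟨(le_max_left _ _).trans hu, ?_⟩
  have hr0 : 0 < r := by linarith
  have hpos : 0 ≤ 4 * max v.1 0 / ε := by positivity
  have hsub := Real.sin_nonneg_of_nonneg_of_le_pi (x := θ - Real.arccos (-v.2 / r))
    (by linarith) (by linarith [Real.arccos_nonneg (-v.2 / r)])
  have hle : (-v.2 / r) ^ 2 ≤ 1 := by
    rw [div_pow, div_le_one (by positivity), hr2]; nlinarith [sq_nonneg v.1]
  have hcos : Real.cos (Real.arccos (-v.2 / r)) = -v.2 / r :=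
    Real.cos_arccos (abs_le.1 ((sq_le_one_iff_abs_le_one _).1 hle)).1
      (abs_le.1 ((sq_le_one_iff_abs_le_one _).1 hle)).2
  have hsin : Real.sin (Real.arccos (-v.2 / r)) = |v.1| / r := by
    rw [Real.sin_arccos, show 1 - (-v.2 / r) ^ 2 = (|v.1| / r) ^ 2 by
      rw [div_pow, div_pow, sq_abs]; field_simp; rw [hr2]; ring]
    exact Real.sqrt_sq (by positivity)
  rw [Real.sin_sub, hcos, hsin] at hsub
  have hmul : 0 ≤ Real.sin θ * -v.2 - Real.cos θ * |v.1| := by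
    have := mul_nonneg hsub hr0.le
    have e : (Real.sin θ * (-v.2 / r) - Real.cos θ * (|v.1| / r)) * r =
      Real.sin θ * -v.2 - Real.cos θ * |v.1| := by field_simp
    rwa [e] at this
  have habs : |v.1| + v.1 = 2 * max v.1 0 := by
    rcases le_total 0 v.1 with h | h
    · rw [abs_of_nonneg h, max_eq_left h]; ring
    · rw [abs_of_nonpos h, max_eq_right h]; ring
  have h5 : 0 ≤ (1 + Real.cos θ) * max v.1 0 :=
    mul_nonneg (by linarith [Real.neg_one_le_cos θ]) (le_max_right _ _)
  have h6 : Real.cos θ * (|v.1| + v.1) = Real.cos θ * (2 * max v.1 0) := by rw [habs]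
  linarith

/-- The parity indicator of an edge whose endpoints are coloured `0` and `1`. -/
def edgeParity (a b : Fin 3) : ZMod 2 := if (a = 0 ∧ b = 1) ∨ (a = 1 ∧ b = 0) then 1 else 0

theorem edgeParity_cell (a b c d : Fin 3) (k : Fin 3) (ha : a ≠ k) (hb : b ≠ k) (hc : c ≠ k)
    (hd : d ≠ k) : edgeParity a b + edgeParity c d + (edgeParity a c + edgeParity b d) = 0 := by
  revert a b c d k
  decide

theorem exists_cell_with_all_colours (N : ℕ) (c : ℕ → ℕ → Fin 3)
    (hbot : ∀ i ≤ N, c i 0 = 2) (hleft : ∀ j ≤ N, c 0 j ≠ 0) (hright : ∀ j ≤ N, c N j ≠ 1)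
    (htop : ∀ i ≤ N, c i N ≠ 2) :
    ∃ i < N, ∃ j < N, ∀ k, c i j = k ∨ c (i + 1) j = k ∨ c i (j + 1) = k ∨
      c (i + 1) (j + 1) = k := by
  by_contra hcon
  push Not at hcon
  have hneg : ∀ x y : ZMod 2, x + y = y - x := by decide
  have hcell : ∑ i ∈ Finset.range N, ∑ j ∈ Finset.range N,
      (edgeParity (c i j) (c (i + 1) j) + edgeParity (c i (j + 1)) (c (i + 1) (j + 1)) +
        (edgeParity (c i j) (c i (j + 1)) + edgeParity (c (i + 1) j) (c (i + 1) (j + 1)))) = 0 := by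
    refine Finset.sum_eq_zero fun i hi => Finset.sum_eq_zero fun j hj => ?_
    obtain ⟨k, h1, h2, h3, h4⟩ := hcon i (Finset.mem_range.1 hi) j (Finset.mem_range.1 hj)
    exact edgeParity_cell _ _ _ _ k h1 h2 h3 h4
  have hhor : ∀ i < N, ∑ j ∈ Finset.range N,
      (edgeParity (c i j) (c (i + 1) j) + edgeParity (c i (j + 1)) (c (i + 1) (j + 1))) =
      edgeParity (c i N) (c (i + 1) N) := by
    intro i hi
    simp only [hneg]
    rw [Finset.sum_range_sub (fun j => edgeParity (c i j) (c (i + 1) j)),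
      hbot i hi.le, hbot (i + 1) hi]
    simp [edgeParity]
  have hver : ∀ j < N, ∑ i ∈ Finset.range N,
      (edgeParity (c i j) (c i (j + 1)) + edgeParity (c (i + 1) j) (c (i + 1) (j + 1))) = 0 := by
    intro j hj
    simp only [hneg]
    rw [Finset.sum_range_sub (fun i => edgeParity (c i j) (c i (j + 1)))]
    have h1 := hleft j hj.le
    have h2 := hleft (j + 1) hj
    have h3 := hright j hj.le
    have h4 := hright (j + 1) hj
    simp [edgeParity, h1, h2, h3, h4]
  simp only [Finset.sum_add_distrib (f := fun j => edgeParity _ _ + edgeParity _ _)] at hcell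
  rw [Finset.sum_add_distrib, Finset.sum_congr rfl fun i hi => hhor i (Finset.mem_range.1 hi),
    Finset.sum_comm (f := fun i j => edgeParity (c i j) (c i (j + 1)) +
      edgeParity (c (i + 1) j) (c (i + 1) (j + 1))),
    Finset.sum_congr rfl fun j hj => hver j (Finset.mem_range.1 hj)] at hcell
  have hstep : ∀ a b : Fin 3, a ≠ 2 → b ≠ 2 →
      edgeParity a b = (if b = 0 then 1 else 0) - (if a = 0 then 1 else 0) := by decide
  rw [Finset.sum_congr rfl fun i hi => hstep _ _ (htop i (Finset.mem_range.1 hi).le)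
    (htop (i + 1) (Finset.mem_range.1 hi)),
    Finset.sum_range_sub (fun i => if c i N = 0 then (1 : ZMod 2) else 0)] at hcell
  have h0 : ∀ a : Fin 3, a ≠ 1 → a ≠ 2 → a = 0 := by decide
  simp [h0 _ (hright N le_rfl) (htop N le_rfl), hleft N le_rfl] at hcell

theorem rectangle_covering {x₀ x₁ y₀ y₁ : ℝ} (hx : x₀ ≤ x₁) (hy : y₀ ≤ y₁)
    (F : Fin 3 → Set (ℝ × ℝ)) (hF : ∀ k, IsClosed (F k))
    (hcov : ∀ p ∈ Set.Icc x₀ x₁ ×ˢ Set.Icc y₀ y₁, ∃ k, p ∈ F k)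
    (hbot : ∀ x ∈ Set.Icc x₀ x₁, (x, y₀) ∉ F 0 ∧ (x, y₀) ∉ F 1)
    (hleft : ∀ y ∈ Set.Icc y₀ y₁, (x₀, y) ∉ F 0) (hright : ∀ y ∈ Set.Icc y₀ y₁, (x₁, y) ∉ F 1)
    (htop : ∀ x ∈ Set.Icc x₀ x₁, (x, y₁) ∉ F 2) :
    ∃ p ∈ Set.Icc x₀ x₁ ×ˢ Set.Icc y₀ y₁, ∀ k, p ∈ F k := by
  by_contra hcon
  push Not at hcon
  obtain ⟨δ, hδ, hball⟩ := lebesgue_number_lemma_of_metric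
    ((isCompact_Icc (a := x₀) (b := x₁)).prod (isCompact_Icc (a := y₀) (b := y₁)))
    (fun k => (hF k).isOpen_compl) fun p hp => by
      obtain ⟨k, hk⟩ := hcon p hp
      exact Set.mem_iUnion.2 ⟨k, hk⟩
  obtain ⟨n, hn⟩ := exists_nat_gt (max (x₁ - x₀) (y₁ - y₀) / δ)
  set N := n + 1 with hN
  have hN0 : (0 : ℝ) < N := by positivity
  have hNδ : max (x₁ - x₀) (y₁ - y₀) < N * δ := by
    have : max (x₁ - x₀) (y₁ - y₀) / δ < N := hn.trans (by rw [hN]; push_cast; linarith)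
    rwa [div_lt_iff₀ hδ] at this
  have hxN := (le_max_left _ _).trans_lt hNδ
  have hyN := (le_max_right _ _).trans_lt hNδ
  let X : ℕ → ℝ := fun i => x₀ + i / N * (x₁ - x₀)
  let Y : ℕ → ℝ := fun j => y₀ + j / N * (y₁ - y₀)
  have hfrac : ∀ i ≤ N, (0 : ℝ) ≤ i / N ∧ (i / N : ℝ) ≤ 1 := fun i hi =>
    ⟨by positivity, (div_le_one hN0).2 (by exact_mod_cast hi)⟩
  have hX : ∀ i ≤ N, X i ∈ Set.Icc x₀ x₁ := by
    intro i hi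
    obtain ⟨h1, h2⟩ := hfrac i hi
    simp only [X]
    constructor <;> nlinarith
  have hY : ∀ i ≤ N, Y i ∈ Set.Icc y₀ y₁ := by
    intro i hi
    obtain ⟨h1, h2⟩ := hfrac i hi
    simp only [Y]
    constructor <;> nlinarith
  have hXs : ∀ i, |X (i + 1) - X i| < δ := by
    intro i
    have : X (i + 1) - X i = (x₁ - x₀) / N := by simp only [X]; push_cast; field_simp; ring
    rw [this, abs_of_nonneg (div_nonneg (by linarith) hN0.le), div_lt_iff₀ hN0]
    linarith
  have hYs : ∀ i, |Y (i + 1) - Y i| < δ := by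
    intro i
    have : Y (i + 1) - Y i = (y₁ - y₀) / N := by simp only [Y]; push_cast; field_simp; ring
    rw [this, abs_of_nonneg (div_nonneg (by linarith) hN0.le), div_lt_iff₀ hN0]
    linarith
  have hX0 : X 0 = x₀ := by simp [X]
  have hY0 : Y 0 = y₀ := by simp [Y]
  have hXN : X N = x₁ := by simp [X, hN0.ne']
  have hYN : Y N = y₁ := by simp [Y, hN0.ne']
  have hc : ∀ i j, ∃ k, i ≤ N → j ≤ N → (X i, Y j) ∈ F k := by
    intro i j
    by_cases h : i ≤ N ∧ j ≤ N
    · obtain ⟨k, hk⟩ := hcov (X i, Y j) ⟨hX i h.1, hY j h.2⟩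
      exact ⟨k, fun _ _ => hk⟩
    · exact ⟨0, fun h1 h2 => absurd ⟨h1, h2⟩ h⟩
  choose c hc using hc
  have h2 : ∀ a : Fin 3, a ≠ 0 → a ≠ 1 → a = 2 := by decide
  obtain ⟨i, hi, j, hj, hall⟩ := exists_cell_with_all_colours N c
    (fun i hi => by
      have h := hc i 0 hi (Nat.zero_le _)
      rw [hY0] at h
      refine h2 _ (fun h0 => (hbot _ (hX i hi)).1 (by rwa [h0] at h))
        (fun h0 => (hbot _ (hX i hi)).2 (by rwa [h0] at h)))
    (fun j hj h0 => hleft _ (hY j hj) (by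
      have h := hc 0 j (Nat.zero_le _) hj; rwa [h0, hX0] at h))
    (fun j hj h0 => hright _ (hY j hj) (by have h := hc N j le_rfl hj; rwa [h0, hXN] at h))
    (fun i hi h0 => htop _ (hX i hi) (by have h := hc i N hi le_rfl; rwa [h0, hYN] at h))
  obtain ⟨k, hk⟩ := hball (X i, Y j) ⟨hX i hi.le, hY j hj.le⟩
  have hsub : ∀ i' j', (i' = i ∨ i' = i + 1) → (j' = j ∨ j' = j + 1) → c i' j' ≠ k := by
    rintro i' j' hi' hj' rfl
    refine hk (a := (X i', Y j')) ?_ (hc i' j' (by omega) (by omega))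
    rw [Metric.mem_ball, Prod.dist_eq, max_lt_iff, Real.dist_eq, Real.dist_eq]
    constructor
    · rcases hi' with rfl | rfl
      · simpa using hδ
      · exact hXs i
    · rcases hj' with rfl | rfl
      · simpa using hδ
      · exact hYs j
  rcases hall k with h | h | h | h
  · exact hsub i j (Or.inl rfl) (Or.inl rfl) h
  · exact hsub (i + 1) j (Or.inr rfl) (Or.inl rfl) h
  · exact hsub i (j + 1) (Or.inl rfl) (Or.inr rfl) h
  · exact hsub (i + 1) (j + 1) (Or.inr rfl) (Or.inr rfl) h

theorem lin_neg_left (e q : ℝ × ℝ) : lin (-e) q = -lin e q := by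
  simp [lin]; ring

theorem not_encloses_halfplane {A B : Finset (Set (ℝ × ℝ))} (hA : LineFamily A) {M M' N : ℝ}
    (H : ∀ e : ℝ × ℝ, e ≠ 0 → ∀ t, Encloses A {q | t ≤ lin e q} M' →
      ¬ Encloses B {q | lin e q ≤ t} N)
    (hM : 0 < M) (hMM : M * M' ≤ A.card) {e : ℝ × ℝ} (he : e ≠ 0) {t : ℝ}
    (h : ¬ Encloses A {q | t < lin e q} M) : ¬ Encloses B {q | t ≤ lin e q} N := by
  have h' := (encloses_halfplane hA he t hM hMM).resolve_left h
  have := H (-e) (neg_ne_zero.2 he) (-t) (h'.mono (fun q hq => by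
    simpa [lin_neg_left] using hq) le_rfl)
  exact fun hB => this (hB.mono (fun q hq => by simpa [lin_neg_left] using hq) le_rfl)

theorem le_max_add_max (a b c : ℝ) :
    c ≤ max a (min (c - b) (c / 2)) + max b (min (c - a) (c / 2)) := by
  grind

theorem max_add_max_eq {a b c : ℝ} (h : a + b < c) :
    max a (min (c - b) (c / 2)) + max b (min (c - a) (c / 2)) = c := by
  grind

theorem exists_approximate_wedges {A B : Finset (Set (ℝ × ℝ))} (hA : LineFamily A)
    (hB : LineFamily B) {M₁ M₂ M₃ N₁ N₂ N₃ : ℝ} (hM₁ : 1 < M₁) (hM₂ : 1 < M₂) (hM₃ : 1 < M₃)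
    (hN₁ : 1 < N₁) (hN₂ : 1 < N₂) (hN₃ : 1 < N₃) (hM : M₁ * M₂ * M₃ ≤ 2 / 3 * A.card)
    (hN : N₁ * N₂ * N₃ ≤ 2 / 3 * B.card)
    (H₁ : ∀ e : ℝ × ℝ, e ≠ 0 → ∀ t, Encloses A {q | t ≤ lin e q} (M₂ * M₃) →
      ¬ Encloses B {q | lin e q ≤ t} N₁)
    (H₂ : ∀ e : ℝ × ℝ, e ≠ 0 → ∀ t, Encloses A {q | t ≤ lin e q} (M₁ * M₃) →
      ¬ Encloses B {q | lin e q ≤ t} N₂)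
    (H₃ : ∀ e : ℝ × ℝ, e ≠ 0 → ∀ t, Encloses A {q | t ≤ lin e q} (M₁ * M₂) →
      ¬ Encloses B {q | lin e q ≤ t} N₃)
    {x₀ x₁ R : ℝ} (hx : x₀ ≤ x₁) (hx₀A : Encloses A {q | q.1 ≤ x₀} M₁)
    (hx₁A : Encloses A {q | x₁ ≤ q.1} M₂) (hx₀B : ¬ Encloses B {q | q.1 ≤ x₀} N₁)
    (hx₁B : ¬ Encloses B {q | x₁ ≤ q.1} N₂) (hR : 0 ≤ R)
    (hRA : ∀ q ∈ incSet A, |q.2| ≤ R) (hRB : ∀ q ∈ incSet B, |q.2| ≤ R)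
    {ε : ℝ} (hε : 0 < ε) (hε1 : ε ≤ 1) :
    ∃ p ∈ Set.Icc x₀ x₁ ×ˢ Set.Icc (-(R + 2)) (R + 2), ∃ θ₁ θ₂ : ℝ, 0 ≤ θ₁ ∧ θ₁ ≤ Real.pi ∧
      0 ≤ θ₂ ∧ θ₂ ≤ Real.pi ∧ Real.pi ≤ θ₁ + θ₂ ∧
      Encloses A {q | q.1 - p.1 ≤ 2 * ε ∧
        -(4 * ε) ≤ lin (Real.cos θ₁, -Real.sin θ₁) (q - p)} M₁ ∧
      Encloses A {q | p.1 - q.1 ≤ 2 * ε ∧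
        -(4 * ε) ≤ lin (-Real.cos θ₂, -Real.sin θ₂) (q - p)} M₂ ∧
      Encloses A (topWedge p θ₁ θ₂) M₃ ∧ Encloses B (leftWedge p θ₁) N₁ ∧
      Encloses B (rightWedge p θ₂) N₂ ∧ Encloses B (topWedge p θ₁ θ₂) N₃ := by
  have hM₁' : 0 < M₁ := by linarith
  have hM₂' : 0 < M₂ := by linarith
  have hM₃' : 0 < M₃ := by linarith
  have hcard : (0 : ℝ) ≤ A.card := by positivity
  have hM₁A : M₁ ≤ A.card := by
    have := one_le_mul_of_one_le_of_one_le hM₂.le hM₃.le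
    nlinarith
  have hM₂A : M₂ ≤ A.card := by
    have := one_le_mul_of_one_le_of_one_le hM₁.le hM₃.le
    nlinarith
  obtain ⟨a₁, ha₁c, ha₁, ha₁'⟩ := exists_threshold hA hM₁ hM₁A
    (fun q p : ℝ × ℝ => fuzzyAngle ε (q - p)) fun q =>
      (continuous_fuzzyAngle hε).comp (by fun_prop)
  obtain ⟨a₂, ha₂c, ha₂, ha₂'⟩ := exists_threshold hA hM₂ hM₂A
    (fun q p : ℝ × ℝ => fuzzyAngle ε (-(q - p).1, (q - p).2)) fun q =>
      (continuous_fuzzyAngle hε).comp (by fun_prop)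
  have hmirror : ∀ (θ : ℝ) (v : ℝ × ℝ), lin (Real.cos θ, -Real.sin θ) (-v.1, v.2) =
      lin (-Real.cos θ, -Real.sin θ) v := by intros; simp [lin]
  have ha₁π : ∀ p : ℝ × ℝ, x₀ ≤ p.1 → a₁ p ≤ Real.pi := fun p hp =>
    (ha₁ p _).2 (hx₀A.mono (fun q hq => fuzzyAngle_le_pi ε (by
      simp only [Set.mem_ofPred_eq, Prod.fst_sub] at hq ⊢; linarith)) le_rfl)
  have ha₂π : ∀ p : ℝ × ℝ, p.1 ≤ x₁ → a₂ p ≤ Real.pi := fun p hp =>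
    (ha₂ p _).2 (hx₁A.mono (fun q hq => fuzzyAngle_le_pi ε (by
      simp only [Set.mem_ofPred_eq, Prod.fst_sub] at hq ⊢; linarith)) le_rfl)
  have hgood₁ : ∀ p : ℝ × ℝ, 0 ≤ a₁ p →
      ¬ Encloses A {q | q.1 ≤ p.1 ∧ 0 < lin (Real.cos (a₁ p), -Real.sin (a₁ p)) (q - p)} M₁ :=
    fun p h0 hE => lt_irrefl _ ((ha₁' p (a₁ p)).2 (hE.mono (fun q hq =>
      fuzzyAngle_lt hε (by simpa using hq.1) h0 hq.2) le_rfl))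
  have hgood₂ : ∀ p : ℝ × ℝ, 0 ≤ a₂ p →
      ¬ Encloses A {q | p.1 ≤ q.1 ∧ 0 < lin (-Real.cos (a₂ p), -Real.sin (a₂ p)) (q - p)} M₂ :=
    fun p h0 hE => lt_irrefl _ ((ha₂' p (a₂ p)).2 (hE.mono (fun q hq =>
      fuzzyAngle_lt hε (by simpa using hq.1) h0 (by rw [hmirror]; exact hq.2)) le_rfl))
  let θ₁ : ℝ × ℝ → ℝ := fun p => max (a₁ p) (min (Real.pi - a₂ p) (Real.pi / 2))
  let θ₂ : ℝ × ℝ → ℝ := fun p => max (a₂ p) (min (Real.pi - a₁ p) (Real.pi / 2))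
  have hθ₁c : Continuous θ₁ := by fun_prop
  have hθ₂c : Continuous θ₂ := by fun_prop
  have hπ := Real.pi_pos
  have hθ : ∀ p ∈ Set.Icc x₀ x₁ ×ˢ Set.Icc (-(R + 2)) (R + 2), 0 ≤ θ₁ p ∧ θ₁ p ≤ Real.pi ∧
      0 ≤ θ₂ p ∧ θ₂ p ≤ Real.pi ∧ Real.pi ≤ θ₁ p + θ₂ p := by
    rintro p ⟨⟨h1, h2⟩, -⟩
    have e1 := ha₁π p h1
    have e2 := ha₂π p h2
    refine ⟨le_max_of_le_right (le_min (by linarith) (by linarith)),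
      max_le e1 (min_le_of_right_le (by linarith)),
      le_max_of_le_right (le_min (by linarith) (by linarith)),
      max_le e2 (min_le_of_right_le (by linarith)), ?_⟩
    exact le_max_add_max _ _ _
  have hbig : ∀ p, Real.pi ≤ a₁ p + a₂ p → θ₁ p = a₁ p ∧ θ₂ p = a₂ p := by
    intro p hp
    constructor
    · exact max_eq_left (min_le_of_left_le (by linarith))
    · exact max_eq_left (min_le_of_left_le (by linarith))
  have hsmall : ∀ p, a₁ p + a₂ p < Real.pi → θ₁ p + θ₂ p = Real.pi := by
    intro p hp
    exact max_add_max_eq hp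
  let F : Fin 3 → Set (ℝ × ℝ) := ![{p | Encloses B (leftWedge p (θ₁ p)) N₁},
    {p | Encloses B (rightWedge p (θ₂ p)) N₂}, {p | Encloses B (topWedge p (θ₁ p) (θ₂ p)) N₃}]
  have hcommon : ∃ p ∈ Set.Icc x₀ x₁ ×ˢ Set.Icc (-(R + 2)) (R + 2), ∀ k, p ∈ F k := by
    refine rectangle_covering hx (by linarith) F ?_ ?_ ?_ ?_ ?_ ?_
    · intro k
      fin_cases k
      · refine isClosed_encloses B N₁ _ fun q => ?_
        change IsClosed ({p : ℝ × ℝ | q.1 ≤ p.1} ∩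
          {p | 0 ≤ lin (Real.cos (θ₁ p), -Real.sin (θ₁ p)) (q - p)})
        simp only [lin]
        exact (isClosed_le (by fun_prop) (by fun_prop)).inter
          (isClosed_le (by fun_prop) (by fun_prop))
      · refine isClosed_encloses B N₂ _ fun q => ?_
        change IsClosed ({p : ℝ × ℝ | p.1 ≤ q.1} ∩
          {p | 0 ≤ lin (-Real.cos (θ₂ p), -Real.sin (θ₂ p)) (q - p)})
        simp only [lin]
        exact (isClosed_le (by fun_prop) (by fun_prop)).inter
          (isClosed_le (by fun_prop) (by fun_prop))
      · refine isClosed_encloses B N₃ _ fun q => ?_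
        change IsClosed ({p : ℝ × ℝ | lin (Real.cos (θ₁ p), -Real.sin (θ₁ p)) (q - p) ≤ 0} ∩
          {p | lin (-Real.cos (θ₂ p), -Real.sin (θ₂ p)) (q - p) ≤ 0})
        simp only [lin]
        exact (isClosed_le (by fun_prop) (by fun_prop)).inter
          (isClosed_le (by fun_prop) (by fun_prop))
    · intro p hp
      obtain ⟨h1, h2, h3, h4, h5⟩ := hθ p hp
      rcases encloses_wedges hB p h1 h2 h3 h4 h5 (by linarith : 0 < N₁) (by linarith : 0 < N₂)
        (by linarith : 0 < N₃) hN with h | h | h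
      · exact ⟨0, h.mono (fun q hq => ⟨hq.1, hq.2.le⟩) le_rfl⟩
      · exact ⟨1, h.mono (fun q hq => ⟨hq.1, hq.2.le⟩) le_rfl⟩
      · exact ⟨2, h⟩
    · intro x hxx
      set p : ℝ × ℝ := (x, -(R + 2)) with hp
      have hpQ : p ∈ Set.Icc x₀ x₁ ×ˢ Set.Icc (-(R + 2)) (R + 2) :=
        ⟨hxx, le_rfl, by simp only [hp]; linarith⟩
      obtain ⟨h1, h2, h3, h4, -⟩ := hθ p hpQ
      have hw : ∀ q ∈ incSet A, 2 ≤ (q - p).2 := by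
        intro q hq
        have := (abs_le.1 (hRA q hq)).1
        simp only [hp, Prod.snd_sub]
        linarith
      have hb₁ : Real.pi / 2 ≤ a₁ p := by
        by_contra hcon
        obtain ⟨q, hq, hq'⟩ := ((ha₁' p _).1 (not_le.1 hcon)).nonempty_incSet hA hM₁
        exact absurd hq' (not_lt.2 (pi_div_two_le_fuzzyAngle hε (by linarith [hw q hq])))
      have hb₂ : Real.pi / 2 ≤ a₂ p := by
        by_contra hcon
        obtain ⟨q, hq, hq'⟩ := ((ha₂' p _).1 (not_le.1 hcon)).nonempty_incSet hA hM₂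
        refine absurd hq' (not_lt.2 (pi_div_two_le_fuzzyAngle hε ?_))
        simp only
        linarith [hw q hq]
      obtain ⟨e1, e2⟩ := hbig p (by linarith)
      rw [e1] at h1 h2
      rw [e2] at h3 h4
      constructor
      · change ¬ Encloses B (leftWedge p (θ₁ p)) N₁
        rw [e1]
        intro hE
        refine not_encloses_halfplane hA H₁ hM₁' (by nlinarith) (cos_sin_ne_zero (a₁ p))
          (t := lin (Real.cos (a₁ p), -Real.sin (a₁ p)) p) (fun hE' => hgood₁ p h1
            (hE'.mono_on (fun q hq hq' => ?_) le_rfl)) (hE.mono (fun q hq => ?_) le_rfl)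
        · rw [Set.mem_ofPred_eq, ← sub_pos, ← lin_sub] at hq'
          refine ⟨?_, hq'⟩
          by_contra hcon
          have hc := Real.cos_nonpos_of_pi_div_two_le_of_le hb₁ (by linarith)
          have hs := Real.sin_nonneg_of_nonneg_of_le_pi h1 h2
          have hu : 0 ≤ (q - p).1 := by simp only [Prod.fst_sub]; linarith
          simp only [lin] at hq'
          nlinarith [hw q hq, mul_nonneg (neg_nonneg.2 hc) hu]
        · have := hq.2
          rw [lin_sub] at this
          simp only [Set.mem_ofPred_eq]
          linarith
      · change ¬ Encloses B (rightWedge p (θ₂ p)) N₂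
        rw [e2]
        intro hE
        refine not_encloses_halfplane hA H₂ hM₂' (by nlinarith) (neg_cos_sin_ne_zero (a₂ p))
          (t := lin (-Real.cos (a₂ p), -Real.sin (a₂ p)) p) (fun hE' => hgood₂ p h3
            (hE'.mono_on (fun q hq hq' => ?_) le_rfl)) (hE.mono (fun q hq => ?_) le_rfl)
        · rw [Set.mem_ofPred_eq, ← sub_pos, ← lin_sub] at hq'
          refine ⟨?_, hq'⟩
          by_contra hcon
          have hc := Real.cos_nonpos_of_pi_div_two_le_of_le hb₂ (by linarith)
          have hs := Real.sin_nonneg_of_nonneg_of_le_pi h3 h4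
          have hu : (q - p).1 ≤ 0 := by simp only [Prod.fst_sub]; linarith
          simp only [lin] at hq'
          nlinarith [hw q hq, mul_nonneg (neg_nonneg.2 hc) (neg_nonneg.2 hu)]
        · have := hq.2
          rw [lin_sub] at this
          simp only [Set.mem_ofPred_eq]
          linarith
    · intro y _ hE
      exact hx₀B (Encloses.mono (A := B) hE (fun q hq => hq.1) le_rfl)
    · intro y _ hE
      exact hx₁B (Encloses.mono (A := B) hE (fun q hq => hq.1) le_rfl)
    · intro x hxx hE
      set p : ℝ × ℝ := (x, R + 2) with hp
      have hw : ∀ q : ℝ × ℝ, |q.2| ≤ R → (q - p).2 < 0 := by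
        intro q hq
        have := (abs_le.1 hq).2
        simp only [hp, Prod.snd_sub]
        linarith
      have hb₁ : a₁ p ≤ Real.pi / 2 := (ha₁ p _).2 (hx₀A.mono_on (fun q hq hq' =>
        fuzzyAngle_le_pi_div_two hε (by
          simp only [Set.mem_ofPred_eq, Prod.fst_sub, hp] at hq' ⊢; linarith [hxx.1])
          (hw q (hRA q hq)).le) le_rfl)
      have hb₂ : a₂ p ≤ Real.pi / 2 := (ha₂ p _).2 (hx₁A.mono_on (fun q hq hq' =>
        fuzzyAngle_le_pi_div_two hε (by
          simp only [Set.mem_ofPred_eq, Prod.fst_sub, hp] at hq' ⊢; linarith [hxx.2])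
          (hw q (hRA q hq)).le) le_rfl)
      have e1 : θ₁ p = Real.pi / 2 := by
        simp only [θ₁]
        rw [min_eq_right (by linarith), max_eq_right hb₁]
      obtain ⟨q, hq, hq'⟩ := Encloses.nonempty_incSet (A := B) hB hE hN₃
      have := hq'.1
      rw [e1] at this
      have hneg := hw q (hRB q hq)
      simp only [lin, Real.cos_pi_div_two, Real.sin_pi_div_two] at this
      linarith
  obtain ⟨p, hp, hpF⟩ := hcommon
  have hp₁ : Encloses B (leftWedge p (θ₁ p)) N₁ := hpF 0
  have hp₂ : Encloses B (rightWedge p (θ₂ p)) N₂ := hpF 1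
  have hp₃ : Encloses B (topWedge p (θ₁ p) (θ₂ p)) N₃ := hpF 2
  obtain ⟨h1, h2, h3, h4, h5⟩ := hθ p hp
  refine ⟨p, hp, θ₁ p, θ₂ p, h1, h2, h3, h4, h5, ?_, ?_, ?_, hp₁, hp₂, hp₃⟩
  · refine ((ha₁ p (θ₁ p)).1 (le_max_left _ _)).mono (fun q hq => ?_) le_rfl
    simpa using of_fuzzyAngle_le hε h2 hq
  · refine ((ha₂ p (θ₂ p)).1 (le_max_left _ _)).mono (fun q hq => ?_) le_rfl
    have := of_fuzzyAngle_le hε h4 hq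
    rw [hmirror] at this
    simpa using this
  · rcases le_or_gt Real.pi (a₁ p + a₂ p) with h | h
    · obtain ⟨e1, e2⟩ := hbig p h
      rcases encloses_wedges hA p h1 h2 h3 h4 h5 hM₁' hM₂' hM₃' hM with h | h | h
      · rw [e1] at h
        exact absurd h (hgood₁ p (e1 ▸ h1))
      · rw [e2] at h
        exact absurd h (hgood₂ p (e2 ▸ h3))
      · exact h
    · have e1 : θ₂ p = Real.pi - θ₁ p := by linarith [hsmall p h]
      have hset : topWedge p (θ₁ p) (θ₂ p) =
          {q | lin (-(Real.cos (θ₁ p), -Real.sin (θ₁ p))) p ≤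
            lin (-(Real.cos (θ₁ p), -Real.sin (θ₁ p))) q} := by
        ext q
        rw [topWedge, e1, Real.cos_pi_sub, Real.sin_pi_sub, neg_neg]
        simp only [Set.mem_ofPred_eq, lin_sub, lin_neg_left, and_self]
        constructor <;> intro <;> linarith
      by_contra hcon
      rw [hset] at hcon hp₃
      exact not_encloses_halfplane hA H₃ hM₃' (by nlinarith)
        (neg_ne_zero.2 (cos_sin_ne_zero _)) (fun hE => hcon (hE.mono (fun q hq => by
            simp only [Set.mem_ofPred_eq] at hq ⊢
            exact hq.le) le_rfl)) hp₃

theorem interior_inter_eq_empty {C D : Set (ℝ × ℝ)} {e : ℝ × ℝ} (he : e ≠ 0) {c : ℝ}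
    (hC : ∀ q ∈ C, lin e q ≤ c) (hD : ∀ q ∈ D, c ≤ lin e q) :
    interior C ∩ interior D = ∅ := by
  rw [← interior_inter, Set.eq_empty_iff_forall_notMem]
  intro x hx
  have hcont : Filter.Tendsto (fun t : ℝ => x + t • e) (nhds 0) (nhds x) := by
    have : Continuous fun t : ℝ => x + t • e := by fun_prop
    simpa using this.tendsto 0
  have hev := (hcont.eventually (isOpen_interior.mem_nhds hx)).filter_mono
    (nhdsWithin_le_nhds (s := Set.Ioi (0 : ℝ)))
  obtain ⟨t, ht, ht0⟩ := (hev.and self_mem_nhdsWithin).exists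
  have hx' := interior_subset hx
  have ht' := interior_subset ht
  have h1 := hD x hx'.2
  have h2 := hC _ ht'.1
  rw [lin_add_smul] at h2
  have h3 : 0 < lin e e := by
    simp only [lin]
    rcases not_and_or.1 (fun h => he (Prod.ext_iff.2 h)) with h | h
    · nlinarith [mul_self_pos.2 h, mul_self_nonneg e.2]
    · nlinarith [mul_self_pos.2 h, mul_self_nonneg e.1]
  have := mul_pos (Set.mem_Ioi.1 ht0) h3
  linarith

theorem convex_lin_le (e : ℝ × ℝ) (c : ℝ) : Convex ℝ {q | lin e q ≤ c} := by
  refine convex_halfSpace_le ⟨fun x y => ?_, fun a x => ?_⟩ c <;> simp [lin] <;> ring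

theorem convex_le_lin (e : ℝ × ℝ) (c : ℝ) : Convex ℝ {q | c ≤ lin e q} := by
  refine convex_halfSpace_ge ⟨fun x y => ?_, fun a x => ?_⟩ c <;> simp [lin] <;> ring

theorem leftWedge_eq (p : ℝ × ℝ) (θ : ℝ) : leftWedge p θ = {q | lin (1, 0) q ≤ p.1} ∩
    {q | lin (Real.cos θ, -Real.sin θ) p ≤ lin (Real.cos θ, -Real.sin θ) q} := by
  ext q
  have h : lin (1, 0) q = q.1 := by simp [lin]
  simp only [leftWedge, lin_sub, sub_nonneg, Set.mem_inter_iff, Set.mem_ofPred_eq, h]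

theorem rightWedge_eq (p : ℝ × ℝ) (θ : ℝ) : rightWedge p θ = {q | p.1 ≤ lin (1, 0) q} ∩
    {q | lin (-Real.cos θ, -Real.sin θ) p ≤ lin (-Real.cos θ, -Real.sin θ) q} := by
  ext q
  have h : lin (1, 0) q = q.1 := by simp [lin]
  simp only [rightWedge, lin_sub, sub_nonneg, Set.mem_inter_iff, Set.mem_ofPred_eq, h]

theorem topWedge_eq (p : ℝ × ℝ) (θ₁ θ₂ : ℝ) : topWedge p θ₁ θ₂ =
    {q | lin (Real.cos θ₁, -Real.sin θ₁) q ≤ lin (Real.cos θ₁, -Real.sin θ₁) p} ∩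
    {q | lin (-Real.cos θ₂, -Real.sin θ₂) q ≤ lin (-Real.cos θ₂, -Real.sin θ₂) p} := by
  ext q
  simp [topWedge, lin_sub]

theorem convexPartition_wedges (p : ℝ × ℝ) {θ₁ θ₂ : ℝ} (h₁ : 0 ≤ θ₁) (hπ₁ : θ₁ ≤ Real.pi)
    (h₂ : 0 ≤ θ₂) (hπ₂ : θ₂ ≤ Real.pi) (hsum : Real.pi ≤ θ₁ + θ₂) :
    ConvexPartition ![leftWedge p θ₁, rightWedge p θ₂, topWedge p θ₁ θ₂] := by
  have hlin : ∀ e : ℝ × ℝ, Continuous (lin e) := fun e => by unfold lin; fun_prop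
  have h01 : interior (leftWedge p θ₁) ∩ interior (rightWedge p θ₂) = ∅ :=
    interior_inter_eq_empty (e := (1, 0)) (c := p.1) (by simp) (fun q hq => by
      rw [leftWedge_eq] at hq; exact hq.1) fun q hq => by rw [rightWedge_eq] at hq; exact hq.1
  have h02 : interior (topWedge p θ₁ θ₂) ∩ interior (leftWedge p θ₁) = ∅ :=
    interior_inter_eq_empty (cos_sin_ne_zero θ₁) (fun q hq => by
      rw [topWedge_eq] at hq; exact hq.1) fun q hq => by rw [leftWedge_eq] at hq; exact hq.2
  have h12 : interior (topWedge p θ₁ θ₂) ∩ interior (rightWedge p θ₂) = ∅ :=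
    interior_inter_eq_empty (neg_cos_sin_ne_zero θ₂) (fun q hq => by
      rw [topWedge_eq] at hq; exact hq.2) fun q hq => by rw [rightWedge_eq] at hq; exact hq.2
  refine ⟨?_, ?_, ?_, ?_⟩
  · intro j
    fin_cases j
    · change IsClosed (leftWedge p θ₁)
      rw [leftWedge_eq]
      exact (isClosed_le (hlin _) continuous_const).inter (isClosed_le continuous_const (hlin _))
    · change IsClosed (rightWedge p θ₂)
      rw [rightWedge_eq]
      exact (isClosed_le continuous_const (hlin _)).inter (isClosed_le continuous_const (hlin _))
    · change IsClosed (topWedge p θ₁ θ₂)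
      rw [topWedge_eq]
      exact (isClosed_le (hlin _) continuous_const).inter (isClosed_le (hlin _) continuous_const)
  · intro j
    fin_cases j
    · change Convex ℝ (leftWedge p θ₁)
      rw [leftWedge_eq]
      exact (convex_lin_le _ _).inter (convex_le_lin _ _)
    · change Convex ℝ (rightWedge p θ₂)
      rw [rightWedge_eq]
      exact (convex_le_lin _ _).inter (convex_le_lin _ _)
    · change Convex ℝ (topWedge p θ₁ θ₂)
      rw [topWedge_eq]
      exact (convex_lin_le _ _).inter (convex_lin_le _ _)
  · refine Set.eq_univ_of_forall fun q => Set.mem_iUnion.2 ?_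
    by_contra hcon
    push Not at hcon
    have hl : q ∉ leftWedge p θ₁ := hcon 0
    have hr : q ∉ rightWedge p θ₂ := hcon 1
    have ht : q ∉ topWedge p θ₁ θ₂ := hcon 2
    simp only [leftWedge, rightWedge, topWedge, Set.mem_ofPred_eq, not_and, not_le] at hl hr ht
    have hs₁ := Real.sin_nonneg_of_nonneg_of_le_pi h₁ hπ₁
    have hs₂ := Real.sin_nonneg_of_nonneg_of_le_pi h₂ hπ₂
    rcases lt_trichotomy q.1 p.1 with h | h | h
    · have hl' := hl h.le
      exact hl'.not_gt (left_pos_of_right_pos h₁ hπ₁ h₂ hπ₂ hsum (by simpa using h) (ht hl'.le))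
    · have hl' := hl h.le
      have ht' := ht hl'.le
      simp only [lin, Prod.fst_sub, Prod.snd_sub, h, sub_self, mul_zero, zero_add] at hl' ht'
      rcases le_total 0 (q.2 - p.2) with h' | h' <;> nlinarith
    · have hr' := hr h.le
      by_cases h0 : 0 < lin (Real.cos θ₁, -Real.sin θ₁) (q - p)
      · exact hr'.not_gt (right_pos_of_left_pos h₁ hπ₁ h₂ hπ₂ hsum (by simpa using h) h0)
      · exact hr'.not_gt (ht (not_lt.1 h0))
  · intro i j hij
    fin_cases i <;> fin_cases j <;> first | exact absurd rfl hij | skip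
    · exact h01
    · exact (Set.inter_comm _ _).trans h02
    · exact (Set.inter_comm _ _).trans h01
    · exact (Set.inter_comm _ _).trans h12
    · exact h02
    · exact h12

theorem incSet_finite {A : Finset (Set (ℝ × ℝ))} (hA : LineFamily A) : (incSet A).Finite := by
  refine (A.offDiag.finite_toSet.biUnion (t := fun x => x.1 ∩ x.2) fun x hx => ?_).subset ?_
  · obtain ⟨h1, h2, h3⟩ := Finset.mem_offDiag.1 hx
    obtain ⟨p, -, hp⟩ := hA.2 _ h1 _ h2 h3
    exact Set.Subsingleton.finite fun a ha b hb => (hp a ha).trans (hp b hb).symm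
  · rintro q ⟨x, hx, y, hy, hxy, hq⟩
    exact Set.mem_biUnion (x := (x, y)) (Finset.mem_coe.2 (Finset.mem_offDiag.2 ⟨hx, hy, hxy⟩)) hq

theorem exists_abs_snd_le {A : Finset (Set (ℝ × ℝ))} (hA : LineFamily A) :
    ∃ R, ∀ q ∈ incSet A, |q.2| ≤ R := by
  obtain ⟨R, hR⟩ := ((incSet_finite hA).image fun q => |q.2|).bddAbove
  exact ⟨R, fun q hq => hR (Set.mem_image_of_mem _ hq)⟩

theorem exists_wedges {A B : Finset (Set (ℝ × ℝ))} (hA : LineFamily A)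
    (hB : LineFamily B) {M₁ M₂ M₃ N₁ N₂ N₃ : ℝ} (hM₁ : 1 < M₁) (hM₂ : 1 < M₂) (hM₃ : 1 < M₃)
    (hN₁ : 1 < N₁) (hN₂ : 1 < N₂) (hN₃ : 1 < N₃) (hM : M₁ * M₂ * M₃ ≤ 2 / 3 * A.card)
    (hN : N₁ * N₂ * N₃ ≤ 2 / 3 * B.card)
    (H₁ : ∀ e : ℝ × ℝ, e ≠ 0 → ∀ t, Encloses A {q | t ≤ lin e q} (M₂ * M₃) →
      ¬ Encloses B {q | lin e q ≤ t} N₁)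
    (H₂ : ∀ e : ℝ × ℝ, e ≠ 0 → ∀ t, Encloses A {q | t ≤ lin e q} (M₁ * M₃) →
      ¬ Encloses B {q | lin e q ≤ t} N₂)
    (H₃ : ∀ e : ℝ × ℝ, e ≠ 0 → ∀ t, Encloses A {q | t ≤ lin e q} (M₁ * M₂) →
      ¬ Encloses B {q | lin e q ≤ t} N₃) :
    ∃ W : Fin 3 → Set (ℝ × ℝ), ConvexPartition W ∧
      (Encloses A (W 0) M₁ ∧ Encloses A (W 1) M₂ ∧ Encloses A (W 2) M₃) ∧
      Encloses B (W 0) N₁ ∧ Encloses B (W 1) N₂ ∧ Encloses B (W 2) N₃ := by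
  have hcard : (0 : ℝ) ≤ A.card := by positivity
  have h23 := one_le_mul_of_one_le_of_one_le hM₂.le hM₃.le
  have h13 := one_le_mul_of_one_le_of_one_le hM₁.le hM₃.le
  obtain ⟨a, -, ha, ha'⟩ := exists_threshold hA hM₁ (by nlinarith) (P := Unit)
    (fun q _ => q.1) fun _ => continuous_const
  obtain ⟨b, -, hb, hb'⟩ := exists_threshold hA hM₂ (by nlinarith) (P := Unit)
    (fun q _ => -q.1) fun _ => continuous_const
  set x₀ := a () with hx₀
  set x₁ := -b () with hx₁
  have hx₀A' : ¬ Encloses A {q | -x₀ < lin (-1, 0) q} M₁ := fun h =>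
    lt_irrefl _ ((ha' () x₀).2 (h.mono (fun q hq => by simpa [lin] using hq) le_rfl))
  have hx₁A' : ¬ Encloses A {q | x₁ < lin (1, 0) q} M₂ := fun h =>
    lt_irrefl _ ((hb' () (b ())).2 (h.mono (fun q hq => by
      simp only [Set.mem_ofPred_eq, lin] at hq ⊢; linarith) le_rfl))
  have hx : x₀ ≤ x₁ := by
    rw [hx₁, le_neg]
    refine (hb () (-x₀)).2 (((encloses_halfplane hA (by simp) (-x₀) (by linarith : 0 < M₁)
      (N := M₂ * M₃) (by nlinarith)).resolve_left hx₀A').mono (fun q hq => ?_) (by nlinarith))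
    simpa [lin] using hq
  have hx₀A : Encloses A {q | q.1 ≤ x₀} M₁ := (ha () x₀).1 le_rfl
  have hx₁A : Encloses A {q | x₁ ≤ q.1} M₂ := ((hb () (b ())).1 le_rfl).mono (fun q hq => by
    simp only [Set.mem_ofPred_eq] at hq ⊢; linarith) le_rfl
  have hx₀B : ¬ Encloses B {q | q.1 ≤ x₀} N₁ := fun h =>
    not_encloses_halfplane hA H₁ (by linarith) (by nlinarith) (by simp) hx₀A'
      (h.mono (fun q hq => by simpa [lin] using hq) le_rfl)
  have hx₁B : ¬ Encloses B {q | x₁ ≤ q.1} N₂ := fun h =>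
    not_encloses_halfplane hA H₂ (by linarith) (by nlinarith) (by simp) hx₁A'
      (h.mono (fun q hq => by simpa [lin] using hq) le_rfl)
  obtain ⟨RA, hRA⟩ := exists_abs_snd_le hA
  obtain ⟨RB, hRB⟩ := exists_abs_snd_le hB
  set R := max 0 (max RA RB)
  have happrox := fun {ε : ℝ} => exists_approximate_wedges hA hB hM₁ hM₂ hM₃ hN₁ hN₂ hN₃ hM hN
    H₁ H₂ H₃ hx hx₀A hx₁A hx₀B hx₁B (le_max_left _ _ : 0 ≤ R)
    (fun q hq => (hRA q hq).trans ((le_max_left _ _).trans (le_max_right _ _)))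
    (fun q hq => (hRB q hq).trans ((le_max_right _ _).trans (le_max_right _ _))) (ε := ε)
  let K : Set ((ℝ × ℝ) × ℝ × ℝ × ℝ) := (Set.Icc x₀ x₁ ×ˢ Set.Icc (-(R + 2)) (R + 2)) ×ˢ
    Set.Icc 0 Real.pi ×ˢ Set.Icc 0 Real.pi ×ˢ Set.Icc 0 1
  have hK : IsCompact K := (isCompact_Icc.prod isCompact_Icc).prod
    (isCompact_Icc.prod (isCompact_Icc.prod isCompact_Icc))
  let E : Set ((ℝ × ℝ) × ℝ × ℝ × ℝ) := {x | Real.pi ≤ x.2.1 + x.2.2.1} ∩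
    ({x | Encloses A {q | q.1 - x.1.1 ≤ 2 * x.2.2.2 ∧
        -(4 * x.2.2.2) ≤ lin (Real.cos x.2.1, -Real.sin x.2.1) (q - x.1)} M₁} ∩
    ({x | Encloses A {q | x.1.1 - q.1 ≤ 2 * x.2.2.2 ∧
        -(4 * x.2.2.2) ≤ lin (-Real.cos x.2.2.1, -Real.sin x.2.2.1) (q - x.1)} M₂} ∩
    ({x | Encloses A (topWedge x.1 x.2.1 x.2.2.1) M₃} ∩
    ({x | Encloses B (leftWedge x.1 x.2.1) N₁} ∩
    ({x | Encloses B (rightWedge x.1 x.2.2.1) N₂} ∩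
    {x | Encloses B (topWedge x.1 x.2.1 x.2.2.1) N₃})))))
  have hE : IsClosed E := by
    refine (isClosed_le (by fun_prop) (by fun_prop)).inter
      (IsClosed.inter (isClosed_encloses _ _ _ fun q => ?_)
      (IsClosed.inter (isClosed_encloses _ _ _ fun q => ?_)
      (IsClosed.inter (isClosed_encloses _ _ _ fun q => ?_)
      (IsClosed.inter (isClosed_encloses _ _ _ fun q => ?_)
      (IsClosed.inter (isClosed_encloses _ _ _ fun q => ?_)
      (isClosed_encloses _ _ _ fun q => ?_))))))
    all_goals
      simp only [lin, leftWedge, rightWedge, topWedge, Set.ofPred_and]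
      exact (isClosed_le (by fun_prop) (by fun_prop)).inter
        (isClosed_le (by fun_prop) (by fun_prop))
  have hEK : ∀ ε : ℝ, 0 < ε → ε ≤ 1 → ∃ x ∈ K ∩ E, x.2.2.2 = ε := by
    intro ε hε hε1
    obtain ⟨p, hp, θ₁, θ₂, h1, h2, h3, h4, h5, h6⟩ := happrox hε hε1
    exact ⟨(p, θ₁, θ₂, ε), ⟨⟨hp, ⟨h1, h2⟩, ⟨h3, h4⟩, hε.le, hε1⟩, h5, h6⟩, rfl⟩
  obtain ⟨x₁, hx₁, -⟩ := hEK 1 one_pos le_rfl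
  obtain ⟨x, hxE, hmin⟩ := (hK.inter_right hE).exists_isMinOn ⟨x₁, hx₁⟩
    (f := fun x => x.2.2.2) (by fun_prop)
  obtain ⟨⟨hp, ⟨h1, h2⟩, ⟨h3, h4⟩, hδ, hδ1⟩, h5, h6, h7, h8, h9, h10, h11⟩ := hxE
  have hδ0 : x.2.2.2 = 0 := by
    by_contra hne
    have hpos : 0 < x.2.2.2 := lt_of_le_of_ne hδ (Ne.symm hne)
    obtain ⟨y, hy, hy'⟩ := hEK (x.2.2.2 / 2) (by linarith) (by linarith)
    have : x.2.2.2 ≤ y.2.2.2 := hmin hy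
    linarith
  refine ⟨_, convexPartition_wedges x.1 h1 h2 h3 h4 h5, ⟨?_, ?_, h8⟩, h9, h10, h11⟩
  · refine h6.mono (fun q hq => ?_) le_rfl
    simpa [hδ0, leftWedge] using hq
  · refine h7.mono (fun q hq => ?_) le_rfl
    simpa [hδ0, rightWedge] using hq

/-- No closed half-plane enclosing `n` lines of `B` has a complementary closed half-plane
enclosing `m` lines of `A`. -/
def Ahead (A B : Finset (Set (ℝ × ℝ))) (m n : ℝ) : Prop :=
  ∀ e : ℝ × ℝ, e ≠ 0 → ∀ t, Encloses A {q | t ≤ lin e q} m → ¬ Encloses B {q | lin e q ≤ t} n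

theorem Ahead.symm {A B : Finset (Set (ℝ × ℝ))} {m n : ℝ} (h : Ahead A B m n) :
    Ahead B A n m := fun e he t hB hA =>
  h (-e) (neg_ne_zero.2 he) (-t) (hA.mono (fun q hq => by simpa [lin_neg_left] using hq) le_rfl)
    (hB.mono (fun q hq => by simpa [lin_neg_left] using hq) le_rfl)

theorem exists_halfplane_thresholds {A : Finset (Set (ℝ × ℝ))} (hA : LineFamily A) {m m' : ℝ}
    (hm : 1 < m) (hm' : 1 < m') (hmm : m * m' ≤ A.card) :
    ∃ a b : ℝ × ℝ → ℝ, Continuous a ∧ Continuous b ∧ (∀ e ≠ 0, a e ≤ b e) ∧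
      (∀ e t, a e ≤ t ↔ Encloses A {q | lin e q ≤ t} m) ∧
      ∀ e t, t ≤ b e ↔ Encloses A {q | t ≤ lin e q} m' := by
  have hc : ∀ q, Continuous fun e => lin e q := fun q => by unfold lin; fun_prop
  obtain ⟨a, hac, ha, -⟩ := exists_threshold hA hm (by nlinarith) (fun q e => lin e q) hc
  obtain ⟨b, hbc, hb, hb'⟩ := exists_threshold hA hm' (by nlinarith)
    (fun q e => lin (-e) q) fun q => (hc q).comp continuous_neg
  simp only [lin_neg_left] at hb hb'
  refine ⟨a, fun e => -b e, hac, hbc.neg, fun e he => ?_, ha, fun e t => ?_⟩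
  · refine (ha e _).2 ((encloses_halfplane hA he _ (by linarith : 0 < m')
      (by rwa [mul_comm])).resolve_left fun h => lt_irrefl (b e) ((hb' e _).2 ?_))
    exact h.mono (fun q hq => by simp only [Set.mem_ofPred_eq] at hq ⊢; linarith) le_rfl
  · rw [le_neg, hb]
    simp only [neg_le_neg_iff]

theorem ahead_dichotomy {A B : Finset (Set (ℝ × ℝ))} (hA : LineFamily A) (hB : LineFamily B)
    {m m' n n' : ℝ} (hm : 1 < m) (hm' : 1 < m') (hmm : m * m' ≤ A.card)
    (hn : 1 < n) (hn' : 1 < n') (hnn : n * n' ≤ B.card) :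
    (∃ e : ℝ × ℝ, e ≠ 0 ∧ ∃ t, Encloses A {q | lin e q ≤ t} m ∧ Encloses A {q | t ≤ lin e q} m' ∧
      Encloses B {q | lin e q ≤ t} n ∧ Encloses B {q | t ≤ lin e q} n') ∨
    Ahead A B m' n ∨ Ahead B A n' m := by
  obtain ⟨a, b, hac, hbc, hab, ha, hb⟩ := exists_halfplane_thresholds hA hm hm' hmm
  obtain ⟨c, d, hcc, hdc, hcd, hc, hd⟩ := exists_halfplane_thresholds hB hn hn' hnn
  by_cases hcut : ∃ e : ℝ × ℝ, e ≠ 0 ∧ a e ≤ d e ∧ c e ≤ b e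
  · obtain ⟨e, he, h1, h2⟩ := hcut
    refine Or.inl ⟨e, he, max (a e) (c e), (ha _ _).1 (le_max_left _ _), (hb _ _).1 ?_,
      (hc _ _).1 (le_max_right _ _), (hd _ _).1 ?_⟩
    · exact max_le (hab e he) h2
    · exact max_le h1 (hcd e he)
  · right
    push Not at hcut
    have hconn : IsPreconnected ({0}ᶜ : Set (ℝ × ℝ)) :=
      (isConnected_compl_singleton_of_one_lt_rank (by simp [← Module.finrank_eq_rank]) 0).2
    have hcov : ({0}ᶜ : Set (ℝ × ℝ)) ⊆ {e | b e < c e} ∪ {e | d e < a e} := by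
      intro e he
      rcases le_or_gt (a e) (d e) with h | h
      · exact Or.inl (hcut e he h)
      · exact Or.inr h
    have hdisj : ({0}ᶜ : Set (ℝ × ℝ)) ∩ ({e | b e < c e} ∩ {e | d e < a e}) = ∅ := by
      rw [Set.eq_empty_iff_forall_notMem]
      rintro e ⟨he, h1, h2⟩
      simp only [Set.mem_ofPred_eq] at h1 h2
      linarith [hab e he, hcd e he]
    rcases isPreconnected_iff_subset_of_disjoint.1 hconn _ _ (isOpen_lt hbc hcc)
      (isOpen_lt hdc hac) hcov hdisj with h | h
    · refine Or.inl fun e he t h1 h2 => ?_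
      have h3 : b e < c e := h he
      linarith [(hb e t).2 h1, (hc e t).2 h2]
    · refine Or.inr fun e he t h1 h2 => ?_
      have h3 : d e < a e := h he
      linarith [(hd e t).2 h1, (ha e t).2 h2]

theorem not_ahead_and_ahead {A B : Finset (Set (ℝ × ℝ))} (hA : LineFamily A) (hB : LineFamily B)
    {m m' n n' : ℝ} (hm : 1 < m) (hm' : 1 < m') (hmm : m * m' ≤ A.card)
    (hn : 1 < n) (hn' : 1 < n') (hnn : n * n' ≤ B.card) (h : Ahead A B m' n) :
    ¬ Ahead B A n' m := by
  obtain ⟨a, b, -, -, hab, ha, hb⟩ := exists_halfplane_thresholds hA hm hm' hmm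
  obtain ⟨c, d, -, -, hcd, hc, hd⟩ := exists_halfplane_thresholds hB hn hn' hnn
  intro h'
  have he : ((1, 0) : ℝ × ℝ) ≠ 0 := by simp
  have h1 : b (1, 0) < c (1, 0) := lt_of_not_ge fun hle =>
    h _ he _ ((hb _ _).1 le_rfl) ((hc _ _).1 hle)
  have h2 : d (1, 0) < a (1, 0) := lt_of_not_ge fun hle =>
    h' _ he _ ((hd _ _).1 le_rfl) ((ha _ _).1 hle)
  linarith [hab _ he, hcd _ he]

/-- The plane can be cut into convex parts `W i`, with positive integer weights `k i < r`
summing to `r`, so that each part encloses its weighted share of both families. -/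
def HasCut (A B : Finset (Set (ℝ × ℝ))) (r : ℕ) : Prop :=
  ∃ (n : ℕ) (k : Fin n → ℕ) (W : Fin n → Set (ℝ × ℝ)), ConvexPartition W ∧ ∑ i, k i = r ∧
    ∀ i, 0 < k i ∧ k i < r ∧ Encloses A (W i) ((2 / 3 * A.card : ℝ) ^ ((k i : ℝ) / r)) ∧
      Encloses B (W i) ((2 / 3 * B.card : ℝ) ^ ((k i : ℝ) / r))

theorem HasCut.symm {A B : Finset (Set (ℝ × ℝ))} {r : ℕ} (h : HasCut A B r) : HasCut B A r := by
  obtain ⟨n, k, W, hW, hk, h⟩ := h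
  exact ⟨n, k, W, hW, hk, fun i => ⟨(h i).1, (h i).2.1, (h i).2.2.2, (h i).2.2.1⟩⟩

theorem convexPartition_halfplanes {e : ℝ × ℝ} (he : e ≠ 0) (t : ℝ) :
    ConvexPartition ![{q | lin e q ≤ t}, {q | t ≤ lin e q}] := by
  have hlin : Continuous (lin e) := by unfold lin; fun_prop
  have h01 : interior {q | lin e q ≤ t} ∩ interior {q | t ≤ lin e q} = ∅ :=
    interior_inter_eq_empty he (fun q hq => hq) fun q hq => hq
  refine ⟨?_, ?_, ?_, ?_⟩
  · intro j
    fin_cases j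
    · exact isClosed_le hlin continuous_const
    · exact isClosed_le continuous_const hlin
  · intro j
    fin_cases j
    · exact convex_lin_le e t
    · exact convex_le_lin e t
  · refine Set.eq_univ_of_forall fun q => Set.mem_iUnion.2 ?_
    rcases le_total (lin e q) t with h | h
    · exact ⟨0, h⟩
    · exact ⟨1, h⟩
  · intro i j hij
    fin_cases i <;> fin_cases j <;> first | exact absurd rfl hij | skip
    · exact h01
    · exact (Set.inter_comm _ _).trans h01

theorem one_lt_rpow_div {x : ℝ} (hx : 1 < x) {k r : ℕ} (hk : 0 < k) (hkr : k < r) :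
    1 < x ^ ((k : ℝ) / r) := by
  have : (0 : ℝ) < r := by exact_mod_cast hk.trans hkr
  exact Real.one_lt_rpow hx (by positivity)

theorem rpow_div_mul_rpow_div {x : ℝ} (hx : 1 < x) {j k l : ℕ} (h : j + k = l) (r : ℕ) :
    x ^ ((j : ℝ) / r) * x ^ ((k : ℝ) / r) = x ^ ((l : ℝ) / r) := by
  rw [← Real.rpow_add (by linarith), ← add_div, ← h]
  push_cast
  rfl

theorem one_lt_two_thirds_card {A : Finset (Set (ℝ × ℝ))} (hA : 2 ≤ A.card) :
    (1 : ℝ) < 2 / 3 * A.card := by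
  have : (2 : ℝ) ≤ A.card := by exact_mod_cast hA
  linarith

theorem hasCut_of_ahead_one {A B : Finset (Set (ℝ × ℝ))} (hA : LineFamily A) (hB : LineFamily B)
    (hA2 : 2 ≤ A.card) (hB2 : 2 ≤ B.card) {r : ℕ} (hr : 2 ≤ r)
    (hahead : ∀ k, 0 < k → k < r →
      Ahead A B ((2 / 3 * A.card : ℝ) ^ (((r - k : ℕ) : ℝ) / r))
        ((2 / 3 * B.card : ℝ) ^ ((k : ℝ) / r)) ∨
      Ahead B A ((2 / 3 * B.card : ℝ) ^ (((r - k : ℕ) : ℝ) / r))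
        ((2 / 3 * A.card : ℝ) ^ ((k : ℝ) / r)))
    (hone : Ahead A B ((2 / 3 * A.card : ℝ) ^ (((r - 1 : ℕ) : ℝ) / r))
        ((2 / 3 * B.card : ℝ) ^ (((1 : ℕ) : ℝ) / r))) : HasCut A B r := by
  have ha := one_lt_two_thirds_card hA2
  have hb := one_lt_two_thirds_card hB2
  set a : ℝ := 2 / 3 * A.card with ha'
  set b : ℝ := 2 / 3 * B.card with hb'
  have hr0 : (r : ℝ) ≠ 0 := by positivity
  have hpow : ∀ x : ℝ, x ^ ((r : ℝ) / r) = x := fun x => by rw [div_self hr0, Real.rpow_one]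
  have hle : ∀ S : Finset (Set (ℝ × ℝ)), (2 / 3 * S.card : ℝ) ≤ S.card := fun S => by
    linarith [(Nat.cast_nonneg S.card : (0 : ℝ) ≤ S.card)]
  have hexcl : ∀ k, 0 < k → k < r → Ahead A B (a ^ (((r - k : ℕ) : ℝ) / r)) (b ^ ((k : ℝ) / r)) →
      ¬ Ahead B A (b ^ (((r - k : ℕ) : ℝ) / r)) (a ^ ((k : ℝ) / r)) := fun k hk hkr =>
    not_ahead_and_ahead hA hB (one_lt_rpow_div ha hk hkr)
      (one_lt_rpow_div ha (Nat.sub_pos_of_lt hkr) (by omega))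
      (by rw [rpow_div_mul_rpow_div ha (by omega : k + (r - k) = r), hpow]; exact hle A)
      (one_lt_rpow_div hb hk hkr) (one_lt_rpow_div hb (Nat.sub_pos_of_lt hkr) (by omega))
      (by rw [rpow_div_mul_rpow_div hb (by omega : k + (r - k) = r), hpow]; exact hle B)
  have hex : ∃ k, 0 < k ∧ k < r ∧
      Ahead B A (b ^ (((r - k : ℕ) : ℝ) / r)) (a ^ ((k : ℝ) / r)) := by
    refine ⟨r - 1, by omega, by omega, ?_⟩
    rw [show r - (r - 1) = 1 by omega]
    exact hone.symm
  set k := Nat.find hex with hk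
  obtain ⟨hk0, hkr, hkB⟩ := Nat.find_spec hex
  rw [← hk] at hk0 hkr hkB
  have hk1 : k ≠ 1 := fun h => hexcl 1 one_pos (by omega) hone (by rwa [h] at hkB)
  have hpred := (hahead (k - 1) (by omega) (by omega)).resolve_right fun h =>
    Nat.find_min hex (show k - 1 < Nat.find hex by omega) ⟨by omega, by omega, h⟩
  have hk1r : k - 1 < r := by omega
  have hk1' : 0 < k - 1 := by omega
  have hrk : 0 < r - k := by omega
  have hrk' : r - k < r := by omega
  have h3 := hkB.symm
  obtain ⟨W, hW, ⟨hA1, hA2, hA3⟩, hB1, hB2, hB3⟩ := exists_wedges hA hB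
    (one_lt_rpow_div ha one_pos (by omega : 1 < r)) (one_lt_rpow_div ha hk1' hk1r)
    (one_lt_rpow_div ha hrk hrk')
    (one_lt_rpow_div hb one_pos (by omega : 1 < r)) (one_lt_rpow_div hb hk1' hk1r)
    (one_lt_rpow_div hb hrk hrk')
    (by rw [rpow_div_mul_rpow_div ha rfl, rpow_div_mul_rpow_div ha
      (by omega : 1 + (k - 1) + (r - k) = r), hpow])
    (by rw [rpow_div_mul_rpow_div hb rfl, rpow_div_mul_rpow_div hb
      (by omega : 1 + (k - 1) + (r - k) = r), hpow])
    (by rw [rpow_div_mul_rpow_div ha (by omega : k - 1 + (r - k) = r - 1)]; exact hone)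
    (by rw [rpow_div_mul_rpow_div ha (by omega : 1 + (r - k) = r - (k - 1))]; exact hpred)
    (by rw [rpow_div_mul_rpow_div ha (by omega : 1 + (k - 1) = k)]; exact h3)
  refine ⟨3, ![1, k - 1, r - k], W, hW, ?_, fun i => ?_⟩
  · simp only [Fin.sum_univ_three, Matrix.cons_val]
    omega
  · fin_cases i
    · exact ⟨one_pos, (by omega : 1 < r), hA1, hB1⟩
    · exact ⟨hk1', hk1r, hA2, hB2⟩
    · exact ⟨hrk, hrk', hA3, hB3⟩

theorem hasCut {A B : Finset (Set (ℝ × ℝ))} (hA : LineFamily A) (hB : LineFamily B)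
    (hA2 : 2 ≤ A.card) (hB2 : 2 ≤ B.card) {r : ℕ} (hr : 2 ≤ r) : HasCut A B r := by
  by_contra hno
  have ha := one_lt_two_thirds_card hA2
  have hb := one_lt_two_thirds_card hB2
  have hr0 : (r : ℝ) ≠ 0 := by positivity
  have hpow : ∀ S : Finset (Set (ℝ × ℝ)), (2 / 3 * S.card : ℝ) ^ ((r : ℝ) / r) ≤ S.card := by
    intro S
    rw [div_self hr0, Real.rpow_one]
    linarith [(Nat.cast_nonneg S.card : (0 : ℝ) ≤ S.card)]
  have hahead : ∀ k, 0 < k → k < r →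
      Ahead A B ((2 / 3 * A.card : ℝ) ^ (((r - k : ℕ) : ℝ) / r))
        ((2 / 3 * B.card : ℝ) ^ ((k : ℝ) / r)) ∨
      Ahead B A ((2 / 3 * B.card : ℝ) ^ (((r - k : ℕ) : ℝ) / r))
        ((2 / 3 * A.card : ℝ) ^ ((k : ℝ) / r)) := by
    intro k hk hkr
    have hrk : 0 < r - k := by omega
    have hrk' : r - k < r := by omega
    refine (ahead_dichotomy hA hB (one_lt_rpow_div ha hk hkr) (one_lt_rpow_div ha hrk hrk')
      (by rw [rpow_div_mul_rpow_div ha (by omega : k + (r - k) = r)]; exact hpow A)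
      (one_lt_rpow_div hb hk hkr) (one_lt_rpow_div hb hrk hrk')
      (by rw [rpow_div_mul_rpow_div hb (by omega : k + (r - k) = r)]; exact hpow B)).resolve_left ?_
    rintro ⟨e, he, t, h1, h2, h3, h4⟩
    refine hno ⟨2, ![k, r - k], _, convexPartition_halfplanes he t, ?_, fun i => ?_⟩
    · simp only [Fin.sum_univ_two, Matrix.cons_val]
      omega
    · fin_cases i
      · exact ⟨hk, hkr, h1, h3⟩
      · exact ⟨hrk, hrk', h2, h4⟩
  rcases hahead 1 one_pos (by omega) with h | h
  · exact hno (hasCut_of_ahead_one hA hB hA2 hB2 hr hahead h)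
  · exact hno (hasCut_of_ahead_one hB hA hB2 hA2 hr (fun k hk hkr => (hahead k hk hkr).symm) h).symm

theorem ConvexPartition.refine {n r : ℕ} {W : Fin n → Set (ℝ × ℝ)} (hW : ConvexPartition W)
    {k : Fin n → ℕ} {C : ∀ i, Fin (k i) → Set (ℝ × ℝ)} (hC : ∀ i, ConvexPartition (C i))
    (e : Fin r ≃ Σ i, Fin (k i)) :
    ConvexPartition fun j => W (e j).1 ∩ C (e j).1 (e j).2 := by
  refine ⟨fun j => (hW.1 _).inter ((hC _).1 _), fun j => (hW.2.1 _).inter ((hC _).2.1 _), ?_, ?_⟩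
  · refine Set.eq_univ_of_forall fun q => ?_
    obtain ⟨i, hi⟩ := Set.mem_iUnion.1 (hW.2.2.1.symm ▸ Set.mem_univ q : q ∈ ⋃ i, W i)
    obtain ⟨l, hl⟩ := Set.mem_iUnion.1 ((hC i).2.2.1.symm ▸ Set.mem_univ q : q ∈ ⋃ l, C i l)
    refine Set.mem_iUnion.2 ⟨e.symm ⟨i, l⟩, ?_⟩
    rw [e.apply_symm_apply]
    exact ⟨hi, hl⟩
  · intro j j' hjj
    have hne : e j ≠ e j' := e.injective.ne hjj
    dsimp only
    generalize e j = x at hne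
    generalize e j' = y at hne
    obtain ⟨i, l⟩ := x
    obtain ⟨i', l'⟩ := y
    rw [interior_inter, interior_inter, ← Set.subset_empty_iff]
    by_cases h : i = i'
    · subst h
      refine Set.Subset.trans ?_ ((hC i).2.2.2 (show l ≠ l' from fun h => hne (by rw [h]))).subset
      exact Set.inter_subset_inter Set.inter_subset_right Set.inter_subset_right
    · exact (Set.inter_subset_inter Set.inter_subset_left Set.inter_subset_left).trans
        (hW.2.2.2 h).subset

theorem exists_convexPartition_univ {r : ℕ} (hr : 0 < r) :
    ∃ C : Fin r → Set (ℝ × ℝ), ConvexPartition C ∧ C ⟨0, hr⟩ = Set.univ := by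
  refine ⟨fun j => if j = ⟨0, hr⟩ then Set.univ else ∅, ⟨fun j => ?_, fun j => ?_, ?_, ?_⟩,
    if_pos rfl⟩
  · dsimp only
    split_ifs
    exacts [isClosed_univ, isClosed_empty]
  · dsimp only
    split_ifs
    exacts [convex_univ, convex_empty]
  · exact Set.eq_univ_of_forall fun q => Set.mem_iUnion.2 ⟨⟨0, hr⟩, by simp⟩
  · intro i j hij
    dsimp only
    split_ifs with h1 h2
    · exact absurd (h1.trans h2.symm) hij
    all_goals simp

theorem log_two_thirds_neg : Real.log (2 / 3) < 0 := Real.log_neg (by norm_num) (by norm_num)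

theorem encloses_of_card_le_one {A : Finset (Set (ℝ × ℝ))} (hA : A.card ≤ 1) {r : ℕ} (hr : 0 < r)
    (K : Set (ℝ × ℝ)) :
    Encloses A K ((r : ℝ) ^ Real.log (2 / 3) * (A.card : ℝ) ^ ((1 : ℝ) / r)) := by
  refine ⟨A, subset_rfl, ?_, ?_⟩
  · rintro q ⟨x, hx, y, hy, hxy, -⟩
    exact absurd (Finset.card_le_one.1 hA x hx y hy) hxy
  · have hr' : (1 : ℝ) ≤ r := by exact_mod_cast hr
    have h := Real.rpow_le_one_of_one_le_of_nonpos hr' log_two_thirds_neg.le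
    rcases Nat.le_one_iff_eq_zero_or_eq_one.1 hA with h0 | h1
    · rw [h0, Nat.cast_zero, Real.zero_rpow (by positivity), mul_zero]
    · rw [h1, Nat.cast_one, Real.one_rpow, mul_one]
      exact h

theorem share_le {a x : ℝ} (ha : 0 ≤ a) {k r : ℕ} (hk : 0 < k) (hkr : k < r)
    (hx : (2 / 3 * a) ^ ((k : ℝ) / r) ≤ x) :
    (r : ℝ) ^ Real.log (2 / 3) * a ^ ((1 : ℝ) / r) ≤
      (k : ℝ) ^ Real.log (2 / 3) * x ^ ((1 : ℝ) / k) := by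
  have hk0 : (0 : ℝ) < k := by exact_mod_cast hk
  have hr0 : (0 : ℝ) < r := by exact_mod_cast hk.trans hkr
  have hkr' : (k : ℝ) + 1 ≤ r := by exact_mod_cast hkr
  have h1 : (2 / 3 : ℝ) ^ ((1 : ℝ) / r) * a ^ ((1 : ℝ) / r) ≤ x ^ ((1 : ℝ) / k) := by
    rw [← Real.mul_rpow (by norm_num) ha]
    refine le_trans (le_of_eq ?_) (Real.rpow_le_rpow (by positivity) hx (by positivity))
    rw [← Real.rpow_mul (by positivity)]
    congr 1
    field_simp
  have h2 : (r : ℝ) ^ Real.log (2 / 3) ≤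
      (k : ℝ) ^ Real.log (2 / 3) * (2 / 3 : ℝ) ^ ((1 : ℝ) / r) := by
    rw [Real.rpow_def_of_pos hr0, Real.rpow_def_of_pos hk0, Real.rpow_def_of_pos (by norm_num),
      ← Real.exp_add, Real.exp_le_exp]
    have h3 := Real.one_sub_inv_le_log_of_pos (div_pos hr0 hk0)
    rw [Real.log_div hr0.ne' hk0.ne', inv_div] at h3
    have h4 : (1 : ℝ) / r ≤ 1 - k / r := by
      rw [le_sub_iff_add_le, ← add_div, div_le_one hr0]
      linarith
    nlinarith [log_two_thirds_neg]
  calc (r : ℝ) ^ Real.log (2 / 3) * a ^ ((1 : ℝ) / r)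
      ≤ (k : ℝ) ^ Real.log (2 / 3) * (2 / 3 : ℝ) ^ ((1 : ℝ) / r) * a ^ ((1 : ℝ) / r) := by gcongr
    _ ≤ _ := by rw [mul_assoc]; gcongr

theorem exists_partition_encloses {r : ℕ} (hr : 0 < r) {A B : Finset (Set (ℝ × ℝ))}
    (hA : LineFamily A) (hB : LineFamily B) :
    ∃ C : Fin r → Set (ℝ × ℝ), ConvexPartition C ∧ ∀ j,
      Encloses A (C j) ((r : ℝ) ^ Real.log (2 / 3) * (A.card : ℝ) ^ ((1 : ℝ) / r)) ∧
      Encloses B (C j) ((r : ℝ) ^ Real.log (2 / 3) * (B.card : ℝ) ^ ((1 : ℝ) / r)) := by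
  induction r using Nat.strong_induction_on generalizing A B with
  | _ r ih =>
  rcases (show r = 1 ∨ 2 ≤ r by omega) with rfl | hr2
  · obtain ⟨C, hC, hC0⟩ := exists_convexPartition_univ hr
    refine ⟨C, hC, fun j => ?_⟩
    rw [Subsingleton.elim j ⟨0, hr⟩, hC0]
    constructor <;> exact ⟨_, subset_rfl, Set.subset_univ _, by simp⟩
  have key : ∀ A B : Finset (Set (ℝ × ℝ)), LineFamily A → LineFamily B → 2 ≤ A.card →
      2 ≤ B.card → ∃ C : Fin r → Set (ℝ × ℝ), ConvexPartition C ∧ ∀ j,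
      Encloses A (C j) ((r : ℝ) ^ Real.log (2 / 3) * (A.card : ℝ) ^ ((1 : ℝ) / r)) ∧
      Encloses B (C j) ((r : ℝ) ^ Real.log (2 / 3) * (B.card : ℝ) ^ ((1 : ℝ) / r)) := by
    intro A B hA hB hA2 hB2
    obtain ⟨n, k, W, hW, hk, hWk⟩ := hasCut hA hB hA2 hB2 hr2
    choose hk0 hkr hWA hWB using hWk
    choose S hSA hSW hS using hWA
    choose T hTB hTW hT using hWB
    choose C hC hE using fun i =>
      ih (k i) (hkr i) (hk0 i) (hA.subset (hSA i)) (hB.subset (hTB i))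
    let e : Fin r ≃ Σ i, Fin (k i) := (finSigmaFinEquiv.trans (finCongr hk)).symm
    refine ⟨_, hW.refine hC e, fun j => ?_⟩
    generalize e j = x
    constructor
    · obtain ⟨U, hUS, hUC, hU⟩ := (hE x.1 x.2).1
      exact ⟨U, hUS.trans (hSA _), Set.subset_inter ((incSet_mono hUS).trans (hSW _)) hUC,
        (share_le (Nat.cast_nonneg _) (hk0 _) (hkr _) (hS _)).trans hU⟩
    · obtain ⟨U, hUT, hUC, hU⟩ := (hE x.1 x.2).2
      exact ⟨U, hUT.trans (hTB _), Set.subset_inter ((incSet_mono hUT).trans (hTW _)) hUC,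
        (share_le (Nat.cast_nonneg _) (hk0 _) (hkr _) (hT _)).trans hU⟩
  rcases le_or_gt A.card 1 with hA1 | hA2 <;> rcases le_or_gt B.card 1 with hB1 | hB2
  · obtain ⟨C, hC, -⟩ := exists_convexPartition_univ hr
    exact ⟨C, hC, fun j => ⟨encloses_of_card_le_one hA1 hr _, encloses_of_card_le_one hB1 hr _⟩⟩
  · obtain ⟨C, hC, h⟩ := key B B hB hB hB2 hB2
    exact ⟨C, hC, fun j => ⟨encloses_of_card_le_one hA1 hr _, (h j).2⟩⟩
  · obtain ⟨C, hC, h⟩ := key A A hA hA hA2 hA2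
    exact ⟨C, hC, fun j => ⟨(h j).1, encloses_of_card_le_one hB1 hr _⟩⟩
  · exact key A B hA hB hA2 hB2

/-- **Main theorem.** If `A ∪ B` is in general position, there is a convex partition of the
plane into `r` parts each of which encloses at least `r^{ln(2/3)}·|A|^{1/r} − 2r` lines of `A`
and at least `r^{ln(2/3)}·|B|^{1/r} − 2r` lines of `B`. -/
theorem main_theorem (A B : Finset (Set (ℝ × ℝ)))
    (hlines : ∀ ℓ ∈ A ∪ B, IsLine ℓ) (hgp : GenPos (A ∪ B)) (r : ℕ) (hr : 0 < r) :
    ∃ C : Fin r → Set (ℝ × ℝ), ConvexPartition C ∧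
      ∀ j : Fin r,
        (∃ A' ⊆ A, incSet A' ⊆ C j ∧
          (r : ℝ) ^ Real.log (2 / 3) * (A.card : ℝ) ^ ((1 : ℝ) / r) - 2 * r ≤ (A'.card : ℝ)) ∧
        (∃ B' ⊆ B, incSet B' ⊆ C j ∧
          (r : ℝ) ^ Real.log (2 / 3) * (B.card : ℝ) ^ ((1 : ℝ) / r) - 2 * r ≤ (B'.card : ℝ)) := by
  have hr' : (0 : ℝ) ≤ 2 * r := by positivity
  have hAB : LineFamily (A ∪ B) := ⟨hlines, hgp.1⟩
  obtain ⟨C, hC, h⟩ := exists_partition_encloses hr (hAB.subset Finset.subset_union_left)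
    (hAB.subset Finset.subset_union_right)
  exact ⟨C, hC, fun j => ⟨(h j).1.mono subset_rfl (by linarith),
    (h j).2.mono subset_rfl (by linarith)⟩⟩
end

section
/- Let n and r be positive integers. There exist sets A and B, each consisting of n lines in ℝ² and with A ∪ B in general position, such that for every convex partition (C₁, …, C_r) of ℝ² into r parts there exists some j ∈ {1, …, r} with either μ_A(C_j) ≤ ⌈n^{1/r}⌉ or μ_B(C_j) ≤ ⌈n^{1/r}⌉. -/
open scoped Classical

/-- The line `y = m * x + c` with parameters `p = (m, c)`. -/
def slopeLine (p : ℝ × ℝ) : Set (ℝ × ℝ) := {z | z.2 = p.1 * z.1 + p.2}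

/-- The intersection point of two lines of different slopes. -/
noncomputable def meet (p q : ℝ × ℝ) : ℝ × ℝ :=
  ((q.2 - p.2) / (p.1 - q.1), p.1 * ((q.2 - p.2) / (p.1 - q.1)) + p.2)

/-- Twice the signed area of the triangle `p q s`. -/
def area (p q s : ℝ × ℝ) : ℝ := (q.1 - p.1) * (s.2 - p.2) - (q.2 - p.2) * (s.1 - p.1)

lemma mem_slopeLine {p z : ℝ × ℝ} : z ∈ slopeLine p ↔ z.2 = p.1 * z.1 + p.2 := Iff.rfl

lemma isLine_slopeLine (p : ℝ × ℝ) : IsLine (slopeLine p) := by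
  refine ⟨-p.1, 1, p.2, by simp, ?_⟩
  ext z
  simp only [mem_slopeLine, Set.mem_ofPred_eq]
  constructor <;> intro h <;> linarith

lemma mem_slopeLine_inter_iff {p q z : ℝ × ℝ} (h : p.1 ≠ q.1) :
    z ∈ slopeLine p ∩ slopeLine q ↔ z = meet p q := by
  have h' : p.1 - q.1 ≠ 0 := sub_ne_zero.2 h
  simp only [Set.mem_inter_iff, mem_slopeLine, meet, Prod.ext_iff]
  constructor
  · rintro ⟨h₁, h₂⟩
    have : z.1 = (q.2 - p.2) / (p.1 - q.1) := by
      rw [eq_div_iff h']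
      linarith
    exact ⟨this, by rw [← this, h₁]⟩
  · rintro ⟨h₁, h₂⟩
    have h₃ : z.1 * (p.1 - q.1) = q.2 - p.2 := by rw [h₁, div_mul_cancel₀ _ h']
    rw [← h₁] at h₂
    exact ⟨h₂, by linarith⟩

lemma notParallel_slopeLine {p q : ℝ × ℝ} (h : p.1 ≠ q.1) :
    NotParallel (slopeLine p) (slopeLine q) :=
  ⟨meet p q, (mem_slopeLine_inter_iff h).2 rfl, fun _ hz => (mem_slopeLine_inter_iff h).1 hz⟩

lemma notParallel_symm {K L : Set (ℝ × ℝ)} (h : NotParallel K L) : NotParallel L K := by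
  rwa [NotParallel, Set.inter_comm]

lemma slopeLine_injective : Function.Injective slopeLine := by
  intro p q h
  have h₀ : ((0 : ℝ), p.2) ∈ slopeLine q := h ▸ (by simp [mem_slopeLine])
  have h₁ : ((1 : ℝ), p.1 + p.2) ∈ slopeLine q := h ▸ (by simp [mem_slopeLine])
  simp only [mem_slopeLine] at h₀ h₁
  ext <;> linarith

lemma area_eq_zero_of_collinear {p q s : ℝ × ℝ}
    (h : Collinear ℝ ({p, q, s} : Set (ℝ × ℝ))) : area p q s = 0 := by
  obtain ⟨v, hv⟩ := (collinear_iff_of_mem (p₀ := p) (by simp)).1 h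
  obtain ⟨a, rfl⟩ := hv q (by simp)
  obtain ⟨b, rfl⟩ := hv s (by simp)
  simp only [area, vadd_eq_add, Prod.fst_add, Prod.snd_add, Prod.smul_fst, Prod.smul_snd,
    smul_eq_mul]
  ring

lemma area_rotate (p q s : ℝ × ℝ) : area q s p = area p q s := by
  simp only [area]
  ring

lemma mem_slopeLine_of_area_eq_zero {l p q s : ℝ × ℝ} (h : area p q s = 0) (hpq : p ≠ q)
    (hp : p ∈ slopeLine l) (hq : q ∈ slopeLine l) : s ∈ slopeLine l := by
  rw [mem_slopeLine] at *
  have hne : q.1 - p.1 ≠ 0 := by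
    intro h0
    have h1 : p.1 = q.1 := by linarith
    exact hpq (Prod.ext h1 (by rw [hp, hq, h1]))
  have : (q.1 - p.1) * (s.2 - (l.1 * s.1 + l.2)) = 0 := by
    simp only [area] at h
    rw [hp, hq] at h
    linear_combination h
  rcases mul_eq_zero.1 this with h | h
  · exact absurd h hne
  · linarith

lemma incSet_finite_s3 {s : Finset (ℝ × ℝ)} (hs : Set.InjOn Prod.fst (s : Set (ℝ × ℝ))) :
    (incSet (s.image slopeLine)).Finite := by
  refine ((s ×ˢ s).image fun x => meet x.1 x.2).finite_toSet.subset ?_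
  rintro z ⟨l₁, h₁, l₂, h₂, hne, hz₁, hz₂⟩
  obtain ⟨p, hp, rfl⟩ := Finset.mem_image.1 h₁
  obtain ⟨q, hq, rfl⟩ := Finset.mem_image.1 h₂
  have hpq : p.1 ≠ q.1 := fun h => hne (congrArg _ (hs hp hq h))
  simp only [Finset.coe_image, Set.mem_image, Finset.mem_coe, Finset.mem_product]
  exact ⟨(p, q), ⟨hp, hq⟩, ((mem_slopeLine_inter_iff hpq).1 ⟨hz₁, hz₂⟩).symm⟩

/-- The points a new line has to avoid to keep the family of lines in general position. -/
def badPoints (L : Finset (Set (ℝ × ℝ))) : Set (ℝ × ℝ) :=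
  incSet L ∪ ⋃ p ∈ incSet L, ⋃ q ∈ incSet L, ⋃ l ∈ L,
    {z | p ≠ q ∧ ¬ (p ∈ l ∧ q ∈ l) ∧ area p q z = 0 ∧ z ∈ l}

lemma badPoints_finite {s : Finset (ℝ × ℝ)} (hs : Set.InjOn Prod.fst (s : Set (ℝ × ℝ))) :
    (badPoints (s.image slopeLine)).Finite := by
  have hfin := incSet_finite_s3 hs
  refine hfin.union (hfin.biUnion fun p _ => hfin.biUnion fun q _ =>
    (Finset.finite_toSet _).biUnion fun l hl => Set.Subsingleton.finite ?_)
  obtain ⟨l, -, rfl⟩ := Finset.mem_image.1 (Finset.mem_coe.1 hl)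
  rintro z ⟨hpq, hl, hz, hzl⟩ w ⟨-, -, hw, hwl⟩
  by_contra hzw
  have key : p ∈ slopeLine l ∧ q ∈ slopeLine l := by
    rw [mem_slopeLine] at hzl hwl
    have hne : z.1 - w.1 ≠ 0 := by
      intro h0
      have h1 : z.1 = w.1 := by linarith
      exact hzw (Prod.ext h1 (by rw [hzl, hwl, h1]))
    simp only [area] at hz hw
    rw [hzl] at hz
    rw [hwl] at hw
    have hd : (q.1 - p.1) * l.1 = q.2 - p.2 :=
      mul_right_cancel₀ hne (by linear_combination hz - hw)
    have hne' : q.1 - p.1 ≠ 0 := by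
      intro h0
      rw [h0, zero_mul] at hd
      exact hpq (Prod.ext (by linarith) (by linarith))
    have hp : p.2 = l.1 * p.1 + l.2 :=
      mul_left_cancel₀ hne' (by linear_combination -hz + z.1 * hd - p.1 * hd)
    refine ⟨hp, ?_⟩
    rw [mem_slopeLine]
    linarith
  exact hl key

lemma mem_incSet_insert {L : Finset (Set (ℝ × ℝ))} {K : Set (ℝ × ℝ)} {z : ℝ × ℝ}
    (hz : z ∈ incSet (insert K L)) : z ∈ incSet L ∨ z ∈ K ∧ ∃ l ∈ L, z ∈ l := by
  obtain ⟨l₁, h₁, l₂, h₂, hne, hz₁, hz₂⟩ := hz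
  rcases Finset.mem_insert.1 h₁ with rfl | h₁'
  · rcases Finset.mem_insert.1 h₂ with rfl | h₂'
    · exact absurd rfl hne
    · exact Or.inr ⟨hz₁, l₂, h₂', hz₂⟩
  · rcases Finset.mem_insert.1 h₂ with rfl | h₂'
    · exact Or.inr ⟨hz₂, l₁, h₁', hz₁⟩
    · exact Or.inl ⟨l₁, h₁', l₂, h₂', hne, hz₁, hz₂⟩

lemma genPos_insert {s : Finset (ℝ × ℝ)} (hs : GenPos (s.image slopeLine)) {m : ℝ × ℝ}
    (hm : ∀ q ∈ s, m.1 ≠ q.1) (hbad : ∀ z ∈ badPoints (s.image slopeLine), z ∉ slopeLine m) :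
    GenPos (insert (slopeLine m) (s.image slopeLine)) := by
  set L := s.image slopeLine with hL
  obtain ⟨hpar, hconc, hcol⟩ := hs
  have hinc : ∀ z ∈ incSet L, z ∉ slopeLine m := fun z hz => hbad z (Or.inl hz)
  have hnew : ∀ l ∈ L, NotParallel (slopeLine m) l := by
    intro l hl
    obtain ⟨q, hq, rfl⟩ := Finset.mem_image.1 hl
    exact notParallel_slopeLine (hm q hq)
  have hone : ∀ p q z, p ∈ incSet L → q ∈ incSet L → p ≠ q → area p q z = 0 →
      z ∈ slopeLine m → (∃ l ∈ L, z ∈ l) → ∃ l ∈ L, p ∈ l ∧ q ∈ l ∧ z ∈ l := by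
    rintro p q z hp hq hpq har hzm ⟨l, hl, hzl⟩
    by_contra hcon
    refine hbad z (Or.inr ?_) hzm
    simp only [Set.mem_iUnion]
    exact ⟨p, hp, q, hq, l, hl, hpq, fun h => hcon ⟨l, hl, h.1, h.2, hzl⟩, har, hzl⟩
  refine ⟨?_, ?_, ?_⟩
  · intro l₁ h₁ l₂ h₂ hne
    rcases Finset.mem_insert.1 h₁ with rfl | h₁ <;> rcases Finset.mem_insert.1 h₂ with rfl | h₂
    · exact absurd rfl hne
    · exact hnew _ h₂
    · exact notParallel_symm (hnew _ h₁)
    · exact hpar _ h₁ _ h₂ hne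
  · rintro l₁ h₁ l₂ h₂ l₃ h₃ h₁₂ h₁₃ h₂₃ ⟨p, hp₁, hp₂, hp₃⟩
    rcases Finset.mem_insert.1 h₁ with rfl | h₁
    · exact hinc p ⟨l₂, Finset.mem_of_mem_insert_of_ne h₂ h₁₂.symm, l₃,
        Finset.mem_of_mem_insert_of_ne h₃ h₁₃.symm, h₂₃, hp₂, hp₃⟩ hp₁
    rcases Finset.mem_insert.1 h₂ with rfl | h₂
    · exact hinc p ⟨l₁, h₁, l₃, Finset.mem_of_mem_insert_of_ne h₃ h₂₃.symm, h₁₃, hp₁, hp₃⟩ hp₂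
    rcases Finset.mem_insert.1 h₃ with rfl | h₃
    · exact hinc p ⟨l₁, h₁, l₂, h₂, h₁₂, hp₁, hp₂⟩ hp₃
    exact hconc _ h₁ _ h₂ _ h₃ h₁₂ h₁₃ h₂₃ ⟨p, hp₁, hp₂, hp₃⟩
  · intro p q t hp hq ht hpq hpt hqt hc
    have har := area_eq_zero_of_collinear hc
    have har₁ : area q t p = 0 := by rw [area_rotate, har]
    have har₂ : area t p q = 0 := by rw [area_rotate, har₁]
    have hmem : ∀ {l}, l ∈ L → l ∈ insert (slopeLine m) L := Finset.mem_insert_of_mem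
    have hself := Finset.mem_insert_self (slopeLine m) L
    rcases mem_incSet_insert hp with hp | ⟨hp, hp'⟩ <;>
      rcases mem_incSet_insert hq with hq | ⟨hq, hq'⟩ <;>
      rcases mem_incSet_insert ht with ht | ⟨ht, ht'⟩
    · obtain ⟨l, hl, h⟩ := hcol p q t hp hq ht hpq hpt hqt hc
      exact ⟨l, hmem hl, h⟩
    · obtain ⟨l, hl, h₁, h₂, h₃⟩ := hone p q t hp hq hpq har ht ht'
      exact ⟨l, hmem hl, h₁, h₂, h₃⟩
    · obtain ⟨l, hl, h₁, h₂, h₃⟩ := hone t p q ht hp hpt.symm har₂ hq hq'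
      exact ⟨l, hmem hl, h₂, h₃, h₁⟩
    · exact ⟨_, hself, mem_slopeLine_of_area_eq_zero har₁ hqt hq ht, hq, ht⟩
    · obtain ⟨l, hl, h₁, h₂, h₃⟩ := hone q t p hq ht hqt har₁ hp hp'
      exact ⟨l, hmem hl, h₃, h₁, h₂⟩
    · exact ⟨_, hself, hp, mem_slopeLine_of_area_eq_zero har₂ hpt.symm ht hp, ht⟩
    · exact ⟨_, hself, hp, hq, mem_slopeLine_of_area_eq_zero har hpq hp hq⟩
    · exact ⟨_, hself, hp, hq, ht⟩

lemma exists_mem_ball_genPos_insert {s : Finset (ℝ × ℝ)}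
    (hinj : Set.InjOn Prod.fst (s : Set (ℝ × ℝ))) (hs : GenPos (s.image slopeLine))
    (p : ℝ × ℝ) {δ : ℝ} (hδ : 0 < δ) :
    ∃ m ∈ Metric.ball p δ, (∀ q ∈ s, m.1 ≠ q.1) ∧
      GenPos (insert (slopeLine m) (s.image slopeLine)) := by
  obtain ⟨a, ha, ha'⟩ := ((s.image Prod.fst).finite_toSet.countable.dense_compl ℝ).exists_mem_open
    Metric.isOpen_ball ⟨p.1, Metric.mem_ball_self hδ⟩
  obtain ⟨b, hb, hb'⟩ := (((badPoints_finite hinj).image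
    fun z => z.2 - a * z.1).countable.dense_compl ℝ).exists_mem_open
    Metric.isOpen_ball ⟨p.2, Metric.mem_ball_self hδ⟩
  have hm : ∀ q ∈ s, (a, b).1 ≠ q.1 := fun q hq h =>
    ha (by simp only [Finset.mem_coe, Finset.mem_image]; exact ⟨q, hq, h.symm⟩)
  refine ⟨(a, b), ?_, hm, genPos_insert hs hm fun z hz hz' => hb ⟨z, hz, ?_⟩⟩
  · rw [Metric.mem_ball, Prod.dist_eq]
    exact max_lt ha' hb'
  · rw [mem_slopeLine] at hz'
    simp only at hz' ⊢
    linarith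

/-- Every finite family of lines can be perturbed into general position. -/
lemma exists_genPos_near {ι : Type*} (s : Finset ι) (p₀ : ι → ℝ × ℝ) {δ : ℝ} (hδ : 0 < δ) :
    ∃ p : ι → ℝ × ℝ, (∀ i ∈ s, p i ∈ Metric.ball (p₀ i) δ) ∧
      Set.InjOn (fun i => (p i).1) (s : Set ι) ∧ GenPos ((s.image p).image slopeLine) := by
  induction s using Finset.induction_on with
  | empty =>
    refine ⟨p₀, by simp, by simp, by simp [PairwiseNonParallel], by simp, ?_⟩
    rintro p q t ⟨l, hl, -⟩
    simp at hl
  | insert i s hi ih =>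
    obtain ⟨p, hp, hinj, hgen⟩ := ih
    have hinj' : Set.InjOn Prod.fst ((s.image p : Finset (ℝ × ℝ)) : Set (ℝ × ℝ)) := by
      rw [Finset.coe_image]
      rintro _ ⟨j, hj, rfl⟩ _ ⟨k, hk, rfl⟩ h
      rw [hinj hj hk h]
    obtain ⟨m, hm, hne, hgen'⟩ := exists_mem_ball_genPos_insert hinj' hgen (p₀ i) hδ
    have hup : ∀ j ∈ s, Function.update p i m j = p j := fun j hj =>
      Function.update_of_ne (by rintro rfl; exact hi hj) _ _
    have hne' : ∀ j ∈ s, m.1 ≠ (p j).1 := fun j hj => hne _ (Finset.mem_image_of_mem _ hj)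
    refine ⟨Function.update p i m, ?_, ?_, ?_⟩
    · intro j hj
      rcases Finset.mem_insert.1 hj with rfl | hj
      · simpa using hm
      · rw [hup j hj]
        exact hp j hj
    · rw [Finset.coe_insert, Set.injOn_insert (by simpa using hi)]
      refine ⟨fun j hj k hk h => hinj hj hk (by simpa [hup j hj, hup k hk] using h), ?_⟩
      rintro ⟨j, hj, h⟩
      simp only [hup j hj, Function.update_self] at h
      exact hne' j hj h.symm
    · rw [Finset.image_insert, Finset.image_insert, Function.update_self,
        Finset.image_congr (g := p) fun j hj => hup j hj]
      exact hgen'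

lemma abs_sum_tail_le {k r : ℕ} {e : ℝ} (he₀ : 0 ≤ e) (he₁ : e ≤ 1) (a : Fin r → ℝ) (d₀ : Fin r)
    (ha : ∀ d, |a d| ≤ r * k) (ha₀ : ∀ d ≤ d₀, a d = 0) :
    |∑ d, a d * e ^ (d : ℕ)| ≤ r * r * k * e * e ^ (d₀ : ℕ) := by
  calc |∑ d, a d * e ^ (d : ℕ)| ≤ ∑ d, |a d * e ^ (d : ℕ)| := Finset.abs_sum_le_sum_abs _ _
    _ ≤ ∑ _d : Fin r, (r * k * e ^ ((d₀ : ℕ) + 1) : ℝ) := by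
        refine Finset.sum_le_sum fun d _ => ?_
        rcases le_or_gt d d₀ with h | h
        · rw [ha₀ d h, zero_mul, abs_zero]
          positivity
        · rw [abs_mul, abs_of_nonneg (pow_nonneg he₀ _)]
          exact mul_le_mul (ha d) (pow_le_pow_of_le_one he₀ he₁ h) (pow_nonneg he₀ _)
            (by positivity)
    _ = r * r * k * e * e ^ (d₀ : ℕ) := by
        rw [Finset.sum_const, Finset.card_univ, Fintype.card_fin, nsmul_eq_mul]
        ring

/-- There are `k ^ r` lines, indexed by words of length `r` over `k` letters, such that the lines
of any two words meet near the abscissa given by a position at which the words differ. -/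
lemma exists_levels (k r : ℕ) :
    ∃ p : (Fin r → Fin k) → ℝ × ℝ, ∀ u v, u ≠ v → ∃ d : Fin r, u d ≠ v d ∧
      (p u).1 ≠ (p v).1 ∧ |(meet (p u) (p v)).1 - ((d : ℕ) : ℝ)| < 1 / 4 := by
  have hpos : (0 : ℝ) < 8 * (r * r * k + 1) := by positivity
  set e : ℝ := 1 / (8 * (r * r * k + 1)) with he
  have he₀ : 0 < e := by positivity
  have hemul : r * r * k * e ≤ 1 / 8 := by
    rw [he, mul_one_div, div_le_iff₀ hpos]
    linarith
  have he₁ : e ≤ 1 := by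
    rw [he, div_le_one hpos]
    have : (0 : ℝ) ≤ r * r * k := by positivity
    linarith
  refine ⟨fun u => (∑ d : Fin r, ((u d : ℕ) : ℝ) * e ^ (d : ℕ),
    -∑ d : Fin r, ((d : ℕ) : ℝ) * ((u d : ℕ) : ℝ) * e ^ (d : ℕ)), fun u v huv => ?_⟩
  obtain ⟨d₀, hd₀, hmin⟩ : ∃ d₀, u d₀ ≠ v d₀ ∧ ∀ d < d₀, u d = v d := by
    obtain ⟨d, hd⟩ := Function.ne_iff.1 huv
    obtain ⟨m, hm⟩ := (Set.toFinite {d | u d ≠ v d}).exists_minimal ⟨d, hd⟩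
    exact ⟨m, hm.1, fun d hd => by_contra fun h => hd.not_ge (hm.2 h hd.le)⟩
  have hr : (1 : ℝ) ≤ r := by exact_mod_cast d₀.pos
  set D : Fin r → ℝ := fun d => ((u d : ℕ) : ℝ) - ((v d : ℕ) : ℝ) with hD
  have hDk : ∀ d, |D d| ≤ k := by
    intro d
    have h₁ : ((u d : ℕ) : ℝ) < k := by exact_mod_cast (u d).2
    have h₂ : ((v d : ℕ) : ℝ) < k := by exact_mod_cast (v d).2
    have h₃ : (0 : ℝ) ≤ (u d : ℕ) := by positivity
    have h₄ : (0 : ℝ) ≤ (v d : ℕ) := by positivity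
    rw [abs_le]
    constructor <;> simp only [hD] <;> linarith
  have hDlt : ∀ d < d₀, D d = 0 := fun d hd => by simp [hD, hmin d hd]
  have hD₀ : 1 ≤ |D d₀| := by
    have h : ((u d₀ : ℕ) : ℤ) - ((v d₀ : ℕ) : ℤ) ≠ 0 := by
      have := Fin.val_ne_of_ne hd₀
      omega
    have h' : ((1 : ℤ) : ℝ) ≤ _ := Int.cast_le.2 (Int.one_le_abs h)
    simpa [hD] using h'
  set P := e ^ (d₀ : ℕ) with hP
  have hPpos : 0 < P := by positivity
  have hE : |∑ d : Fin r, ((((d : ℕ) : ℝ) - ((d₀ : ℕ) : ℝ)) * D d) * e ^ (d : ℕ)| ≤ P / 8 := by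
    refine (abs_sum_tail_le (k := k) he₀.le he₁ _ d₀ (fun d => ?_) fun d hd => ?_).trans ?_
    · rw [abs_mul]
      refine mul_le_mul ?_ (hDk d) (abs_nonneg _) (by positivity)
      have h₁ : ((d : ℕ) : ℝ) < r := by exact_mod_cast d.2
      have h₂ : ((d₀ : ℕ) : ℝ) < r := by exact_mod_cast d₀.2
      have h₃ : (0 : ℝ) ≤ (d : ℕ) := by positivity
      have h₄ : (0 : ℝ) ≤ (d₀ : ℕ) := by positivity
      rw [abs_le]
      constructor <;> linarith
    · rcases hd.lt_or_eq with h | rfl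
      · rw [hDlt d h, mul_zero]
      · rw [sub_self, zero_mul]
    · nlinarith
  have hF : |∑ d : Fin r, (if d = d₀ then 0 else D d) * e ^ (d : ℕ)| ≤ P / 8 := by
    refine (abs_sum_tail_le (k := k) he₀.le he₁ _ d₀ (fun d => ?_) fun d hd => ?_).trans ?_
    · have hk : (0 : ℝ) ≤ k := by positivity
      split_ifs
      · rw [abs_zero]
        positivity
      · nlinarith [hDk d]
    · split_ifs with h
      · rfl
      · exact hDlt d (lt_of_le_of_ne hd h)
    · nlinarith
  have hsplit : ∑ d : Fin r, D d * e ^ (d : ℕ) =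
      D d₀ * P + ∑ d : Fin r, (if d = d₀ then 0 else D d) * e ^ (d : ℕ) := by
    have h : D d₀ * P = ∑ d : Fin r, (if d = d₀ then D d else 0) * e ^ (d : ℕ) := by
      simp [ite_mul, hP]
    rw [h, ← Finset.sum_add_distrib]
    refine Finset.sum_congr rfl fun d _ => ?_
    split_ifs <;> ring
  have hsum : 7 / 8 * P ≤ |∑ d : Fin r, D d * e ^ (d : ℕ)| := by
    have h₁ : P ≤ |D d₀ * P| := by
      rw [abs_mul, abs_of_pos hPpos]
      nlinarith
    have h₂ := abs_sub_abs_le_abs_add (D d₀ * P)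
      (∑ d : Fin r, (if d = d₀ then 0 else D d) * e ^ (d : ℕ))
    rw [hsplit]
    linarith
  have hslope : ∑ d : Fin r, ((u d : ℕ) : ℝ) * e ^ (d : ℕ) -
      ∑ d : Fin r, ((v d : ℕ) : ℝ) * e ^ (d : ℕ) = ∑ d : Fin r, D d * e ^ (d : ℕ) := by
    rw [← Finset.sum_sub_distrib]
    exact Finset.sum_congr rfl fun d _ => by simp only [hD]; ring
  have hne : ∑ d : Fin r, D d * e ^ (d : ℕ) ≠ 0 := by
    intro h
    rw [h, abs_zero] at hsum
    linarith
  refine ⟨d₀, hd₀, fun h => hne (by rw [← hslope]; exact sub_eq_zero.2 h), ?_⟩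
  have hx : (-∑ d : Fin r, ((d : ℕ) : ℝ) * ((v d : ℕ) : ℝ) * e ^ (d : ℕ) -
      -∑ d : Fin r, ((d : ℕ) : ℝ) * ((u d : ℕ) : ℝ) * e ^ (d : ℕ)) / ∑ d : Fin r, D d * e ^ (d : ℕ)
        - ((d₀ : ℕ) : ℝ) = (∑ d : Fin r, ((((d : ℕ) : ℝ) - ((d₀ : ℕ) : ℝ)) * D d) * e ^ (d : ℕ)) /
          ∑ d : Fin r, D d * e ^ (d : ℕ) := by
    rw [div_sub' hne]
    congr 1
    rw [Finset.sum_mul, ← Finset.sum_neg_distrib, ← Finset.sum_neg_distrib,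
      ← Finset.sum_sub_distrib, ← Finset.sum_sub_distrib]
    exact Finset.sum_congr rfl fun d _ => by simp only [hD]; ring
  simp only [meet]
  rw [hslope, hx, abs_div, div_lt_iff₀ (abs_pos.2 hne)]
  linarith

lemma interior_nonempty_of_area_ne_zero {C : Set (ℝ × ℝ)} (hC : Convex ℝ C) {p q s : ℝ × ℝ}
    (hp : p ∈ C) (hq : q ∈ C) (hs : s ∈ C) (h : area p q s ≠ 0) : (interior C).Nonempty := by
  rw [hC.interior_nonempty_iff_affineSpan_eq_top, eq_top_iff]
  intro z _
  have hp' := subset_affineSpan ℝ C hp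
  have hz : z = ((area p z s / area p q s) • (q -ᵥ p) +
      (area p q z / area p q s) • (s -ᵥ p)) +ᵥ p := by
    ext <;> simp only [vadd_eq_add, vsub_eq_sub, Prod.fst_add, Prod.snd_add, Prod.smul_fst,
      Prod.smul_snd, Prod.fst_sub, Prod.snd_sub, smul_eq_mul] <;> field_simp <;>
      simp only [area] <;> ring
  rw [hz]
  exact AffineSubspace.vadd_mem_of_mem_direction (add_mem
    (Submodule.smul_mem _ _ (AffineSubspace.vsub_mem_direction (subset_affineSpan ℝ C hq) hp'))
    (Submodule.smul_mem _ _ (AffineSubspace.vsub_mem_direction (subset_affineSpan ℝ C hs) hp')))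
    hp'

lemma exists_separating_line {C D : Set (ℝ × ℝ)} (hC : Convex ℝ C) (hD : Convex ℝ D)
    (hC' : (interior C).Nonempty) (hD' : (interior D).Nonempty)
    (hCD : interior C ∩ interior D = ∅) :
    ∃ a b u : ℝ, (a ≠ 0 ∨ b ≠ 0) ∧ (∀ z ∈ C, a * z.1 + b * z.2 ≤ u) ∧
      ∀ z ∈ D, u ≤ a * z.1 + b * z.2 := by
  obtain ⟨f, u, hfC, hfD⟩ := geometric_hahn_banach_open_open hC.interior isOpen_interior
    hD.interior isOpen_interior (Set.disjoint_iff_inter_eq_empty.2 hCD)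
  have hf : ∀ z : ℝ × ℝ, f z = f (1, 0) * z.1 + f (0, 1) * z.2 := by
    intro z
    have : z = z.1 • ((1 : ℝ), (0 : ℝ)) + z.2 • ((0 : ℝ), (1 : ℝ)) := by ext <;> simp
    conv_lhs => rw [this]
    rw [map_add, map_smul, map_smul, smul_eq_mul, smul_eq_mul]
    ring
  refine ⟨f (1, 0), f (0, 1), u, ?_, fun z hz => ?_, fun z hz => ?_⟩
  · by_contra! h
    obtain ⟨z, hz⟩ := hC'
    obtain ⟨w, hw⟩ := hD'
    have h₁ := hfC z hz
    have h₂ := hfD w hw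
    rw [hf, h.1, h.2] at h₁ h₂
    linarith
  · rw [← hf]
    have hcl : z ∈ closure (interior C) :=
      hC.closure_interior_eq_closure_of_nonempty_interior hC' ▸ subset_closure hz
    exact closure_minimal (fun w hw => (hfC w hw).le)
      (isClosed_le f.continuous continuous_const) hcl
  · rw [← hf]
    have hcl : z ∈ closure (interior D) :=
      hD.closure_interior_eq_closure_of_nonempty_interior hD' ▸ subset_closure hz
    exact closure_minimal (fun w hw => (hfD w hw).le)
      (isClosed_le continuous_const f.continuous) hcl

/-- The axis-parallel square of side `2 * M` centred at `(0, T)`. -/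
def box (M T : ℝ) : Set (ℝ × ℝ) := {z | |z.1| < M ∧ |z.2 - T| < M}

lemma almost_ordered {M : ℝ} (hM : 1 ≤ M) {C D : Set (ℝ × ℝ)} (hC : Convex ℝ C) (hD : Convex ℝ D)
    (hC' : (interior C).Nonempty) (hD' : (interior D).Nonempty)
    (hCD : interior C ∩ interior D = ∅)
    (hCn : (C ∩ box M 0).Nonempty) (hDn : (D ∩ box M 0).Nonempty)
    (hCf : (C ∩ box M (2 * M + 16 * M ^ 2)).Nonempty)
    (hDf : (D ∩ box M (2 * M + 16 * M ^ 2)).Nonempty) :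
    (∀ z ∈ C ∩ box M 0, ∀ w ∈ D ∩ box M 0, z.1 ≤ w.1 + 1 / 2) ∨
      ∀ z ∈ C ∩ box M 0, ∀ w ∈ D ∩ box M 0, w.1 ≤ z.1 + 1 / 2 := by
  obtain ⟨a, b, u, hab, hsC, hsD⟩ := exists_separating_line hC hD hC' hD' hCD
  obtain ⟨p, hpC, hp₁, hp₂⟩ := hCn
  obtain ⟨q, hqD, hq₁, hq₂⟩ := hDn
  obtain ⟨p', hpC', hp₁', hp₂'⟩ := hCf
  obtain ⟨q', hqD', hq₁', hq₂'⟩ := hDf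
  rw [abs_lt] at hp₁ hp₂ hq₁ hq₂ hp₁' hp₂' hq₁' hq₂'
  have hbound : ∀ x : ℝ, |x| ≤ 2 * M → a * x ≤ |a| * (2 * M) := fun x hx =>
    (le_abs_self _).trans (by rw [abs_mul]; exact mul_le_mul_of_nonneg_left hx (abs_nonneg a))
  have hslope : |b| * (16 * M ^ 2) ≤ |a| * (2 * M) := by
    rcases le_total 0 b with hb | hb
    · rw [abs_of_nonneg hb]
      have h₁ := (hsC p' hpC').trans (hsD q hqD)
      have h₂ := hbound (q.1 - p'.1) (abs_le.2 ⟨by linarith, by linarith⟩)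
      nlinarith [mul_le_mul_of_nonneg_left (show 16 * M ^ 2 ≤ p'.2 - q.2 by linarith) hb]
    · rw [abs_of_nonpos hb]
      have h₁ := (hsC p hpC).trans (hsD q' hqD')
      have h₂ := hbound (q'.1 - p.1) (abs_le.2 ⟨by linarith, by linarith⟩)
      nlinarith [mul_le_mul_of_nonneg_left (show 16 * M ^ 2 ≤ q'.2 - p.2 by linarith)
        (neg_nonneg.2 hb)]
  have hslope' : |b| * (8 * M) ≤ |a| := by nlinarith
  have ha : 0 < |a| := by
    rcases hab with ha | hb
    · exact abs_pos.2 ha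
    · have := abs_pos.2 hb
      nlinarith
  have key : ∀ z ∈ C ∩ box M 0, ∀ w ∈ D ∩ box M 0, a * (z.1 - w.1) ≤ |a| * (1 / 2) := by
    rintro z ⟨hz, -, hz₂⟩ w ⟨hw, -, hw₂⟩
    rw [abs_lt] at hz₂ hw₂
    have h₁ := (hsC z hz).trans (hsD w hw)
    have h₂ : b * (w.2 - z.2) ≤ |b| * (2 * M) := by
      refine (le_abs_self _).trans ?_
      rw [abs_mul]
      exact mul_le_mul_of_nonneg_left (abs_le.2 ⟨by linarith, by linarith⟩) (abs_nonneg b)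
    nlinarith
  rcases abs_choice a with h | h
  · left
    intro z hz w hw
    have := key z hz w hw
    rw [h] at this ha
    nlinarith
  · right
    intro z hz w hw
    have := key z hz w hw
    rw [h] at this ha
    nlinarith

lemma exists_of_lt_mu {ι : Type*} [Fintype ι] {g : ι → ℝ × ℝ}
    (hg : Function.Injective fun i => (g i).1) {k : ℕ} {C : Set (ℝ × ℝ)}
    (h : k < mu (Finset.univ.image fun i => slopeLine (g i)) C) :
    ∃ S : Finset ι, k < S.card ∧ ∀ i ∈ S, ∀ j ∈ S, i ≠ j → meet (g i) (g j) ∈ C := by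
  obtain ⟨A', hA', hk⟩ := Finset.lt_sup_iff.1 h
  obtain ⟨hsub, hinc⟩ := Finset.mem_filter.1 hA'
  rw [Finset.mem_powerset] at hsub
  refine ⟨Finset.univ.filter fun i => slopeLine (g i) ∈ A', ?_, fun i hi j hj hij => hinc ?_⟩
  · refine hk.trans_le ((Finset.card_le_card fun l hl => ?_).trans
      (Finset.card_image_le (f := fun i => slopeLine (g i))))
    obtain ⟨i, -, rfl⟩ := Finset.mem_image.1 (hsub hl)
    exact Finset.mem_image_of_mem _ (by simpa using hl)
  · have hne : (g i).1 ≠ (g j).1 := fun h => hij (hg h)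
    have hmem := (mem_slopeLine_inter_iff hne).2 rfl
    exact ⟨_, (Finset.mem_filter.1 hi).2, _, (Finset.mem_filter.1 hj).2,
      fun h => hne (congrArg Prod.fst (slopeLine_injective h)), hmem.1, hmem.2⟩

lemma continuousAt_meet {p q : ℝ × ℝ} (h : p.1 ≠ q.1) :
    ContinuousAt (fun x : (ℝ × ℝ) × (ℝ × ℝ) => meet x.1 x.2) (p, q) := by
  have h' : p.1 - q.1 ≠ 0 := sub_ne_zero.2 h
  unfold meet
  fun_prop (disch := simpa using h')

lemma meet_shift (p q : ℝ × ℝ) (T : ℝ) :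
    meet (p + (0, T)) (q + (0, T)) = meet p q + (0, T) := by
  ext
  · simp [meet]
  · simp [meet]
    ring

lemma isOpen_box (M T : ℝ) : IsOpen (box M T) := by
  refine IsOpen.inter ?_ ?_
  · exact isOpen_lt (f := fun z : ℝ × ℝ => |z.1|) (by fun_prop) continuous_const
  · exact isOpen_lt (f := fun z : ℝ × ℝ => |z.2 - T|) (by fun_prop) continuous_const

/-- Pairwise interior-disjoint convex sets that reach both boxes cannot all meet the near box at
two different levels if there are as many sets as levels. -/
lemma false_of_two_levels {r : ℕ} (hr : 0 < r) {M : ℝ} (hM : 1 ≤ M) {C : Fin r → Set (ℝ × ℝ)}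
    (hconv : ∀ j, Convex ℝ (C j))
    (hdisj : Pairwise fun i j => interior (C i) ∩ interior (C j) = ∅)
    (hfar : ∀ j, (C j ∩ box M (2 * M + 16 * M ^ 2)).Nonempty)
    (hnear : ∀ j, ∃ z ∈ C j ∩ box M 0, ∃ w ∈ C j ∩ box M 0, ∃ d e : Fin r, d < e ∧
      |z.1 - ((d : ℕ) : ℝ)| < 1 / 4 ∧ |w.1 - ((e : ℕ) : ℝ)| < 1 / 4) : False := by
  choose z hz w hw lo hi hlt hlo hhi using hnear
  have hgap : ∀ j, 1 / 2 ≤ (w j).1 - (z j).1 := by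
    intro j
    have h₁ := abs_lt.1 (hlo j)
    have h₂ := abs_lt.1 (hhi j)
    have h₃ : ((lo j : ℕ) : ℝ) + 1 ≤ ((hi j : ℕ) : ℝ) := by exact_mod_cast hlt j
    linarith
  have hint : ∀ j, (interior (C j)).Nonempty := by
    intro j
    obtain ⟨q, hq, hq₁, hq₂⟩ := hfar j
    refine interior_nonempty_of_area_ne_zero (hconv j) (hz j).1 (hw j).1 hq ?_
    obtain ⟨hz₁, hz₂⟩ := (hz j).2
    obtain ⟨hw₁, hw₂⟩ := (hw j).2
    rw [abs_lt] at hq₁ hq₂ hz₁ hz₂ hw₁ hw₂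
    have h₁ : 1 / 2 * (16 * M ^ 2) < ((w j).1 - (z j).1) * (q.2 - (z j).2) :=
      mul_lt_mul' (hgap j) (by linarith) (by positivity) (by linarith [hgap j])
    have h₂ : ((w j).2 - (z j).2) * (q.1 - (z j).1) ≤ (2 * M) * (2 * M) := by
      refine (le_abs_self _).trans ?_
      rw [abs_mul]
      exact mul_le_mul (abs_le.2 ⟨by linarith, by linarith⟩) (abs_le.2 ⟨by linarith, by linarith⟩)
        (abs_nonneg _) (by linarith)
    have h₃ : 0 < M ^ 2 := by positivity
    simp only [area]
    nlinarith
  have hord : ∀ i j, i ≠ j → hi i ≤ lo j ∨ hi j ≤ lo i := by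
    intro i j hij
    have hle : ∀ a b : Fin r, (w a).1 ≤ (z b).1 + 1 / 2 → hi a ≤ lo b := by
      intro a b h
      have h₁ := abs_lt.1 (hhi a)
      have h₂ := abs_lt.1 (hlo b)
      have h₃ : ((hi a : ℕ) : ℝ) < ((lo b : ℕ) : ℝ) + 1 := by linarith
      have h₄ : (hi a : ℕ) < lo b + 1 := by exact_mod_cast h₃
      exact Fin.le_def.2 (by omega)
    exact (almost_ordered hM (hconv i) (hconv j) (hint i) (hint j) (hdisj hij) ⟨_, hz i⟩ ⟨_, hz j⟩
      (hfar i) (hfar j)).imp (fun h => hle _ _ (h _ (hw i) _ (hz j)))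
      fun h => hle _ _ (h _ (hz i) _ (hw j))
  have hinj : Function.Injective hi := by
    intro i j h
    by_contra hij
    rcases hord i j hij with h' | h'
    · exact absurd (hlt j) (h ▸ h').not_gt
    · exact absurd (hlt i) (h ▸ h').not_gt
  obtain ⟨j, hj⟩ := (Finite.injective_iff_surjective.1 hinj) ⟨0, hr⟩
  have := Fin.lt_def.1 (hj ▸ hlt j)
  simp at this

/-- **Upper bound.** For all positive `n`, `r` there are sets `A`, `B` of `n` lines each,
with `A ∪ B` in general position, such that every convex partition of the plane into `r`
parts has a part `C_j` with `μ_A(C_j) ≤ ⌈n^{1/r}⌉` or `μ_B(C_j) ≤ ⌈n^{1/r}⌉`. -/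
theorem upper_bound (n r : ℕ) (hn : 0 < n) (hr : 0 < r) :
    ∃ A B : Finset (Set (ℝ × ℝ)),
      (∀ ℓ ∈ A ∪ B, IsLine ℓ) ∧ A.card = n ∧ B.card = n ∧ GenPos (A ∪ B) ∧
      ∀ C : Fin r → Set (ℝ × ℝ), ConvexPartition C →
        ∃ j : Fin r,
          mu A (C j) ≤ ⌈(n : ℝ) ^ ((1 : ℝ) / r)⌉₊ ∨
          mu B (C j) ≤ ⌈(n : ℝ) ^ ((1 : ℝ) / r)⌉₊ := by
  set k : ℕ := ⌈(n : ℝ) ^ ((1 : ℝ) / r)⌉₊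
  have hk₁ : 1 ≤ k := Nat.one_le_ceil_iff.2 (Real.rpow_pos_of_pos (by exact_mod_cast hn) _)
  have hnk : n ≤ k ^ r := by
    have h : (n : ℝ) ≤ (k : ℝ) ^ r := by
      calc (n : ℝ) = ((n : ℝ) ^ ((1 : ℝ) / r)) ^ r := by
            rw [one_div, Real.rpow_inv_natCast_pow (Nat.cast_nonneg n) hr.ne']
        _ ≤ (k : ℝ) ^ r := pow_le_pow_left₀ (by positivity) (Nat.le_ceil _) r
    exact_mod_cast h
  obtain ⟨f⟩ : Nonempty (Fin n ↪ (Fin r → Fin k)) :=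
    Function.Embedding.nonempty_of_card_le (by simpa using hnk)
  obtain ⟨q, hq⟩ := exists_levels k r
  have hq' : ∀ i j : Fin n, i ≠ j → ∃ d : Fin r, f i d ≠ f j d ∧ (q (f i)).1 ≠ (q (f j)).1 ∧
      |(meet (q (f i)) (q (f j))).1 - ((d : ℕ) : ℝ)| < 1 / 4 :=
    fun i j hij => hq _ _ (f.injective.ne hij)
  obtain ⟨M, hM, hbox⟩ : ∃ M : ℝ, 1 ≤ M ∧ ∀ i j, meet (q (f i)) (q (f j)) ∈ box M 0 := by
    obtain ⟨M, hM⟩ := (Set.finite_range fun x : Fin n × Fin n =>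
      ‖meet (q (f x.1)) (q (f x.2))‖).bddAbove
    refine ⟨max 1 (M + 1), le_max_left _ _, fun i j => ?_⟩
    have h : ‖meet (q (f i)) (q (f j))‖ < max 1 (M + 1) :=
      lt_max_of_lt_right (lt_of_le_of_lt (hM ⟨(i, j), rfl⟩) (lt_add_one M))
    rw [Prod.norm_def, max_lt_iff] at h
    simpa [box] using h
  set T : ℝ := 2 * M + 16 * M ^ 2
  let p₀ : Fin n ⊕ Fin n → ℝ × ℝ := Sum.elim (fun i => q (f i)) fun i => q (f i) + (0, T)
  have hcont : ∀ a b, (p₀ a).1 ≠ (p₀ b).1 →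
      ContinuousAt (fun p : Fin n ⊕ Fin n → ℝ × ℝ => meet (p a) (p b)) p₀ := fun a b h =>
    (continuousAt_meet h).comp (f := fun p : Fin n ⊕ Fin n → ℝ × ℝ => (p a, p b))
      (by fun_prop)
  have hev : ∀ᶠ p in nhds p₀, ∀ i j, i ≠ j →
      (∃ d : Fin r, f i d ≠ f j d ∧
        |(meet (p (.inl i)) (p (.inl j))).1 - ((d : ℕ) : ℝ)| < 1 / 4) ∧
      meet (p (.inl i)) (p (.inl j)) ∈ box M 0 ∧ meet (p (.inr i)) (p (.inr j)) ∈ box M T := by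
    refine Filter.eventually_all.2 fun i => Filter.eventually_all.2 fun j =>
      Filter.eventually_imp_distrib_left.2 fun hij => ?_
    obtain ⟨d, hd, hne, hlt⟩ := hq' i j hij
    have hA := hcont (.inl i) (.inl j) hne
    have hB := hcont (.inr i) (.inr j) (by simpa [p₀] using hne)
    have h₁ := hA.eventually_mem ((isOpen_lt (f := fun z : ℝ × ℝ => |z.1 - ((d : ℕ) : ℝ)|)
      (by fun_prop) continuous_const).mem_nhds hlt)
    have h₂ := hA.eventually_mem ((isOpen_box M 0).mem_nhds (hbox i j))
    have h₃ := hB.eventually_mem ((isOpen_box M T).mem_nhds (by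
      have := hbox i j
      simpa [p₀, meet_shift, box] using this))
    filter_upwards [h₁, h₂, h₃] with p h₁ h₂ h₃
    exact ⟨⟨d, hd, h₁⟩, h₂, h₃⟩
  obtain ⟨δ, hδ, hball⟩ := Metric.eventually_nhds_iff.1 hev
  obtain ⟨p, hp, hinj, hgen⟩ := exists_genPos_near Finset.univ p₀ hδ
  have hpos := hball ((dist_pi_lt_iff hδ).2 fun i => hp i (Finset.mem_univ i))
  have hinj' : Function.Injective fun i => (p i).1 := by simpa using hinj
  have hline : Function.Injective fun i => slopeLine (p i) := fun i j h =>
    hinj' (congrArg Prod.fst (slopeLine_injective h))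
  refine ⟨Finset.univ.image fun i => slopeLine (p (.inl i)),
    Finset.univ.image fun i => slopeLine (p (.inr i)), ?_, ?_, ?_, ?_, ?_⟩
  · intro l hl
    rcases Finset.mem_union.1 hl with hl | hl <;>
      obtain ⟨i, -, rfl⟩ := Finset.mem_image.1 hl <;> exact isLine_slopeLine _
  · exact (Finset.card_image_of_injective _ (hline.comp Sum.inl_injective)).trans
      (Finset.card_fin n)
  · exact (Finset.card_image_of_injective _ (hline.comp Sum.inr_injective)).trans
      (Finset.card_fin n)
  · rw [Finset.image_image] at hgen
    convert hgen using 1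
    ext l
    simp
  · intro C hC
    by_contra! hcon
    refine false_of_two_levels hr hM hC.2.1 hC.2.2.2 (fun j => ?_) fun j => ?_
    · obtain ⟨S, hS, hSC⟩ := exists_of_lt_mu (hinj'.comp Sum.inr_injective) (hcon j).2
      obtain ⟨a, ha, b, hb, hab⟩ := Finset.one_lt_card.1 (hk₁.trans_lt hS)
      exact ⟨_, hSC a ha b hb hab, (hpos a b hab).2.2⟩
    · obtain ⟨S, hS, hSC⟩ := exists_of_lt_mu (hinj'.comp Sum.inl_injective) (hcon j).1
      obtain ⟨a, ha, b, hb, hab⟩ := Finset.one_lt_card.1 (hk₁.trans_lt hS)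
      obtain ⟨⟨d, hd, hd'⟩, hab', -⟩ := hpos a b hab
      obtain ⟨a', ha', b', hb', hne, heq⟩ := Finset.exists_ne_map_eq_of_card_lt_of_maps_to
        (t := Finset.univ) (f := fun i => f i d) (by simpa using hS) (by simp)
      obtain ⟨⟨e, he, he'⟩, hab'', -⟩ := hpos a' b' hne
      have hde : d ≠ e := by
        rintro rfl
        exact he heq
      have hz := And.intro (hSC a ha b hb hab) hab'
      have hw := And.intro (hSC a' ha' b' hb' hne) hab''
      rcases hde.lt_or_gt with h | h
      · exact ⟨_, hz, _, hw, d, e, h, hd', he'⟩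
      · exact ⟨_, hw, _, hz, e, d, h, he', hd'⟩
end

section
/- Let k be a nonnegative integer, let r = 2^k, and let A and B be two finite nonempty sets of lines in ℝ² such that no two lines of A ∪ B are parallel. Then there exists a convex partition (C₁, …, C_r) of ℝ² into r parts such that every C_j encloses a subset of A of cardinality at least |A|^{1/r} and encloses a subset of B of cardinality at least |B|^{1/r}. -/
open scoped Classical

/-- If every weakly decreasing subset of `S` has at most `b` elements, then some weakly increasing
subset `C` satisfies `#S ≤ #C * b`. -/
theorem exists_increasing_card_le_mul {ι : Type*} (s q : ι → ℝ) (b : ℕ) (S : Finset ι)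
    (hs : Set.InjOn s S)
    (hb : ∀ D ⊆ S, (∀ i ∈ D, ∀ j ∈ D, s i < s j → q j ≤ q i) → D.card ≤ b) :
    ∃ C ⊆ S, (∀ i ∈ C, ∀ j ∈ C, s i < s j → q i ≤ q j) ∧ S.card ≤ C.card * b := by
  induction S using Finset.strongInduction with
  | H S ih =>
    rcases S.eq_empty_or_nonempty with rfl | hS
    · exact ⟨∅, by simp, by simp, by simp⟩
    set M := S.filter fun i => ∀ j ∈ S, s j < s i → ¬ q j ≤ q i
    have hMS : M ⊆ S := Finset.filter_subset _ _
    have hMb : M.card ≤ b := by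
      refine hb M hMS fun i hi j hj hij => ?_
      exact (not_le.1 ((Finset.mem_filter.1 hj).2 i (hMS hi) hij)).le
    have hMne : M.Nonempty := by
      obtain ⟨m, hm, hmin⟩ := S.exists_min_image s hS
      exact ⟨m, Finset.mem_filter.2 ⟨hm, fun j hj hlt => absurd (hmin j hj) (not_le.2 hlt)⟩⟩
    obtain ⟨C, hCS, hC, hcard⟩ := ih (S \ M) (Finset.sdiff_ssubset hMS hMne)
      (hs.mono (by simp)) fun D hD => hb D (hD.trans Finset.sdiff_subset)
    have hsum : (S \ M).card + M.card = S.card := Finset.card_sdiff_add_card_eq_card hMS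
    rcases C.eq_empty_or_nonempty with rfl | hCne
    · obtain ⟨m, hm⟩ := hMne
      refine ⟨{m}, by simpa using hMS hm, by simp, ?_⟩
      simp only [Finset.card_empty, Finset.card_singleton] at *
      omega
    obtain ⟨c, hc, hcmin⟩ := C.exists_min_image s hCne
    obtain ⟨hcS, hcM⟩ := Finset.mem_sdiff.1 (hCS hc)
    have hbelow : (S.filter fun j => s j < s c ∧ q j ≤ q c).Nonempty := by
      by_contra hne
      refine hcM (Finset.mem_filter.2 ⟨hcS, fun j hj hlt hle => hne ⟨j, ?_⟩⟩)
      exact Finset.mem_filter.2 ⟨hj, hlt, hle⟩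
    obtain ⟨m, hm, hmmin⟩ := Finset.exists_min_image _ s hbelow
    obtain ⟨hmS, hmc, hmq⟩ := Finset.mem_filter.1 hm
    have hmM : m ∈ M := Finset.mem_filter.2 ⟨hmS, fun j hj hlt hle =>
      absurd (hmmin j (Finset.mem_filter.2 ⟨hj, hlt.trans hmc, hle.trans hmq⟩)) (not_le.2 hlt)⟩
    have hmC : m ∉ C := fun h => (Finset.mem_sdiff.1 (hCS h)).2 hmM
    have hq : ∀ j ∈ C, q c ≤ q j := by
      intro j hj
      rcases (hcmin j hj).lt_or_eq with h | h
      · exact hC c hc j hj h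
      · exact (congrArg q (hs hcS (Finset.mem_sdiff.1 (hCS hj)).1 h)).le
    refine ⟨insert m C, ?_, ?_, ?_⟩
    · exact Finset.insert_subset hmS (hCS.trans Finset.sdiff_subset)
    · intro i hi j hj hij
      rcases Finset.mem_insert.1 hi with rfl | hiC <;>
        rcases Finset.mem_insert.1 hj with rfl | hjC
      · exact le_rfl
      · exact hmq.trans (hq j hjC)
      · exact absurd (hcmin i hiC) (not_le.2 (hij.trans hmc))
      · exact hC i hiC j hjC hij
    · rw [Finset.card_insert_of_notMem hmC]
      nlinarith

/-- The Erdős–Szekeres theorem in product form. -/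
theorem exists_increasing_decreasing_card_le_mul {ι : Type*} (s q : ι → ℝ) (S : Finset ι)
    (hs : Set.InjOn s S) :
    ∃ C ⊆ S, ∃ D ⊆ S, (∀ i ∈ C, ∀ j ∈ C, s i < s j → q i ≤ q j) ∧
      (∀ i ∈ D, ∀ j ∈ D, s i < s j → q j ≤ q i) ∧ S.card ≤ C.card * D.card := by
  obtain ⟨D, hD, hmax⟩ := Finset.exists_max_image
    (S.powerset.filter fun D => ∀ i ∈ D, ∀ j ∈ D, s i < s j → q j ≤ q i) Finset.card
    ⟨∅, by simp⟩
  simp only [Finset.mem_filter, Finset.mem_powerset] at hD hmax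
  obtain ⟨C, hCS, hC, hcard⟩ := exists_increasing_card_le_mul s q D.card S hs
    fun E hE hdec => hmax E ⟨hE, hdec⟩
  exact ⟨C, hCS, D, hD.1, hC, hD.2, hcard⟩

/-- The signed distance of `p` from the origin in the direction of angle `θ`. -/
noncomputable def height (θ : ℝ) (p : ℝ × ℝ) : ℝ := p.1 * Real.cos θ + p.2 * Real.sin θ

theorem height_add_pi (θ : ℝ) (p : ℝ × ℝ) : height (θ + Real.pi) p = -height θ p := by
  simp only [height, Real.cos_add_pi, Real.sin_add_pi]; ring

theorem continuous_height_left (p : ℝ × ℝ) : Continuous fun θ => height θ p := by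
  unfold height; fun_prop

theorem continuous_height (θ : ℝ) : Continuous (height θ) := by
  unfold height; fun_prop

theorem height_add_smul (θ t : ℝ) (p : ℝ × ℝ) :
    height θ (p + t • (Real.cos θ, Real.sin θ)) = height θ p + t := by
  simp only [height, Prod.fst_add, Prod.snd_add, Prod.smul_fst, Prod.smul_snd, smul_eq_mul]
  linear_combination t * Real.sin_sq_add_cos_sq θ

theorem isLinearMap_height (θ : ℝ) : IsLinearMap ℝ (height θ) where
  map_add p q := by simp only [height, Prod.fst_add, Prod.snd_add]; ring
  map_smul c p := by simp only [height, Prod.smul_fst, Prod.smul_snd, smul_eq_mul]; ring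

/-- In the frame rotated by `θ`, a line is either a level set of the height or the graph of an
affine function of the height. -/
theorem IsLine.eq_level_or_graph {ℓ : Set (ℝ × ℝ)} (h : IsLine ℓ) (θ t : ℝ) :
    (∃ c, ∀ p, p ∈ ℓ ↔ height θ p = c) ∨
      ∃ s q, ∀ p, p ∈ ℓ ↔ height (θ + Real.pi / 2) p = s * (height θ p - t) + q := by
  obtain ⟨a, b, c, hab, rfl⟩ := h
  set α := a * Real.cos θ + b * Real.sin θ with hα
  set β := b * Real.cos θ - a * Real.sin θ with hβ
  have h1 := Real.sin_sq_add_cos_sq θ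
  have key : ∀ p : ℝ × ℝ, a * p.1 + b * p.2 =
      α * height θ p + β * height (θ + Real.pi / 2) p := by
    intro p
    simp only [height, Real.cos_add_pi_div_two, Real.sin_add_pi_div_two, hα, hβ]
    linear_combination (-(a * p.1 + b * p.2)) * h1
  by_cases hβ0 : β = 0
  · have hα0 : α ≠ 0 := by
      intro hα0
      apply hab
      have ha : a = 0 := by
        linear_combination (-a) * h1 + Real.cos θ * (hα0) - Real.sin θ * hβ0
      have hb : b = 0 := by
        linear_combination (-b) * h1 + Real.sin θ * (hα0) + Real.cos θ * hβ0
      rw [ha, hb]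
    refine Or.inl ⟨c / α, fun p => ?_⟩
    rw [Set.mem_ofPred_eq, key, hβ0, eq_div_iff hα0]
    constructor <;> intro h <;> linarith
  · refine Or.inr ⟨-α / β, (c - α * t) / β, fun p => ?_⟩
    rw [Set.mem_ofPred_eq, key]
    have : -α / β * (height θ p - t) + (c - α * t) / β = (c - α * height θ p) / β := by
      field_simp; ring
    rw [this, eq_div_iff hβ0]
    constructor <;> intro h <;> linarith

theorem PairwiseNonParallel.mono {A B : Finset (Set (ℝ × ℝ))} (hB : PairwiseNonParallel B)
    (h : A ⊆ B) : PairwiseNonParallel A :=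
  fun ℓ₁ h₁ ℓ₂ h₂ => hB ℓ₁ (h h₁) ℓ₂ (h h₂)

theorem incSet_insert_subset {A : Finset (Set (ℝ × ℝ))} {ℓ K : Set (ℝ × ℝ)}
    (hA : incSet A ⊆ K) (hℓ : ℓ ⊆ K) : incSet (insert ℓ A) ⊆ K := by
  rintro p ⟨ℓ₁, h₁, ℓ₂, h₂, hne, hp₁, hp₂⟩
  rcases Finset.mem_insert.1 h₁ with rfl | h₁
  · exact hℓ hp₁
  rcases Finset.mem_insert.1 h₂ with rfl | h₂
  · exact hℓ hp₂
  exact hA ⟨ℓ₁, h₁, ℓ₂, h₂, hne, hp₁, hp₂⟩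

/-- If no line of `A` is parallel to a given splitting line, then the two closed sides of the
splitting line enclose subsets of `A` the product of whose sizes is at least `#A`. -/
theorem exists_enclosed_card_le_mul_of_graph (θ t : ℝ) (A : Finset (Set (ℝ × ℝ)))
    (hpar : PairwiseNonParallel A)
    (hgraph : ∀ ℓ ∈ A, ∃ s q, ∀ p, p ∈ ℓ ↔
      height (θ + Real.pi / 2) p = s * (height θ p - t) + q) :
    ∃ C ⊆ A, ∃ D ⊆ A, incSet C ⊆ {p | height θ p ≤ t} ∧ incSet D ⊆ {p | t ≤ height θ p} ∧
      A.card ≤ C.card * D.card := by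
  choose! s q hsq using hgraph
  have hs : Set.InjOn s A := by
    intro ℓ₁ h₁ ℓ₂ h₂ hss
    by_contra hne
    obtain ⟨p, ⟨hp₁, hp₂⟩, -⟩ := hpar ℓ₁ h₁ ℓ₂ h₂ hne
    have e₁ := (hsq ℓ₁ h₁ p).1 hp₁
    have e₂ := (hsq ℓ₂ h₂ p).1 hp₂
    rw [hss] at e₁
    have hqq : q ℓ₁ = q ℓ₂ := by linarith
    exact hne (Set.ext fun x => by rw [hsq ℓ₁ h₁, hsq ℓ₂ h₂, hss, hqq])
  obtain ⟨C, hC, D, hD, hinc, hdec, hcard⟩ :=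
    exists_increasing_decreasing_card_le_mul s q A hs
  refine ⟨C, hC, D, hD, ?_, ?_, hcard⟩
  · rintro p ⟨ℓ₁, h₁, ℓ₂, h₂, hne, hp₁, hp₂⟩
    have e₁ := (hsq ℓ₁ (hC h₁) p).1 hp₁
    have e₂ := (hsq ℓ₂ (hC h₂) p).1 hp₂
    rw [Set.mem_ofPred_eq]
    rcases lt_or_gt_of_ne fun h => hne (hs (hC h₁) (hC h₂) h) with h | h
    · have := hinc ℓ₁ h₁ ℓ₂ h₂ h
      nlinarith
    · have := hinc ℓ₂ h₂ ℓ₁ h₁ h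
      nlinarith
  · rintro p ⟨ℓ₁, h₁, ℓ₂, h₂, hne, hp₁, hp₂⟩
    have e₁ := (hsq ℓ₁ (hD h₁) p).1 hp₁
    have e₂ := (hsq ℓ₂ (hD h₂) p).1 hp₂
    rw [Set.mem_ofPred_eq]
    rcases lt_or_gt_of_ne fun h => hne (hs (hD h₁) (hD h₂) h) with h | h
    · have := hdec ℓ₁ h₁ ℓ₂ h₂ h
      nlinarith
    · have := hdec ℓ₂ h₂ ℓ₁ h₁ h
      nlinarith

/-- The two closed sides of any line enclose subsets of `A` the product of whose sizes is at
least `#A`. -/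
theorem exists_enclosed_card_le_mul (θ t : ℝ) (A : Finset (Set (ℝ × ℝ)))
    (hlines : ∀ ℓ ∈ A, IsLine ℓ) (hpar : PairwiseNonParallel A) :
    ∃ C ⊆ A, ∃ D ⊆ A, incSet C ⊆ {p | height θ p ≤ t} ∧ incSet D ⊆ {p | t ≤ height θ p} ∧
      A.card ≤ C.card * D.card := by
  by_cases hlevel : ∃ ℓ ∈ A, ∃ c, ∀ p, p ∈ ℓ ↔ height θ p = c
  · obtain ⟨ℓ, hℓ, c, hc⟩ := hlevel
    obtain ⟨C, hC, D, hD, hCt, hDt, hcard⟩ := exists_enclosed_card_le_mul_of_graph θ t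
      (A.erase ℓ) (hpar.mono (Finset.erase_subset _ _)) fun ℓ' hℓ' => by
        obtain ⟨hne, hℓ'⟩ := Finset.mem_erase.1 hℓ'
        refine ((hlines ℓ' hℓ').eq_level_or_graph θ t).resolve_left ?_
        rintro ⟨c', hc'⟩
        obtain ⟨p, ⟨hp₁, hp₂⟩, -⟩ := hpar ℓ' hℓ' ℓ hℓ hne
        have hcc : c' = c := ((hc' p).1 hp₁).symm.trans ((hc p).1 hp₂)
        exact hne (Set.ext fun x => by rw [hc', hc, hcc])
    have hcardA : (A.erase ℓ).card + 1 = A.card := Finset.card_erase_add_one hℓ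
    rcases (A.erase ℓ).eq_empty_or_nonempty with hemp | hne
    · have hsingle : ∀ K, incSet {ℓ} ⊆ K := by
        rintro K p ⟨ℓ₁, h₁, ℓ₂, h₂, hne, -⟩
        exact absurd ((Finset.mem_singleton.1 h₁).trans (Finset.mem_singleton.1 h₂).symm) hne
      refine ⟨{ℓ}, by simpa, {ℓ}, by simpa, hsingle _, hsingle _, ?_⟩
      rw [← hcardA, hemp]; simp
    have hpos : 0 < C.card * D.card := hne.card_pos.trans_le hcard
    have hCpos : 0 < C.card := Nat.pos_of_mul_pos_right hpos
    have hDpos : 0 < D.card := Nat.pos_of_mul_pos_left hpos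
    have hCA : C ⊆ A := hC.trans (Finset.erase_subset _ _)
    have hDA : D ⊆ A := hD.trans (Finset.erase_subset _ _)
    rcases le_total c t with hct | hct
    · refine ⟨insert ℓ C, Finset.insert_subset hℓ hCA, D, hDA,
        incSet_insert_subset hCt fun p hp => ((hc p).1 hp).le.trans hct, hDt, ?_⟩
      rw [Finset.card_insert_of_notMem fun h => Finset.notMem_erase ℓ A (hC h)]
      nlinarith
    · refine ⟨C, hCA, insert ℓ D, Finset.insert_subset hℓ hDA, hCt,
        incSet_insert_subset hDt fun p hp => hct.trans ((hc p).1 hp).ge, ?_⟩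
      rw [Finset.card_insert_of_notMem fun h => Finset.notMem_erase ℓ A (hD h)]
      nlinarith
  · refine exists_enclosed_card_le_mul_of_graph θ t A hpar fun ℓ hℓ => ?_
    exact ((hlines ℓ hℓ).eq_level_or_graph θ t).resolve_left fun h => hlevel ⟨ℓ, hℓ, h⟩

/-- The least `t` such that `{height θ ≤ t}` encloses a subset of `A` of size at least `√#A`
depends continuously on `θ`. -/
theorem exists_continuous_threshold (A : Finset (Set (ℝ × ℝ))) (hpar : PairwiseNonParallel A)
    (hA : 2 ≤ A.card) :
    ∃ F : ℝ → ℝ, Continuous F ∧ ∀ θ t, F θ ≤ t ↔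
      ∃ C ⊆ A, A.card ≤ C.card ^ 2 ∧ incSet C ⊆ {p | height θ p ≤ t} := by
  have hpt : ∀ x : Set (ℝ × ℝ) × Set (ℝ × ℝ), ∃ p, x ∈ A.offDiag → x.1 ∩ x.2 = {p} := by
    intro x
    by_cases hx : x ∈ A.offDiag
    · obtain ⟨h₁, h₂, hne⟩ := Finset.mem_offDiag.1 hx
      obtain ⟨p, hp, huniq⟩ := hpar _ h₁ _ h₂ hne
      exact ⟨p, fun _ => Set.eq_singleton_iff_unique_mem.2 ⟨hp, huniq⟩⟩
    · exact ⟨0, fun h => absurd h hx⟩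
  choose pt hpt using hpt
  set T : Finset (Finset (Set (ℝ × ℝ))) := A.powerset.filter fun C => A.card ≤ C.card ^ 2
  have hT : T.attach.Nonempty := by
    rw [Finset.attach_nonempty_iff]
    exact ⟨A, Finset.mem_filter.2 ⟨Finset.mem_powerset_self A, by nlinarith⟩⟩
  have hoff : ∀ C : T, C.1.offDiag.Nonempty := by
    intro C
    have hC := (Finset.mem_filter.1 C.2).2
    have : 1 < C.1.card := by
      by_contra hle
      have : C.1.card ≤ 1 := not_lt.1 hle
      nlinarith
    obtain ⟨a, ha, b, hb, hab⟩ := Finset.one_lt_card.1 this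
    exact ⟨(a, b), Finset.mem_offDiag.2 ⟨ha, hb, hab⟩⟩
  refine ⟨fun θ => T.attach.inf' hT fun C => C.1.offDiag.sup' (hoff C) fun x => height θ (pt x),
    ?_, fun θ t => ?_⟩
  · refine Continuous.finset_inf'_apply hT fun C _ => ?_
    exact Continuous.finset_sup'_apply (hoff C) fun x _ => continuous_height_left (pt x)
  · simp only [Finset.inf'_le_iff, Finset.sup'_le_iff, Finset.mem_attach, true_and]
    constructor
    · rintro ⟨C, hC⟩
      obtain ⟨hCA, hcard⟩ := Finset.mem_filter.1 C.2
      refine ⟨C.1, Finset.mem_powerset.1 hCA, hcard, ?_⟩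
      rintro p ⟨ℓ₁, h₁, ℓ₂, h₂, hne, hp⟩
      have hmem : (ℓ₁, ℓ₂) ∈ C.1.offDiag := Finset.mem_offDiag.2 ⟨h₁, h₂, hne⟩
      have := hpt (ℓ₁, ℓ₂) (Finset.offDiag_mono (Finset.mem_powerset.1 hCA) hmem)
      have hpeq : p = pt (ℓ₁, ℓ₂) := by
        rw [← Set.mem_singleton_iff, ← this]; exact hp
      rw [Set.mem_ofPred_eq, hpeq]
      exact hC _ hmem
    · rintro ⟨C, hCA, hcard, hC⟩
      refine ⟨⟨C, Finset.mem_filter.2 ⟨Finset.mem_powerset.2 hCA, hcard⟩⟩, fun x hx => ?_⟩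
      have hmem : pt x ∈ x.1 ∩ x.2 := by
        rw [hpt x (Finset.offDiag_mono hCA hx)]; rfl
      obtain ⟨h₁, h₂, hne⟩ := Finset.mem_offDiag.1 hx
      exact hC ⟨x.1, h₁, x.2, h₂, hne, hmem⟩

/-- For every direction one can choose, continuously and equivariantly under the antipodal map,
a line with that normal direction both of whose closed sides enclose at least `√#A` lines. -/
theorem exists_continuous_odd_splitting (A : Finset (Set (ℝ × ℝ)))
    (hlines : ∀ ℓ ∈ A, IsLine ℓ) (hpar : PairwiseNonParallel A) :
    ∃ m : ℝ → ℝ, Continuous m ∧ (∀ θ, m (θ + Real.pi) = -m θ) ∧ ∀ θ,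
      (∃ C ⊆ A, A.card ≤ C.card ^ 2 ∧ incSet C ⊆ {p | height θ p ≤ m θ}) ∧
      (∃ D ⊆ A, A.card ≤ D.card ^ 2 ∧ incSet D ⊆ {p | m θ ≤ height θ p}) := by
  rcases lt_or_ge A.card 2 with hA | hA
  · have hemp : ∀ K, incSet A ⊆ K := by
      rintro K p ⟨ℓ₁, h₁, ℓ₂, h₂, hne, -⟩
      exact absurd (Finset.card_le_one.1 (Nat.lt_succ_iff.1 hA) ℓ₁ h₁ ℓ₂ h₂) hne
    have hcard : A.card ≤ A.card ^ 2 := Nat.le_self_pow two_ne_zero _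
    exact ⟨fun _ => 0, continuous_const, fun _ => by simp, fun θ =>
      ⟨⟨A, subset_rfl, hcard, hemp _⟩, ⟨A, subset_rfl, hcard, hemp _⟩⟩⟩
  obtain ⟨F, hFc, hF⟩ := exists_continuous_threshold A hpar hA
  have hper : ∀ θ, F (θ + Real.pi + Real.pi) = F θ := by
    intro θ
    have hle : ∀ t, F (θ + Real.pi + Real.pi) ≤ t ↔ F θ ≤ t := by
      intro t; simp only [hF, height_add_pi, neg_neg]
    exact le_antisymm ((hle _).2 le_rfl) ((hle _).1 le_rfl)
  have hgap : ∀ θ, F θ ≤ -F (θ + Real.pi) := by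
    intro θ
    by_contra! hlt
    obtain ⟨t, ht₁, ht₂⟩ := exists_between hlt
    obtain ⟨C, hC, D, hD, hCt, hDt, hcard⟩ := exists_enclosed_card_le_mul θ t A hlines hpar
    rcases le_total D.card C.card with h | h
    · exact absurd ((hF θ t).2 ⟨C, hC, by nlinarith, hCt⟩) (not_le.2 ht₂)
    · have := (hF (θ + Real.pi) (-t)).2 ⟨D, hD, by nlinarith, fun p hp => by
        simpa [height_add_pi] using hDt hp⟩
      linarith
  refine ⟨fun θ => (F θ - F (θ + Real.pi)) / 2, by fun_prop, fun θ => ?_, fun θ => ⟨?_, ?_⟩⟩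
  · simp only [hper]; ring
  · exact (hF θ _).1 (by linarith [hgap θ])
  · obtain ⟨D, hD, hcard, hDt⟩ := (hF (θ + Real.pi) (-((F θ - F (θ + Real.pi)) / 2))).1
      (by linarith [hgap θ])
    exact ⟨D, hD, hcard, fun p hp => by simpa [height_add_pi] using hDt hp⟩

/-- The Dujmović–Langerman ham-sandwich theorem for two families of lines in the plane. -/
theorem exists_ham_sandwich_line (A B : Finset (Set (ℝ × ℝ)))
    (hlA : ∀ ℓ ∈ A, IsLine ℓ) (hlB : ∀ ℓ ∈ B, IsLine ℓ)
    (hpA : PairwiseNonParallel A) (hpB : PairwiseNonParallel B) :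
    ∃ θ t : ℝ,
      ((∃ C ⊆ A, A.card ≤ C.card ^ 2 ∧ incSet C ⊆ {p | height θ p ≤ t}) ∧
        (∃ D ⊆ A, A.card ≤ D.card ^ 2 ∧ incSet D ⊆ {p | t ≤ height θ p})) ∧
      ((∃ C ⊆ B, B.card ≤ C.card ^ 2 ∧ incSet C ⊆ {p | height θ p ≤ t}) ∧
        (∃ D ⊆ B, B.card ≤ D.card ^ 2 ∧ incSet D ⊆ {p | t ≤ height θ p})) := by
  obtain ⟨f, hf, hfodd, hfA⟩ := exists_continuous_odd_splitting A hlA hpA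
  obtain ⟨g, hg, hgodd, hgB⟩ := exists_continuous_odd_splitting B hlB hpB
  obtain ⟨θ, hθ⟩ : ∃ θ, f θ - g θ = 0 := by
    have h0 := hfodd 0
    have h1 := hgodd 0
    refine mem_range_of_exists_le_of_exists_ge (hf.sub hg) ?_ ?_ <;>
      rcases le_total (f 0) (g 0) with h | h
    · exact ⟨0, by linarith⟩
    · exact ⟨0 + Real.pi, by linarith⟩
    · exact ⟨0 + Real.pi, by linarith⟩
    · exact ⟨0, by linarith⟩
  have hfg : f θ = g θ := sub_eq_zero.1 hθ
  exact ⟨θ, f θ, hfA θ, hfg ▸ hgB θ⟩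

theorem interior_halfPlane_inter_interior_halfPlane (θ t : ℝ) :
    interior {p | height θ p ≤ t} ∩ interior {p | t ≤ height θ p} = ∅ := by
  rw [← interior_inter, Set.eq_empty_iff_forall_notMem]
  intro p hp
  have hcont : Filter.Tendsto (fun ε : ℝ => p + ε • (Real.cos θ, Real.sin θ)) (nhds 0)
      (nhds p) := by
    have : Continuous fun ε : ℝ => p + ε • (Real.cos θ, Real.sin θ) := by fun_prop
    simpa using this.tendsto 0
  have hev := hcont.eventually (mem_interior_iff_mem_nhds.1 hp)
  obtain ⟨ε, hε, hpos⟩ := ((hev.filter_mono nhdsWithin_le_nhds).and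
    (self_mem_nhdsWithin : Set.Ioi (0 : ℝ) ∈ nhdsWithin 0 (Set.Ioi 0))).exists
  have hle := hε.1
  have hp0 := (interior_subset hp).2
  simp only [Set.mem_ofPred_eq, height_add_smul] at hle hp0
  linarith

theorem rpow_half_mul_le {n m : ℕ} (h : n ≤ m ^ 2) (k : ℕ) :
    (n : ℝ) ^ ((1 : ℝ) / (2 ^ (k + 1) : ℕ)) ≤ (m : ℝ) ^ ((1 : ℝ) / (2 ^ k : ℕ)) := by
  have hexp : (1 : ℝ) / (2 ^ k : ℕ) = (2 : ℕ) * (1 / (2 ^ (k + 1) : ℕ)) := by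
    push_cast; field_simp; ring
  rw [hexp, Real.rpow_mul (Nat.cast_nonneg m), Real.rpow_natCast]
  exact Real.rpow_le_rpow (Nat.cast_nonneg n) (mod_cast h) (by positivity)

/-- Gluing convex partitions along a line: intersect the first with one closed side of the line
and the second with the other. -/
theorem convexPartition_halfPlanes {r r₁ r₂ : ℕ} (e : Fin r₁ ⊕ Fin r₂ ≃ Fin r) (θ t : ℝ)
    {P : Fin r₁ → Set (ℝ × ℝ)} {Q : Fin r₂ → Set (ℝ × ℝ)}
    (hP : ConvexPartition P) (hQ : ConvexPartition Q) :
    ConvexPartition fun j => Sum.elim (fun i => P i ∩ {p | height θ p ≤ t})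
      (fun i => Q i ∩ {p | t ≤ height θ p}) (e.symm j) := by
  obtain ⟨hPc, hPx, hPu, hPd⟩ := hP
  obtain ⟨hQc, hQx, hQu, hQd⟩ := hQ
  have hdisj := interior_halfPlane_inter_interior_halfPlane θ t
  refine ⟨fun j => ?_, fun j => ?_, ?_, fun i j hij => ?_⟩
  · dsimp only
    rcases e.symm j with i | i
    · exact (hPc i).inter (isClosed_le (continuous_height θ) continuous_const)
    · exact (hQc i).inter (isClosed_le continuous_const (continuous_height θ))
  · dsimp only
    rcases e.symm j with i | i
    · exact (hPx i).inter (convex_halfSpace_le (isLinearMap_height θ) t)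
    · exact (hQx i).inter (convex_halfSpace_ge (isLinearMap_height θ) t)
  · refine Set.eq_univ_of_forall fun p => Set.mem_iUnion.2 ?_
    rcases le_total (height θ p) t with h | h
    · obtain ⟨i, hi⟩ := Set.mem_iUnion.1 (hPu.symm ▸ Set.mem_univ p)
      exact ⟨e (Sum.inl i), by simpa using ⟨hi, h⟩⟩
    · obtain ⟨i, hi⟩ := Set.mem_iUnion.1 (hQu.symm ▸ Set.mem_univ p)
      exact ⟨e (Sum.inr i), by simpa using ⟨hi, h⟩⟩
  · have hne : e.symm i ≠ e.symm j := e.symm.injective.ne hij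
    refine Set.subset_empty_iff.1 ?_
    revert hne
    dsimp only
    generalize e.symm i = a
    generalize e.symm j = b
    intro hne
    rcases a with a | a <;> rcases b with b | b <;> simp only [Sum.elim_inl, Sum.elim_inr]
    · rw [← hPd fun h => hne (congrArg Sum.inl h)]
      gcongr <;> exact Set.inter_subset_left
    · rw [← hdisj]
      gcongr <;> exact Set.inter_subset_right
    · rw [← hdisj, Set.inter_comm]
      gcongr <;> exact Set.inter_subset_right
    · rw [← hQd fun h => hne (congrArg Sum.inr h)]
      gcongr <;> exact Set.inter_subset_left

/-- Repeated application of the Dujmović–Langerman theorem: for `r = 2^k` a power of two,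
there is a convex partition into `r` parts where each part encloses at least `|A|^{1/r}`
lines of `A` and at least `|B|^{1/r}` lines of `B`. -/
theorem power_of_two_partition (k : ℕ) (A B : Finset (Set (ℝ × ℝ)))
    (hA : A.Nonempty) (hB : B.Nonempty)
    (hlines : ∀ ℓ ∈ A ∪ B, IsLine ℓ) (hpar : PairwiseNonParallel (A ∪ B)) :
    ∃ C : Fin (2 ^ k) → Set (ℝ × ℝ), ConvexPartition C ∧
      ∀ j : Fin (2 ^ k),
        (∃ A' ⊆ A, incSet A' ⊆ C j ∧
          (A.card : ℝ) ^ ((1 : ℝ) / (2 ^ k : ℕ)) ≤ (A'.card : ℝ)) ∧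
        (∃ B' ⊆ B, incSet B' ⊆ C j ∧
          (B.card : ℝ) ^ ((1 : ℝ) / (2 ^ k : ℕ)) ≤ (B'.card : ℝ)) := by
  have hlA : ∀ ℓ ∈ A, IsLine ℓ := fun ℓ h => hlines ℓ (Finset.mem_union_left B h)
  have hlB : ∀ ℓ ∈ B, IsLine ℓ := fun ℓ h => hlines ℓ (Finset.mem_union_right A h)
  have hpA : PairwiseNonParallel A := hpar.mono Finset.subset_union_left
  have hpB : PairwiseNonParallel B := hpar.mono Finset.subset_union_right
  clear hA hB hlines hpar
  induction k generalizing A B with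
  | zero =>
    refine ⟨fun _ => Set.univ, ⟨fun _ => isClosed_univ, fun _ => convex_univ, ?_, ?_⟩, fun _ =>
      ⟨⟨A, subset_rfl, Set.subset_univ _, by simp⟩, ⟨B, subset_rfl, Set.subset_univ _, by simp⟩⟩⟩
    · exact Set.iUnion_const _
    · exact fun i j hij => absurd (Fin.ext (by omega)) hij
  | succ k ih =>
    obtain ⟨θ, t, ⟨⟨A₁, hA₁, hcA₁, hiA₁⟩, ⟨A₂, hA₂, hcA₂, hiA₂⟩⟩,
      ⟨⟨B₁, hB₁, hcB₁, hiB₁⟩, ⟨B₂, hB₂, hcB₂, hiB₂⟩⟩⟩ :=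
      exists_ham_sandwich_line A B hlA hlB hpA hpB
    obtain ⟨P, hP, hPe⟩ := ih A₁ B₁ (fun ℓ h => hlA ℓ (hA₁ h)) (fun ℓ h => hlB ℓ (hB₁ h))
      (hpA.mono hA₁) (hpB.mono hB₁)
    obtain ⟨Q, hQ, hQe⟩ := ih A₂ B₂ (fun ℓ h => hlA ℓ (hA₂ h)) (fun ℓ h => hlB ℓ (hB₂ h))
      (hpA.mono hA₂) (hpB.mono hB₂)
    have e : Fin (2 ^ k) ⊕ Fin (2 ^ k) ≃ Fin (2 ^ (k + 1)) :=
      finSumFinEquiv.trans (finCongr (by ring))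
    refine ⟨_, convexPartition_halfPlanes e θ t hP hQ, fun j => ?_⟩
    rcases e.symm j with i | i
    · obtain ⟨⟨A', hA', hiA', hcA'⟩, ⟨B', hB', hiB', hcB'⟩⟩ := hPe i
      exact ⟨⟨A', hA'.trans hA₁, Set.subset_inter hiA' ((incSet_mono hA').trans hiA₁),
          (rpow_half_mul_le hcA₁ k).trans hcA'⟩,
        ⟨B', hB'.trans hB₁, Set.subset_inter hiB' ((incSet_mono hB').trans hiB₁),
          (rpow_half_mul_le hcB₁ k).trans hcB'⟩⟩
    · obtain ⟨⟨A', hA', hiA', hcA'⟩, ⟨B', hB', hiB', hcB'⟩⟩ := hQe i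
      exact ⟨⟨A', hA'.trans hA₂, Set.subset_inter hiA' ((incSet_mono hA').trans hiA₂),
          (rpow_half_mul_le hcA₂ k).trans hcA'⟩,
        ⟨B', hB'.trans hB₂, Set.subset_inter hiB' ((incSet_mono hB').trans hiB₂),
          (rpow_half_mul_le hcB₂ k).trans hcB'⟩⟩
end
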